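/- arXiv:1305.5193 — 8 statements merged into one kernel-verified Lean document; each statement's English description precedes it below -/
import Mathlib

section
/- Let Ω ⊂ ℂ be a nonempty bounded simply connected open set, and let h be holomorphic on Ω with ∫_Ω |h(z)|² dxdy < ∞. Then there exists a holomorphic function g on Ω such that the function u(z) := conj(z)·h(z) − g(z) satisfies ∂̄u = h on Ω (where ∂̄ = (∂/∂x + i ∂/∂y)/2) and ∫_Ω |u(z)|² dxdy ≤ (Area(Ω)/(2π)) ∫_Ω |h(z)|² dxdy, where Area(Ω) is the Lebesgue measure of Ω. -/
open MeasureTheory Complex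

theorem integral_ball_pow_mul_conj_pow (a b : ℕ) {r : ℝ} (hr : 0 ≤ r) :
    ∫ z in Metric.ball (0 : ℂ) r, z ^ a * (starRingEnd ℂ) z ^ b =
      if a = b then (Real.pi * r ^ (2 * a + 2) / (a + 1) : ℂ) else 0 := by
  rw [← integral_indicator Metric.isOpen_ball.measurableSet,
    ← Complex.integral_comp_polarCoord_symm]
  have key : ∀ p ∈ polarCoord.target,
      p.1 • (Metric.ball (0 : ℂ) r).indicator (fun z => z ^ a * (starRingEnd ℂ) z ^ b)
        (Complex.polarCoord.symm p) =
      ((Set.Ioo 0 r).indicator (fun t : ℝ => ((t : ℂ) ^ (a + b + 1))) p.1) *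
        cexp (((a : ℂ) - b) * I * p.2) := by
    rintro ⟨t, θ⟩ ht
    simp only [polarCoord_target, Set.mem_prod, Set.mem_Ioi] at ht
    have ht0 : 0 < t := ht.1
    by_cases h : t < r
    · rw [Set.indicator_of_mem (by simpa [abs_of_pos ht0] using h),
        Set.indicator_of_mem (show t ∈ Set.Ioo 0 r from ⟨ht0, h⟩)]
      have e : Complex.polarCoord.symm (t, θ) = t * cexp (θ * I) := by
        rw [Complex.polarCoord_symm_apply, Complex.exp_mul_I]; push_cast; rfl
      have e' : (starRingEnd ℂ) (cexp (θ * I)) = cexp (-(θ * I)) := by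
        rw [← Complex.exp_conj]; simp
      have e3 : cexp (((a : ℂ) - b) * I * θ) = cexp (θ * I) ^ a * cexp (-(θ * I)) ^ b := by
        rw [← Complex.exp_nat_mul, ← Complex.exp_nat_mul, ← Complex.exp_add]; ring_nf
      rw [e, map_mul, Complex.conj_ofReal, e', e3, Complex.real_smul]
      ring
    · rw [Set.indicator_of_notMem (by simpa [abs_of_pos ht0] using h),
        Set.indicator_of_notMem (show t ∉ Set.Ioo 0 r from fun h' => h h'.2)]
      simp
  rw [setIntegral_congr_fun polarCoord.open_target.measurableSet key, polarCoord_target,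
    Measure.volume_eq_prod,
    setIntegral_prod_mul (fun t : ℝ => (Set.Ioo 0 r).indicator
      (fun t : ℝ => ((t : ℂ) ^ (a + b + 1))) t)
      (fun θ : ℝ => cexp (((a : ℂ) - b) * I * θ)), setIntegral_indicator measurableSet_Ioo,
      Set.inter_eq_right.mpr Set.Ioo_subset_Ioi_self, ← integral_Ioc_eq_integral_Ioo,
      ← integral_Ioc_eq_integral_Ioo, ← intervalIntegral.integral_of_le hr,
      ← intervalIntegral.integral_of_le (by linarith [Real.pi_pos])]
  have h1 : ∫ t in (0:ℝ)..r, (t : ℂ) ^ (a + b + 1) = r ^ (a + b + 2) / (a + b + 2) := by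
    have : ∀ t : ℝ, (t : ℂ) ^ (a + b + 1) = ((t ^ (a + b + 1) : ℝ) : ℂ) := by
      intro t
      push_cast
      rfl
    simp_rw [this]
    rw [intervalIntegral.integral_ofReal, integral_pow]
    push_cast
    rw [zero_pow (by omega)]
    ring
  rw [h1]
  split_ifs with hab
  · subst hab
    have : (a : ℂ) + 1 ≠ 0 := by exact_mod_cast Nat.succ_ne_zero a
    rw [show (a : ℂ) + a + 2 = 2 * (a + 1) by ring]
    simp
    field_simp
    ring
  · have hc : ((a : ℂ) - b) * I ≠ 0 :=
      mul_ne_zero (sub_ne_zero.mpr (by exact_mod_cast hab)) I_ne_zero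
    rw [integral_exp_mul_complex hc]
    have : cexp (((a : ℂ) - b) * I * (Real.pi : ℝ)) =
        cexp (((a : ℂ) - b) * I * ((-Real.pi : ℝ))) := by
      rw [Complex.exp_eq_exp_iff_exists_int]
      refine ⟨a - b, ?_⟩
      push_cast
      ring
    rw [this]
    simp


theorem sum_range_schur_kernel (n k : ℕ) :
    ∑ i ∈ Finset.range (n + k + 1),
      (if n + k ≤ n + i then (k : ℝ) * ((n + k - i : ℕ) : ℝ) else ((n : ℝ) + 1) * ((i : ℝ) + 1)) =
      (n + k + 1) * ((n + 1) * k) / 2 := by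
  rw [show n + k + 1 = k + (n + 1) by ring, Finset.sum_range_add]
  have h1 : ∀ m : ℕ, ∑ i ∈ Finset.range m, ((i : ℝ) + 1) = m * (m + 1) / 2 := by
    intro m
    induction m with
    | zero => simp
    | succ m ih => rw [Finset.sum_range_succ, ih]; push_cast; ring
  have h2 : ∀ m : ℕ, ∑ i ∈ Finset.range (m + 1), ((m - i : ℕ) : ℝ) = m * (m + 1) / 2 := by
    intro m
    rw [← Finset.sum_range_reflect, Finset.sum_range_succ', ← h1]
    simp only [Nat.add_sub_cancel]
    rw [Nat.sub_zero, Nat.sub_self, Nat.cast_zero, add_zero]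
    refine Finset.sum_congr rfl fun i hi => ?_
    have := Finset.mem_range.mp hi
    rw [show m - (m - (i + 1)) = i + 1 by omega]; push_cast; rfl
  have e1 : ∀ i ∈ Finset.range k, (if n + k ≤ n + i then (k : ℝ) * ((n + k - i : ℕ) : ℝ)
      else ((n : ℝ) + 1) * ((i : ℝ) + 1)) = ((n : ℝ) + 1) * ((i : ℝ) + 1) := by
    intro i hi
    rw [if_neg]
    have := Finset.mem_range.mp hi
    omega
  have e2 : ∀ i ∈ Finset.range (n + 1), (if n + k ≤ n + (k + i) then
      (k : ℝ) * ((n + k - (k + i) : ℕ) : ℝ)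
      else ((n : ℝ) + 1) * (((k + i : ℕ) : ℝ) + 1)) = k * ((n - i : ℕ) : ℝ) := by
    intro i hi
    rw [if_pos (by omega), show n + k - (k + i) = n - i by omega]
  rw [Finset.sum_congr rfl e1, Finset.sum_congr rfl e2, ← Finset.mul_sum, ← Finset.mul_sum, h1, h2]
  ring

/-- The Gram matrix, divided by `π`, of the components of `z ^ p.1 * conj z ^ p.2` orthogonal to the
Bergman space of the unit disc. -/
noncomputable def hankelWeight (p q : ℕ × ℕ) : ℝ :=
  if p.1 + q.2 = q.1 + p.2 then
    (if p.2 ≤ p.1 then (p.2 * q.2 : ℝ) / ((p.1 + 1) * (q.1 + 1)) else 1) / (p.1 + q.2 + 1)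
  else 0

theorem hankelWeight_nonneg (p q : ℕ × ℕ) : 0 ≤ hankelWeight p q := by
  unfold hankelWeight
  split_ifs <;> positivity

theorem hankelWeight_symm (n k n' k' : ℕ) :
    hankelWeight (n, k) (n', k') = hankelWeight (n', k') (n, k) := by
  unfold hankelWeight
  by_cases h : n + k' = n' + k
  · have : (n : ℝ) + k' = n' + k := by exact_mod_cast h
    by_cases h' : k ≤ n
    · have h'' : k' ≤ n' := by omega
      simp only [h, h', h'', if_true, this]; ring
    · have h'' : ¬ k' ≤ n' := by omega
      simp only [h, h', h'', if_true, if_false, this]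
  · simp [h, Ne.symm h]

theorem sum_hankelWeight_le (N n k' : ℕ) :
    ∑ q ∈ Finset.range N ×ˢ Finset.range N,
      ((n + 1 : ℝ) * (q.1 + 1)) * hankelWeight (n, q.2) (q.1, k') ≤ (n + 1) * k' / 2 := by
  have hsum := sum_range_schur_kernel n k'
  have hpos : (0 : ℝ) < n + k' + 1 := by positivity
  have hT : ∀ q ∈ Finset.HasAntidiagonal.antidiagonal (n + k'),
      ((n + 1 : ℝ) * (q.1 + 1)) * hankelWeight (n, q.2) (q.1, k') =
      (if n + k' ≤ n + q.1 then (k' : ℝ) * ((n + k' - q.1 : ℕ) : ℝ)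
        else ((n : ℝ) + 1) * ((q.1 : ℝ) + 1)) / (n + k' + 1) := by
    rintro ⟨i, j⟩ hij
    have hij : i + j = n + k' := by simpa using hij
    unfold hankelWeight
    simp only [hij, if_true]
    rw [show n + k' - i = j by omega]
    by_cases h : j ≤ n
    · have h' : n + k' ≤ n + i := by omega
      simp only [h, h', if_true]
      field_simp
    · have h' : ¬ n + k' ≤ n + i := by omega
      simp only [h, h', if_false]
      field_simp
  calc _ ≤ ∑ q ∈ Finset.HasAntidiagonal.antidiagonal (n + k'),
      ((n + 1 : ℝ) * (q.1 + 1)) * hankelWeight (n, q.2) (q.1, k') := by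
        rw [← Finset.sum_filter_of_ne
          (p := fun q => q ∈ Finset.HasAntidiagonal.antidiagonal (n + k'))]
        · refine Finset.sum_le_sum_of_subset_of_nonneg
            (fun q hq => (Finset.mem_filter.mp hq).2) fun q _ _ => ?_
          exact mul_nonneg (by positivity) (hankelWeight_nonneg _ _)
        · intro q _ hq
          by_contra hc
          apply hq
          rw [Finset.HasAntidiagonal.mem_antidiagonal] at hc
          unfold hankelWeight
          rw [if_neg (fun h => hc h.symm), mul_zero]
    _ = (∑ i ∈ Finset.range (n + k' + 1), (if n + k' ≤ n + i then (k' : ℝ) * ((n + k' - i : ℕ) : ℝ)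
        else ((n : ℝ) + 1) * ((i : ℝ) + 1))) / (n + k' + 1) := by
        rw [Finset.sum_congr rfl hT, Finset.sum_div,
          Finset.Nat.sum_antidiagonal_eq_sum_range_succ_mk]
    _ ≤ _ := by rw [hsum]; apply le_of_eq; field_simp

theorem hankel_schur_bound (N : ℕ) (x y : ℕ → ℝ) :
    ∑ p ∈ Finset.range N ×ˢ Finset.range N, ∑ q ∈ Finset.range N ×ˢ Finset.range N,
      (x p.1 * y p.2) * (x q.1 * y q.2) * hankelWeight p q ≤
    (∑ n ∈ Finset.range N, x n ^ 2 / (n + 1)) * (∑ k ∈ Finset.range N, k * y k ^ 2) / 2 := by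
  set R := Finset.range N with hR
  have hswap : ∀ F : ℕ → ℕ → ℕ → ℕ → ℝ,
      ∑ p ∈ R ×ˢ R, ∑ q ∈ R ×ˢ R, F p.1 p.2 q.1 q.2 =
      ∑ p ∈ R ×ˢ R, ∑ q ∈ R ×ˢ R, F p.1 q.2 q.1 p.2 := by
    intro F
    simp only [Finset.sum_product]
    refine Finset.sum_congr rfl fun n _ => ?_
    rw [Finset.sum_comm' (t' := R) (s' := fun _ => R) (by tauto)]
    conv_rhs => rw [Finset.sum_comm]
    refine Finset.sum_congr rfl fun i _ => ?_
    rw [Finset.sum_comm]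
  let z : ℕ × ℕ → ℝ := fun p => x p.1 * y p.2 / (p.1 + 1)
  let K : ℕ × ℕ → ℕ × ℕ → ℝ := fun p q =>
    ((p.1 + 1 : ℝ) * (q.1 + 1)) * hankelWeight (p.1, q.2) (q.1, p.2)
  have hK : ∀ p q, K p q = K q p := by
    intro p q
    simp only [K]
    rw [hankelWeight_symm]; ring
  calc _ = ∑ p ∈ R ×ˢ R, ∑ q ∈ R ×ˢ R, z p * z q * K p q := by
        rw [hswap (fun a b c d => (x a * y b) * (x c * y d) * hankelWeight (a, b) (c, d))]
        refine Finset.sum_congr rfl fun p _ => Finset.sum_congr rfl fun q _ => ?_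
        simp only [z, K]
        have : (p.1 : ℝ) + 1 ≠ 0 := by positivity
        have : (q.1 : ℝ) + 1 ≠ 0 := by positivity
        field_simp
    _ ≤ ∑ p ∈ R ×ˢ R, ∑ q ∈ R ×ˢ R, (z p ^ 2 * K p q / 2 + z q ^ 2 * K q p / 2) := by
        refine Finset.sum_le_sum fun p _ => Finset.sum_le_sum fun q _ => ?_
        have : 0 ≤ K p q := mul_nonneg (by positivity) (hankelWeight_nonneg _ _)
        rw [hK q p]
        nlinarith [mul_nonneg this (sq_nonneg (z p - z q))]
    _ = ∑ p ∈ R ×ˢ R, z p ^ 2 * ∑ q ∈ R ×ˢ R, K p q := by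
        simp only [Finset.sum_add_distrib]
        conv_lhs => enter [2]; rw [Finset.sum_comm]
        rw [← Finset.sum_add_distrib]
        refine Finset.sum_congr rfl fun p _ => ?_
        rw [← Finset.sum_add_distrib, Finset.mul_sum]
        exact Finset.sum_congr rfl fun q _ => by ring
    _ ≤ ∑ p ∈ R ×ˢ R, z p ^ 2 * ((p.1 + 1) * p.2 / 2) :=
        Finset.sum_le_sum fun p _ => mul_le_mul_of_nonneg_left
          (sum_hankelWeight_le N p.1 p.2) (sq_nonneg _)
    _ = _ := by
        rw [Finset.sum_mul_sum, ← Finset.sum_product', Finset.sum_div]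
        refine Finset.sum_congr rfl fun p _ => ?_
        simp only [z]
        have : (p.1 : ℝ) + 1 ≠ 0 := by positivity
        field_simp

theorem Continuous.integrableOn_ball {E : Type*} [NormedAddCommGroup E] {f : ℂ → E}
    (hf : Continuous f) (c : ℂ) (r : ℝ) : IntegrableOn f (Metric.ball c r) :=
  (hf.continuousOn.integrableOn_compact (isCompact_closedBall c r)).mono_set
    Metric.ball_subset_closedBall

/-- The Bergman projection of the monomial `z ^ n * conj z ^ k` on the unit disc. -/
noncomputable def bergmanProjMonomial (p : ℕ × ℕ) (z : ℂ) : ℂ :=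
  if p.2 ≤ p.1 then (((p.1 - p.2 : ℕ) : ℂ) + 1) / (p.1 + 1) * z ^ (p.1 - p.2) else 0

/-- The component of `z ^ n * conj z ^ k` orthogonal to the Bergman space of the unit disc. -/
noncomputable def bergmanResidual (p : ℕ × ℕ) (z : ℂ) : ℂ :=
  z ^ p.1 * (starRingEnd ℂ) z ^ p.2 - bergmanProjMonomial p z

theorem continuous_bergmanProjMonomial (p : ℕ × ℕ) : Continuous (bergmanProjMonomial p) := by
  unfold bergmanProjMonomial
  split_ifs <;> fun_prop

theorem continuous_bergmanResidual (p : ℕ × ℕ) : Continuous (bergmanResidual p) := by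
  have := continuous_bergmanProjMonomial p
  have : Continuous (starRingEnd ℂ) := Complex.continuous_conj
  unfold bergmanResidual
  fun_prop

theorem integral_bergmanResidual_mul_conj (p q : ℕ × ℕ) :
    ∫ z in Metric.ball (0 : ℂ) 1, bergmanResidual p z * (starRingEnd ℂ) (bergmanResidual q z) =
      Real.pi * hankelWeight p q := by
  obtain ⟨n, k⟩ := p
  obtain ⟨n', k'⟩ := q
  have hconj : Continuous (starRingEnd ℂ) := Complex.continuous_conj
  have hI : ∀ a b : ℕ, IntegrableOn (fun z : ℂ => z ^ a * (starRingEnd ℂ) z ^ b)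
      (Metric.ball 0 1) := fun a b => Continuous.integrableOn_ball (by fun_prop) _ _
  have hM : ∀ a b : ℕ, ∫ z in Metric.ball (0 : ℂ) 1, z ^ a * (starRingEnd ℂ) z ^ b =
      if a = b then (Real.pi / (a + 1) : ℂ) else 0 := by
    intro a b
    rw [integral_ball_pow_mul_conj_pow a b zero_le_one]
    simp
  have hn : (n : ℂ) + 1 ≠ 0 := by exact_mod_cast n.succ_ne_zero
  have hn' : (n' : ℂ) + 1 ≠ 0 := by exact_mod_cast n'.succ_ne_zero
  by_cases hk : k ≤ n <;> by_cases hk' : k' ≤ n'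
  · obtain ⟨m, rfl⟩ := Nat.exists_eq_add_of_le hk
    obtain ⟨m', rfl⟩ := Nat.exists_eq_add_of_le hk'
    have e : ∀ z : ℂ, bergmanResidual (k + m, k) z *
        (starRingEnd ℂ) (bergmanResidual (k' + m', k') z) =
        z ^ (k + m + k') * (starRingEnd ℂ) z ^ (k + (k' + m'))
        - ((m' + 1) / (k' + m' + 1) : ℂ) * (z ^ (k + m) * (starRingEnd ℂ) z ^ (k + m'))
        - ((m + 1) / (k + m + 1) : ℂ) * (z ^ (m + k') * (starRingEnd ℂ) z ^ (k' + m'))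
        + ((m + 1) / (k + m + 1) : ℂ) * ((m' + 1) / (k' + m' + 1) : ℂ) *
          (z ^ m * (starRingEnd ℂ) z ^ m') := by
      intro z
      simp [bergmanResidual, bergmanProjMonomial]
      ring
    simp_rw [e]
    rw [integral_add, integral_sub, integral_sub, integral_const_mul, integral_const_mul,
      integral_const_mul, hM, hM, hM, hM]
    any_goals exact Continuous.integrableOn_ball (by fun_prop) _ _
    unfold hankelWeight
    by_cases hmm : m = m'
    · subst hmm
      have hm : (m : ℂ) + 1 ≠ 0 := by exact_mod_cast m.succ_ne_zero
      have hs : (k : ℂ) + m + k' + 1 ≠ 0 := by exact_mod_cast (k + m + k').succ_ne_zero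
      push_cast at hn hn'
      have hn3 : (m : ℂ) + k' + 1 ≠ 0 := by rwa [add_comm (m : ℂ)]
      simp [show k + m + k' = k + (k' + m) by ring, show k' + m + k = k + (k' + m) by ring,
        show m + k' = k' + m by ring]
      have hs : (k : ℂ) + (k' + m) + 1 ≠ 0 := by exact_mod_cast (k + (k' + m)).succ_ne_zero
      have hs : (k : ℂ) + m + k' + 1 ≠ 0 := by exact_mod_cast (k + m + k').succ_ne_zero
      field_simp
      ring
    · rw [if_neg (by omega), if_neg (by omega), if_neg (by omega), if_neg (by omega),
        if_neg (by simp only; omega)]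
      simp
  · have hne : n + k' ≠ n' + k := by omega
    obtain ⟨m, rfl⟩ := Nat.exists_eq_add_of_le hk
    have e : ∀ z : ℂ, bergmanResidual (k + m, k) z *
        (starRingEnd ℂ) (bergmanResidual (n', k') z) =
        z ^ (k + m + k') * (starRingEnd ℂ) z ^ (k + n')
        - ((m + 1) / (k + m + 1) : ℂ) * (z ^ (m + k') * (starRingEnd ℂ) z ^ n') := by
      intro z
      simp [bergmanResidual, bergmanProjMonomial, hk']
      ring
    simp_rw [e]
    rw [integral_sub (hI _ _) ((hI _ _).const_mul _), integral_const_mul, hM, hM]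
    unfold hankelWeight
    rw [if_neg (by omega), if_neg (by omega), if_neg (by simpa using hne)]
    simp
  · have hne : n + k' ≠ n' + k := by omega
    obtain ⟨m', rfl⟩ := Nat.exists_eq_add_of_le hk'
    have e : ∀ z : ℂ, bergmanResidual (n, k) z *
        (starRingEnd ℂ) (bergmanResidual (k' + m', k') z) =
        z ^ (n + k') * (starRingEnd ℂ) z ^ (k + (k' + m'))
        - ((m' + 1) / (k' + m' + 1) : ℂ) * (z ^ n * (starRingEnd ℂ) z ^ (k + m')) := by
      intro z
      simp [bergmanResidual, bergmanProjMonomial, hk]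
      ring
    simp_rw [e]
    rw [integral_sub (hI _ _) ((hI _ _).const_mul _), integral_const_mul, hM, hM]
    unfold hankelWeight
    rw [if_neg (by omega), if_neg (by omega), if_neg (by simpa using hne)]
    simp
  · have e : ∀ z : ℂ, bergmanResidual (n, k) z *
        (starRingEnd ℂ) (bergmanResidual (n', k') z) =
        z ^ (n + k') * (starRingEnd ℂ) z ^ (n' + k) := by
      intro z
      simp [bergmanResidual, bergmanProjMonomial, hk, hk']
      ring
    simp_rw [e]
    rw [hM]
    unfold hankelWeight
    simp only [hk, if_false]
    split_ifs
    · push_cast; ring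
    · simp

theorem integral_norm_sq_sum_bergmanResidual_le (N : ℕ) (a c : ℕ → ℂ) :
    ∫ z in Metric.ball (0 : ℂ) 1, ‖∑ p ∈ Finset.range N ×ˢ Finset.range N,
      a p.1 * (starRingEnd ℂ) (c p.2) * bergmanResidual p z‖ ^ 2 ≤
    Real.pi * ((∑ n ∈ Finset.range N, ‖a n‖ ^ 2 / (n + 1)) *
      (∑ k ∈ Finset.range N, k * ‖c k‖ ^ 2) / 2) := by
  set S := Finset.range N ×ˢ Finset.range N
  set α : ℕ × ℕ → ℂ := fun p => a p.1 * (starRingEnd ℂ) (c p.2) with hα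
  have hc := continuous_bergmanResidual
  have hconj : Continuous (starRingEnd ℂ) := Complex.continuous_conj
  have h1 : ((∫ z in Metric.ball (0 : ℂ) 1, ‖∑ p ∈ S, α p * bergmanResidual p z‖ ^ 2 : ℝ) : ℂ) =
      ((∑ p ∈ S, ∑ q ∈ S, α p * (starRingEnd ℂ) (α q) * (Real.pi * hankelWeight p q) : ℂ)) := by
    rw [← integral_complex_ofReal]
    have e : ∀ z : ℂ, ((‖∑ p ∈ S, α p * bergmanResidual p z‖ ^ 2 : ℝ) : ℂ) =
        ∑ p ∈ S, ∑ q ∈ S, α p * (starRingEnd ℂ) (α q) *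
          (bergmanResidual p z * (starRingEnd ℂ) (bergmanResidual q z)) := by
      intro z
      push_cast
      rw [← Complex.mul_conj', map_sum, Finset.sum_mul_sum]
      refine Finset.sum_congr rfl fun p _ => Finset.sum_congr rfl fun q _ => ?_
      rw [map_mul]; ring
    have hinteg : ∀ p q, IntegrableOn (fun z => α p * (starRingEnd ℂ) (α q) *
          (bergmanResidual p z * (starRingEnd ℂ) (bergmanResidual q z))) (Metric.ball 0 1) :=
      fun p q => Continuous.integrableOn_ball (by fun_prop) _ _
    refine (integral_congr_ae (Filter.Eventually.of_forall e)).trans ?_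
    rw [integral_finsetSum _ fun p _ => integrable_finsetSum _ fun q _ => hinteg p q]
    refine Finset.sum_congr rfl fun p _ => ?_
    rw [integral_finsetSum _ fun q _ => hinteg p q]
    refine Finset.sum_congr rfl fun q _ => ?_
    rw [integral_const_mul, integral_bergmanResidual_mul_conj]
  calc _ ≤ ‖((∫ z in Metric.ball (0 : ℂ) 1, ‖∑ p ∈ S, α p * bergmanResidual p z‖ ^ 2 : ℝ) : ℂ)‖ := by
        rw [Complex.norm_real]; exact Real.le_norm_self _
    _ ≤ ∑ p ∈ S, ∑ q ∈ S, ‖α p * (starRingEnd ℂ) (α q) * (Real.pi * hankelWeight p q)‖ := by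
        rw [h1]
        exact (norm_sum_le _ _).trans (Finset.sum_le_sum fun p _ => norm_sum_le _ _)
    _ = Real.pi * ∑ p ∈ S, ∑ q ∈ S, (‖a p.1‖ * ‖c p.2‖) * (‖a q.1‖ * ‖c q.2‖) *
          hankelWeight p q := by
        simp_rw [Finset.mul_sum]
        refine Finset.sum_congr rfl fun p _ => Finset.sum_congr rfl fun q _ => ?_
        simp only [hα, norm_mul, Complex.norm_conj, Complex.norm_real,
          Real.norm_of_nonneg Real.pi_pos.le, Real.norm_of_nonneg (hankelWeight_nonneg p q)]
        ring
    _ ≤ _ := mul_le_mul_of_nonneg_left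
        (hankel_schur_bound N (fun n => ‖a n‖) fun n => ‖c n‖) Real.pi_pos.le

theorem integral_ball_norm_sq_sum_pow (a : ℕ → ℂ) (M : ℕ) {r : ℝ} (hr : 0 ≤ r) :
    ∫ z in Metric.ball (0 : ℂ) r, ‖∑ n ∈ Finset.range M, a n * z ^ n‖ ^ 2 =
      ∑ n ∈ Finset.range M, Real.pi * ‖a n‖ ^ 2 / (n + 1) * r ^ (2 * n + 2) := by
  have hconj : Continuous (starRingEnd ℂ) := Complex.continuous_conj
  have hinteg : ∀ p q, IntegrableOn (fun z : ℂ => a p * (starRingEnd ℂ) (a q) *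
      (z ^ p * (starRingEnd ℂ) z ^ q)) (Metric.ball 0 r) :=
    fun p q => Continuous.integrableOn_ball (by fun_prop) _ _
  have e : ∀ z : ℂ, ((‖∑ n ∈ Finset.range M, a n * z ^ n‖ ^ 2 : ℝ) : ℂ) =
      ∑ p ∈ Finset.range M, ∑ q ∈ Finset.range M, a p * (starRingEnd ℂ) (a q) *
        (z ^ p * (starRingEnd ℂ) z ^ q) := by
    intro z
    push_cast
    rw [← Complex.mul_conj', map_sum, Finset.sum_mul_sum]
    refine Finset.sum_congr rfl fun p _ => Finset.sum_congr rfl fun q _ => ?_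
    rw [map_mul, map_pow]; ring
  apply Complex.ofReal_injective
  rw [← integral_complex_ofReal]
  refine (integral_congr_ae (Filter.Eventually.of_forall e)).trans ?_
  rw [integral_finsetSum _ fun p _ => integrable_finsetSum _ fun q _ => hinteg p q, ofReal_sum]
  refine Finset.sum_congr rfl fun p hp => ?_
  rw [integral_finsetSum _ fun q _ => hinteg p q, Finset.sum_eq_single_of_mem p hp]
  · rw [integral_const_mul, integral_ball_pow_mul_conj_pow _ _ hr, if_pos rfl, Complex.mul_conj']
    push_cast
    ring
  · intro q _ hq
    rw [integral_const_mul, integral_ball_pow_mul_conj_pow _ _ hr, if_neg hq.symm, mul_zero]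

theorem sum_norm_sq_coeff_le_integral {f : ℂ → ℂ} {a : ℕ → ℂ}
    (hs : ∀ z ∈ Metric.ball (0 : ℂ) 1, HasSum (fun n => a n * z ^ n) (f z))
    (hf : IntegrableOn (fun z => ‖f z‖ ^ 2) (Metric.ball 0 1)) (N : ℕ) :
    ∑ n ∈ Finset.range N, ‖a n‖ ^ 2 / (n + 1) ≤
      (∫ z in Metric.ball (0 : ℂ) 1, ‖f z‖ ^ 2) / Real.pi := by
  have hr : ∀ r ∈ Set.Ioo (0 : ℝ) 1,
      ∑ n ∈ Finset.range N, Real.pi * ‖a n‖ ^ 2 / (n + 1) * r ^ (2 * n + 2) ≤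
        ∫ z in Metric.ball (0 : ℂ) 1, ‖f z‖ ^ 2 := by
    rintro r ⟨hr0, hr1⟩
    have hsum : Summable fun n => ‖a n‖ * r ^ n := by
      have := (hs r (by simpa [abs_of_pos hr0] using hr1)).summable.norm
      simpa [abs_of_pos hr0] using this
    have hbound : ∀ M, ∀ z ∈ Metric.ball (0 : ℂ) r,
        ‖∑ n ∈ Finset.range M, a n * z ^ n‖ ≤ ∑' n, ‖a n‖ * r ^ n := by
      intro M z hz
      refine (norm_sum_le _ _).trans (le_trans (Finset.sum_le_sum fun n _ => ?_)
        (hsum.sum_le_tsum _ fun n _ => by positivity))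
      rw [norm_mul, norm_pow]
      have : ‖z‖ ≤ r := by simpa using (Metric.mem_ball.mp hz).le
      gcongr
    have hlim : Filter.Tendsto (fun M => ∫ z in Metric.ball (0 : ℂ) r,
        ‖∑ n ∈ Finset.range M, a n * z ^ n‖ ^ 2) Filter.atTop
        (nhds (∫ z in Metric.ball (0 : ℂ) r, ‖f z‖ ^ 2)) := by
      refine tendsto_integral_of_dominated_convergence (fun _ => (∑' n, ‖a n‖ * r ^ n) ^ 2)
        (fun M => (Continuous.aestronglyMeasurable (by fun_prop))) ?_ (fun M => ?_) ?_
      · exact Continuous.integrableOn_ball (by fun_prop) _ _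
      · filter_upwards [ae_restrict_mem Metric.isOpen_ball.measurableSet] with z hz
        rw [norm_pow, norm_norm]
        exact pow_le_pow_left₀ (norm_nonneg _) (hbound M z hz) 2
      · filter_upwards [ae_restrict_mem Metric.isOpen_ball.measurableSet] with z hz
        exact ((hs z (Metric.ball_subset_ball hr1.le hz)).tendsto_sum_nat.norm).pow 2
    have h1 : ∑ n ∈ Finset.range N, Real.pi * ‖a n‖ ^ 2 / (n + 1) * r ^ (2 * n + 2) ≤
        ∫ z in Metric.ball (0 : ℂ) r, ‖f z‖ ^ 2 := by
      refine ge_of_tendsto hlim ?_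
      filter_upwards [Filter.eventually_ge_atTop N] with M hM
      rw [integral_ball_norm_sq_sum_pow a M hr0.le]
      refine Finset.sum_le_sum_of_subset_of_nonneg (Finset.range_subset_range.mpr hM)
        fun n _ _ => ?_
      have := Real.pi_pos
      positivity
    refine h1.trans (setIntegral_mono_set hf ?_ ?_)
    · exact Filter.Eventually.of_forall fun z => sq_nonneg _
    · exact (Metric.ball_subset_ball hr1.le).eventuallyLE
  have hlim : Filter.Tendsto (fun r : ℝ => ∑ n ∈ Finset.range N,
      Real.pi * ‖a n‖ ^ 2 / (n + 1) * r ^ (2 * n + 2)) (nhdsWithin 1 (Set.Iio 1))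
      (nhds (∑ n ∈ Finset.range N, Real.pi * ‖a n‖ ^ 2 / (n + 1) * 1 ^ (2 * n + 2))) := by
    refine Filter.Tendsto.mono_left (Continuous.tendsto ?_ 1) nhdsWithin_le_nhds
    fun_prop
  have := le_of_tendsto hlim (Filter.mem_of_superset (Ioo_mem_nhdsLT one_pos) hr)
  rw [le_div_iff₀ Real.pi_pos, Finset.sum_mul]
  refine le_trans (le_of_eq (Finset.sum_congr rfl fun n _ => ?_)) this
  ring

theorem summable_bergmanProjMonomial {a c : ℕ → ℂ}
    (ha : Summable fun n => ‖a n‖ ^ 2 / (n + 1)) (hc : Summable fun k => ‖c k‖ ^ 2)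
    {r : ℝ} (hr0 : 0 ≤ r) (hr1 : r < 1) :
    ∃ u : ℕ × ℕ → ℝ, Summable u ∧ ∀ p, ∀ z ∈ Metric.ball (0 : ℂ) r,
      ‖a p.1 * (starRingEnd ℂ) (c p.2) * bergmanProjMonomial p z‖ ≤ u p := by
  have hq : Summable fun m : ℕ => ((m : ℝ) + 1) * r ^ m := by
    have h1 := summable_pow_mul_geometric_of_norm_lt_one 1
      (show ‖r‖ < 1 by rwa [Real.norm_of_nonneg hr0])
    have h2 := summable_geometric_of_lt_one hr0 hr1
    refine (h1.add h2).congr fun m => ?_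
    simp; ring
  have hq0 : 0 ≤ fun m : ℕ => ((m : ℝ) + 1) * r ^ m := fun m => by positivity
  let v : ℕ × ℕ → ℝ := fun p => ((p.1 : ℝ) + 1) * r ^ p.1 * ‖c p.2‖ ^ 2 +
    ((p.1 : ℝ) + 1) * r ^ p.1 * (‖a (p.1 + p.2)‖ ^ 2 / (((p.1 + p.2 : ℕ) : ℝ) + 1))
  have hv : Summable v := by
    refine Summable.add (Summable.mul_of_nonneg hq hc hq0 fun k => sq_nonneg ‖c k‖) ?_
    have h1 := Summable.mul_of_nonneg hq ha hq0 fun n =>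
      div_nonneg (sq_nonneg ‖a n‖) (by positivity)
    have hinj : Function.Injective fun p : ℕ × ℕ => (p.1, p.1 + p.2) := by
      rintro ⟨m, k⟩ ⟨m', k'⟩ h
      simp only [Prod.mk.injEq] at h ⊢
      omega
    have h2 := h1.comp_injective hinj
    simpa only [Function.comp_def] using h2
  let e : ℕ × ℕ → ℕ × ℕ := fun p => (p.1 + p.2, p.2)
  have he : Function.Injective e := by
    rintro ⟨m, k⟩ ⟨m', k'⟩ h
    simp only [e, Prod.mk.injEq] at h ⊢
    omega
  let u : ℕ × ℕ → ℝ := fun p => if p.2 ≤ p.1 then v (p.1 - p.2, p.2) else 0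
  refine ⟨u, ?_, ?_⟩
  · rw [← he.summable_iff]
    · refine hv.congr fun p => ?_
      simp [u, e]
    · rintro ⟨n, k⟩ hp
      refine if_neg fun h => hp ⟨(n - k, k), ?_⟩
      simp only [e]
      simp only at h
      rw [Nat.sub_add_cancel h]
  · rintro ⟨n, k⟩ z hz
    have hz : ‖z‖ ≤ r := by simpa using (Metric.mem_ball.mp hz).le
    by_cases h : k ≤ n
    · obtain ⟨m, rfl⟩ := Nat.exists_eq_add_of_le' h
      simp only [u, v, bergmanProjMonomial, h, if_true, Nat.add_sub_cancel, norm_mul, norm_div,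
        norm_pow, Complex.norm_conj]
      have h1 : ‖((m : ℕ) : ℂ) + 1‖ = m + 1 := by
        have := Complex.norm_natCast (m + 1); push_cast at this; exact this
      have h2 : ‖((m + k : ℕ) : ℂ) + 1‖ = (m + k : ℕ) + 1 := by
        have := Complex.norm_natCast (m + k + 1); push_cast at this ⊢; exact this
      rw [h1, h2]
      set s : ℝ := ((m + k : ℕ) : ℝ) + 1
      have hs : 1 ≤ s := by simp only [s]; linarith [Nat.cast_nonneg (α := ℝ) (m + k)]
      have hs0 : 0 < s := by linarith
      have hx := norm_nonneg (a (m + k))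
      have hy := norm_nonneg (c k)
      have h3 : ‖a (m + k)‖ * ‖c k‖ / s ≤ ‖c k‖ ^ 2 + ‖a (m + k)‖ ^ 2 / s := by
        rw [div_le_iff₀ hs0, add_mul, div_mul_cancel₀ _ hs0.ne']
        nlinarith [sq_nonneg (‖a (m + k)‖ - ‖c k‖), sq_nonneg ‖c k‖,
          mul_nonneg (sub_nonneg.mpr hs) (sq_nonneg ‖c k‖)]
      calc ‖a (m + k)‖ * ‖c k‖ * ((m + 1) / s * ‖z‖ ^ m)
          = (‖a (m + k)‖ * ‖c k‖ / s) * ((m + 1) * ‖z‖ ^ m) := by ring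
        _ ≤ (‖c k‖ ^ 2 + ‖a (m + k)‖ ^ 2 / s) * ((m + 1) * r ^ m) := by gcongr
        _ = _ := by ring
    · simp [u, bergmanProjMonomial, h]

theorem hasSum_taylor_unit_ball {f : ℂ → ℂ} (hf : DifferentiableOn ℂ f (Metric.ball 0 1))
    {z : ℂ} (hz : z ∈ Metric.ball (0 : ℂ) 1) :
    HasSum (fun n : ℕ => ((n.factorial : ℂ)⁻¹ * iteratedDeriv n f 0) * z ^ n) (f z) := by
  have := Complex.hasSum_taylorSeries_on_ball hf hz
  convert! this using 2 with n
  simp only [sub_zero, smul_eq_mul]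
  ring

theorem exists_bergman_correction_unit_ball {φ f : ℂ → ℂ}
    (hφ : DifferentiableOn ℂ φ (Metric.ball 0 1)) (hf : DifferentiableOn ℂ f (Metric.ball 0 1))
    (hφ2 : IntegrableOn (fun z => ‖deriv φ z‖ ^ 2) (Metric.ball 0 1))
    (hf2 : IntegrableOn (fun z => ‖f z‖ ^ 2) (Metric.ball 0 1)) :
    ∃ G : ℂ → ℂ, DifferentiableOn ℂ G (Metric.ball 0 1) ∧
      ∫⁻ z in Metric.ball (0 : ℂ) 1, ENNReal.ofReal (‖(starRingEnd ℂ) (φ z) * f z - G z‖ ^ 2) ≤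
        ENNReal.ofReal ((∫ z in Metric.ball (0 : ℂ) 1, ‖deriv φ z‖ ^ 2) / (2 * Real.pi) *
          ∫ z in Metric.ball (0 : ℂ) 1, ‖f z‖ ^ 2) := by
  set a : ℕ → ℂ := fun n => (n.factorial : ℂ)⁻¹ * iteratedDeriv n f 0 with ha_def
  set c : ℕ → ℂ := fun n => (n.factorial : ℂ)⁻¹ * iteratedDeriv n φ 0 with hc_def
  have ha := fun z hz => hasSum_taylor_unit_ball hf (z := z) hz
  have hc := fun z hz => hasSum_taylor_unit_ball hφ (z := z) hz
  have hd := fun z hz => hasSum_taylor_unit_ball (hφ.deriv Metric.isOpen_ball) (z := z) hz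
  set I := ∫ z in Metric.ball (0 : ℂ) 1, ‖f z‖ ^ 2
  set J := ∫ z in Metric.ball (0 : ℂ) 1, ‖deriv φ z‖ ^ 2
  have hI : ∀ N, ∑ n ∈ Finset.range N, ‖a n‖ ^ 2 / (n + 1) ≤ I / Real.pi :=
    sum_norm_sq_coeff_le_integral ha hf2
  have hJ : ∀ N, ∑ k ∈ Finset.range N, k * ‖c k‖ ^ 2 ≤ J / Real.pi := by
    intro N
    refine (Finset.sum_le_sum_of_subset_of_nonneg
      (Finset.range_subset_range.mpr (Nat.le_succ N)) fun k _ _ => by positivity).trans ?_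
    rw [Finset.sum_range_succ']
    refine le_trans (le_of_eq ?_) (sum_norm_sq_coeff_le_integral hd hφ2 N)
    rw [Nat.cast_zero, zero_mul, add_zero]
    refine Finset.sum_congr rfl fun k _ => ?_
    simp only [hc_def]
    rw [iteratedDeriv_succ', Nat.factorial_succ, norm_mul, norm_mul, norm_inv, norm_inv]
    push_cast
    rw [norm_mul]
    have h1 : ‖(k : ℂ) + 1‖ = k + 1 := by
      have := Complex.norm_natCast (k + 1); push_cast at this; exact this
    rw [h1]
    have : (k : ℝ) + 1 ≠ 0 := by positivity
    field_simp
  have hI0 : 0 ≤ I := integral_nonneg fun z => sq_nonneg _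
  have hJ0 : 0 ≤ J := integral_nonneg fun z => sq_nonneg _
  have hasum : Summable fun n => ‖a n‖ ^ 2 / (n + 1) :=
    summable_of_sum_range_le (fun n => by positivity) hI
  have hcsum : Summable fun k => ‖c k‖ ^ 2 := by
    have h1 : Summable fun k : ℕ => (k : ℝ) * ‖c k‖ ^ 2 :=
      summable_of_sum_range_le (fun n => by positivity) hJ
    rw [← summable_nat_add_iff 1] at h1 ⊢
    refine Summable.of_nonneg_of_le (fun k => sq_nonneg _) (fun k => ?_) h1
    push_cast
    nlinarith [sq_nonneg ‖c (k + 1)‖, Nat.cast_nonneg (α := ℝ) k]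
  let T : ℕ × ℕ → ℂ → ℂ := fun p z => a p.1 * (starRingEnd ℂ) (c p.2) * bergmanProjMonomial p z
  have hTd : ∀ p, Differentiable ℂ (T p) := by
    intro p
    simp only [T]
    unfold bergmanProjMonomial
    split_ifs <;> fun_prop
  have hsubball : ∀ z ∈ Metric.ball (0 : ℂ) 1, ∃ r : ℝ, 0 ≤ r ∧ r < 1 ∧
      z ∈ Metric.ball (0 : ℂ) r := by
    intro z hz
    obtain ⟨r, h1, h2⟩ := exists_between (mem_ball_zero_iff.mp hz)
    exact ⟨r, (norm_nonneg z).trans h1.le, h2, mem_ball_zero_iff.mpr h1⟩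
  refine ⟨fun z => ∑' p, T p z, ?_, ?_⟩
  · intro z hz
    obtain ⟨r, hr0, hr1, hzr⟩ := hsubball z hz
    obtain ⟨u, hu, hTu⟩ := summable_bergmanProjMonomial hasum hcsum hr0 hr1
    exact ((differentiableOn_tsum_of_summable_norm hu (fun p => (hTd p).differentiableOn)
      Metric.isOpen_ball hTu).differentiableAt (Metric.isOpen_ball.mem_nhds
        hzr)).differentiableWithinAt
  let U : ℕ → ℂ → ℂ := fun N z => ∑ p ∈ Finset.range N ×ˢ Finset.range N,
      a p.1 * (starRingEnd ℂ) (c p.2) * bergmanResidual p z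
  have hUc : ∀ N, Continuous (U N) := by
    intro N
    have := continuous_bergmanResidual
    fun_prop
  have hlim : ∀ z ∈ Metric.ball (0 : ℂ) 1, Filter.Tendsto (fun N => U N z) Filter.atTop
      (nhds ((starRingEnd ℂ) (φ z) * f z - ∑' p, T p z)) := by
    intro z hz
    have hU : ∀ N, U N z = (starRingEnd ℂ) (∑ k ∈ Finset.range N, c k * z ^ k) *
        (∑ n ∈ Finset.range N, a n * z ^ n) -
        ∑ p ∈ Finset.range N ×ˢ Finset.range N, T p z := by
      intro N
      rw [mul_comm, map_sum, Finset.sum_mul_sum, ← Finset.sum_product', ← Finset.sum_sub_distrib]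
      refine Finset.sum_congr rfl fun p _ => ?_
      simp only [T, bergmanResidual, map_mul, map_pow]
      ring
    simp_rw [hU]
    obtain ⟨r, hr0, hr1, hzr⟩ := hsubball z hz
    obtain ⟨u, hu, hTu⟩ := summable_bergmanProjMonomial hasum hcsum hr0 hr1
    have hTs : HasSum (fun p => T p z) (∑' p, T p z) :=
      (Summable.of_norm_bounded hu fun p => hTu p z hzr).hasSum
    refine Filter.Tendsto.sub (Filter.Tendsto.mul ?_ (ha z hz).tendsto_sum_nat) ?_
    · exact (Complex.continuous_conj.tendsto _).comp (hc z hz).tendsto_sum_nat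
    · refine hTs.comp ?_
      refine Filter.tendsto_atTop_finset_of_monotone ?_ ?_
      · intro N M hNM
        exact Finset.product_subset_product (Finset.range_subset_range.mpr hNM)
          (Finset.range_subset_range.mpr hNM)
      · rintro ⟨n, k⟩
        exact ⟨n + k + 1, by simp⟩
  have hbound : ∀ N, ∫⁻ z in Metric.ball (0 : ℂ) 1, ENNReal.ofReal (‖U N z‖ ^ 2) ≤
      ENNReal.ofReal (J / (2 * Real.pi) * I) := by
    intro N
    have hc := hUc N
    rw [← ofReal_integral_eq_lintegral_ofReal (Continuous.integrableOn_ball (by fun_prop) _ _)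
      (Filter.Eventually.of_forall fun z => sq_nonneg _)]
    refine ENNReal.ofReal_le_ofReal ((integral_norm_sq_sum_bergmanResidual_le N a c).trans ?_)
    have hpi := Real.pi_pos
    calc _ ≤ Real.pi * ((I / Real.pi) * (J / Real.pi) / 2) := by
          have h2 : 0 ≤ ∑ k ∈ Finset.range N, (k : ℝ) * ‖c k‖ ^ 2 :=
            Finset.sum_nonneg fun k _ => by positivity
          have h3 : 0 ≤ I / Real.pi := by positivity
          exact mul_le_mul_of_nonneg_left (div_le_div_of_nonneg_right
            (mul_le_mul (hI N) (hJ N) h2 h3) zero_le_two) hpi.le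
      _ = _ := by field_simp
  calc _ = ∫⁻ z in Metric.ball (0 : ℂ) 1,
        Filter.liminf (fun N => ENNReal.ofReal (‖U N z‖ ^ 2)) Filter.atTop := by
        refine setLIntegral_congr_fun Metric.isOpen_ball.measurableSet fun z hz => ?_
        exact (Filter.Tendsto.liminf_eq
          ((ENNReal.continuous_ofReal.tendsto _).comp (((hlim z hz).norm).pow 2))).symm
    _ ≤ Filter.liminf (fun N => ∫⁻ z in Metric.ball (0 : ℂ) 1, ENNReal.ofReal (‖U N z‖ ^ 2))
        Filter.atTop := by
        refine lintegral_liminf_le fun N => ?_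
        have hc := hUc N
        exact ENNReal.measurable_ofReal.comp (Continuous.measurable (by fun_prop))
    _ ≤ _ := Filter.liminf_le_of_le (by isBoundedDefault) fun b hb => by
        obtain ⟨N, hN⟩ := hb.exists
        exact hN.trans (hbound N)

theorem exists_tendstoLocallyUniformlyOn_ultrafilter {ι : Type*} (l : Ultrafilter ι) {U : Set ℂ}
    (hU : IsOpen U) {F : ι → ℂ → ℂ} (hF : ∀ i, DifferentiableOn ℂ (F i) U) {C : ℝ}
    (hb : ∀ i, ∀ z ∈ U, ‖F i z‖ ≤ C) :
    ∃ f : ℂ → ℂ, TendstoLocallyUniformlyOn F f l U := by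
  have hpt : ∀ z, ∃ y, z ∈ U → Filter.Tendsto (fun i => F i z) l (nhds y) := by
    intro z
    by_cases hz : z ∈ U
    · obtain ⟨y, -, hy⟩ := (isCompact_closedBall (0 : ℂ) C).ultrafilter_le_nhds
        (l.map fun i => F i z) (by
          simp only [Filter.le_principal_iff, Ultrafilter.mem_coe, Ultrafilter.mem_map]
          exact Filter.univ_mem' fun i => by simpa using hb i z hz)
      exact ⟨y, fun _ => hy⟩
    · exact ⟨0, fun h => absurd h hz⟩
  choose f hf using hpt
  refine ⟨f, Metric.tendstoLocallyUniformlyOn_iff.mpr fun ε hε x hx => ?_⟩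
  obtain ⟨R, hR, hRU⟩ := Metric.nhds_basis_closedBall.mem_iff.mp (hU.mem_nhds hx)
  have hlip : ∀ i, ∀ y ∈ Metric.ball x (R / 2), ‖F i y - F i x‖ ≤ C / (R / 2) * ‖y - x‖ := by
    intro i y hy
    refine (convex_ball x (R / 2)).norm_image_sub_le_of_norm_deriv_le (𝕜 := ℂ)
      (fun w hw => ?_) (fun w hw => ?_) (Metric.mem_ball_self (by positivity)) hy
    · exact (hF i).differentiableAt (hU.mem_nhds (hRU (Metric.ball_subset_closedBall
        (Metric.ball_subset_ball (by linarith) hw))))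
    · have hsub : Metric.closedBall w (R / 2) ⊆ U := fun v hv => hRU (by
        have h1 := Metric.mem_closedBall.mp hv
        have h2 := Metric.mem_ball.mp hw
        rw [Metric.mem_closedBall]
        linarith [dist_triangle v w x])
      refine norm_deriv_le_of_forall_mem_sphere_norm_le (by positivity)
        ((hF i).mono ?_).diffContOnCl fun v hv => hb i v (hsub (Metric.sphere_subset_closedBall hv))
      exact Metric.closure_ball_subset_closedBall.trans hsub
  have hC : 0 ≤ C := by
    obtain ⟨i⟩ : Nonempty ι := (inferInstance : (l : Filter ι).NeBot).nonempty
    exact (norm_nonneg _).trans (hb i x hx)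
  obtain ⟨δ, hδ0, hδR, hδ⟩ : ∃ δ, 0 < δ ∧ δ ≤ R / 2 ∧ C / (R / 2) * δ ≤ ε / 3 := by
    refine ⟨min (R / 2) (ε / 3 / (C / (R / 2) + 1)), by positivity, min_le_left _ _, ?_⟩
    calc _ ≤ (C / (R / 2) + 1) * (ε / 3 / (C / (R / 2) + 1)) :=
          mul_le_mul (by linarith) (min_le_right _ _) (by positivity) (by positivity)
      _ = _ := mul_div_cancel₀ _ (by positivity)
  have hclose : ∀ y ∈ Metric.ball x δ, ∀ i, ‖F i y - F i x‖ ≤ ε / 3 := fun y hy i =>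
    (hlip i y (Metric.ball_subset_ball hδR hy)).trans (le_trans (mul_le_mul_of_nonneg_left
      (by simpa [dist_eq_norm] using (Metric.mem_ball.mp hy).le) (by positivity)) hδ)
  refine ⟨Metric.ball x δ, mem_nhdsWithin_of_mem_nhds (Metric.ball_mem_nhds x hδ0), ?_⟩
  have hev := (Metric.tendsto_nhds.mp (hf x hx)) (ε / 3) (by positivity)
  filter_upwards [hev] with i hi y hy
  have hyU : y ∈ U := hRU (Metric.ball_subset_closedBall
    (Metric.ball_subset_ball (by linarith) hy))
  have h1 : ‖f y - f x‖ ≤ ε / 3 :=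
    le_of_tendsto ((hf y hyU).sub (hf x hx)).norm
      (Filter.Eventually.of_forall fun i => hclose y hy i)
  have h2 := hclose y hy i
  rw [dist_eq_norm] at hi ⊢
  calc ‖f y - F i y‖ = ‖(f y - f x) - (F i x - f x) - (F i y - F i x)‖ := by ring_nf
    _ ≤ ‖f y - f x‖ + ‖F i x - f x‖ + ‖F i y - F i x‖ :=
      (norm_sub_le _ _).trans (by gcongr; exact norm_sub_le _ _)
    _ < ε := by linarith

/-- **Hurwitz's theorem**: a zero of a locally uniform limit of holomorphic functions which are
zero-free near the point cannot be isolated. -/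
theorem not_eventually_ne_zero_of_tendstoLocallyUniformlyOn {ι : Type*} {l : Filter ι} [l.NeBot]
    {U V : Set ℂ} (hU : IsOpen U) {F : ι → ℂ → ℂ} {f : ℂ → ℂ}
    (hlim : TendstoLocallyUniformlyOn F f l U) (hF : ∀ i, DifferentiableOn ℂ (F i) U)
    {a : ℂ} (ha : a ∈ U) (hV : V ∈ nhds a) (hFV : ∀ i, ∀ z ∈ V, F i z ≠ 0) (hfa : f a = 0) :
    ¬ ∀ᶠ z in nhdsWithin a {a}ᶜ, f z ≠ 0 := by
  intro hne
  have hfU : DifferentiableOn ℂ f U := hlim.differentiableOn (Filter.Eventually.of_forall hF) hU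
  rw [eventually_nhdsWithin_iff] at hne
  obtain ⟨r, hr, hrs⟩ := Metric.nhds_basis_closedBall.mem_iff.mp
    (Filter.inter_mem (Filter.inter_mem (hU.mem_nhds ha) hV) hne)
  have hrU : Metric.closedBall a r ⊆ U := fun z hz => (hrs hz).1.1
  have hsph : Metric.sphere a r ⊆ Metric.closedBall a r := Metric.sphere_subset_closedBall
  obtain ⟨z₀, hz₀, hmin⟩ := (isCompact_sphere a r).exists_isMinOn
    (NormedSpace.sphere_nonempty.mpr hr.le)
    (hfU.continuousOn.mono (hsph.trans hrU)).norm
  have hδ : 0 < ‖f z₀‖ :=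
    norm_pos_iff.mpr ((hrs (hsph hz₀)).2 (Metric.ne_of_mem_sphere hz₀ hr.ne'))
  set δ := ‖f z₀‖
  have hunif := (tendstoLocallyUniformlyOn_iff_forall_isCompact hU).mp hlim _ hrU
    (isCompact_closedBall a r)
  obtain ⟨i, hi⟩ := (Metric.tendstoUniformlyOn_iff.mp hunif (δ / 3) (by positivity)).exists
  have hcl : closure (Metric.ball a r) ⊆ Metric.closedBall a r :=
    Metric.closure_ball_subset_closedBall
  have h0 : ∀ z ∈ Metric.closedBall a r, F i z ≠ 0 := fun z hz => hFV i z (hrs hz).1.2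
  have hd : DiffContOnCl ℂ (fun z => (F i z)⁻¹) (Metric.ball a r) :=
    DifferentiableOn.diffContOnCl
      (((hF i).mono (hcl.trans hrU)).fun_inv fun z hz => h0 z (hcl hz))
  have hle := Complex.norm_le_of_forall_mem_frontier_norm_le Metric.isBounded_ball hd
    (C := (2 * δ / 3)⁻¹) (fun z hz => ?_) (subset_closure (Metric.mem_ball_self hr))
  · have h1 := hi a (Metric.mem_closedBall_self hr.le)
    rw [hfa, dist_zero_left] at h1
    rw [norm_inv, inv_le_inv₀ (norm_pos_iff.mpr (h0 a (Metric.mem_closedBall_self hr.le)))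
      (by positivity)] at hle
    linarith
  · rw [frontier_ball a hr.ne'] at hz
    have h1 := hi z (hsph hz)
    have h2 : δ ≤ ‖f z‖ := hmin hz
    rw [dist_eq_norm] at h1
    rw [norm_inv]
    refine inv_anti₀ (by positivity) ?_
    have := norm_sub_norm_le (f z) (F i z)
    linarith

/-- Univalent maps of `U` into the unit disc sending `z₀` to `0`. -/
def univalentDiscMaps (U : Set ℂ) (z₀ : ℂ) : Set (ℂ → ℂ) :=
  {f | Set.MapsTo f U (Metric.ball 0 1) ∧ Set.InjOn f U ∧ (∀ z ∈ U, deriv f z ≠ 0) ∧ f z₀ = 0}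

theorem differentiableOn_of_mem_univalentDiscMaps {U : Set ℂ} {z₀ : ℂ} {f : ℂ → ℂ}
    (hf : f ∈ univalentDiscMaps U z₀) : DifferentiableOn ℂ f U := fun z hz =>
  (differentiableAt_of_deriv_ne_zero (hf.2.2.1 z hz)).differentiableWithinAt

theorem exists_maximal_univalentDiscMaps {U : Set ℂ} (hU : IsOpen U) (hUc : IsPreconnected U)
    {z₀ : ℂ} (hz₀ : z₀ ∈ U) (hne : (univalentDiscMaps U z₀).Nonempty) :
    ∃ f ∈ univalentDiscMaps U z₀, ∀ g ∈ univalentDiscMaps U z₀,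
      ‖deriv g z₀‖ ≤ ‖deriv f z₀‖ := by
  set S := (fun f : ℂ → ℂ => ‖deriv f z₀‖) '' univalentDiscMaps U z₀
  have hS : S.Nonempty := hne.image _
  have hSb : BddAbove S := by
    obtain ⟨R, hR, hRU⟩ := Metric.nhds_basis_closedBall.mem_iff.mp (hU.mem_nhds hz₀)
    refine ⟨1 / R, ?_⟩
    rintro _ ⟨f, hf, rfl⟩
    refine norm_deriv_le_of_forall_mem_sphere_norm_le hR
      ((differentiableOn_of_mem_univalentDiscMaps hf).mono
        (Metric.closure_ball_subset_closedBall.trans hRU)).diffContOnCl fun v hv => ?_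
    exact (mem_ball_zero_iff.mp (hf.1 (hRU (Metric.sphere_subset_closedBall hv)))).le
  obtain ⟨u, -, hu, huS⟩ := exists_seq_tendsto_sSup hS hSb
  choose F hF hFu using huS
  have hFd := fun n => differentiableOn_of_mem_univalentDiscMaps (hF n)
  obtain ⟨f, hlim⟩ := exists_tendstoLocallyUniformlyOn_ultrafilter (Filter.hyperfilter ℕ) hU hFd
    (C := 1) fun n z hz => (mem_ball_zero_iff.mp ((hF n).1 hz)).le
  have hev := Filter.Eventually.of_forall (f := (Filter.hyperfilter ℕ : Filter ℕ)) hFd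
  have hfd : DifferentiableOn ℂ f U := hlim.differentiableOn hev hU
  have hlim' := hlim.deriv hev hU
  have hsup : ‖deriv f z₀‖ = sSup S := by
    refine tendsto_nhds_unique (hlim'.tendsto_at hz₀).norm ?_
    refine (hu.mono_left Nat.hyperfilter_le_atTop).congr fun n => ?_
    exact (hFu n).symm
  have hmax : ∀ g ∈ univalentDiscMaps U z₀, ‖deriv g z₀‖ ≤ ‖deriv f z₀‖ := fun g hg => by
    rw [hsup]
    exact le_csSup hSb ⟨g, hg, rfl⟩
  have hd0 : deriv f z₀ ≠ 0 := by
    obtain ⟨g, hg⟩ := hne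
    exact norm_pos_iff.mp ((norm_pos_iff.mpr (hg.2.2.1 z₀ hz₀)).trans_le (hmax g hg))
  have hf0 : f z₀ = 0 := by
    refine tendsto_nhds_unique (hlim.tendsto_at hz₀) ?_
    simp_rw [fun n => (hF n).2.2.2]
    exact tendsto_const_nhds
  refine ⟨f, ⟨?_, ?_, ?_, hf0⟩, hmax⟩
  · have hle : ∀ z ∈ U, ‖f z‖ ≤ 1 := fun z hz =>
      le_of_tendsto (hlim.tendsto_at hz).norm (Filter.Eventually.of_forall fun n =>
        (mem_ball_zero_iff.mp ((hF n).1 hz)).le)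
    intro z hz
    rw [mem_ball_zero_iff]
    refine lt_of_le_of_ne (hle z hz) fun h1 => ?_
    have := Complex.norm_eqOn_of_isPreconnected_of_isMaxOn hUc hU hfd hz
      (fun w hw => by simpa [h1] using hle w hw) hz₀
    simp [hf0, h1] at this
  · intro a ha b hb hab
    by_contra hne'
    refine not_eventually_ne_zero_of_tendstoLocallyUniformlyOn hU (V := U \ {b})
      (F := fun n z => F n z - F n b) (f := fun z => f z - f b) (l := Filter.hyperfilter ℕ)
      ?_ (fun n => (hFd n).sub_const _) ha ((hU.sdiff isClosed_singleton).mem_nhds ⟨ha, hne'⟩)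
      (fun n z hz h0 => hz.2 ((hF n).2.1 hz.1 hb (sub_eq_zero.mp h0))) (sub_eq_zero.mpr hab) ?_
    · rw [Metric.tendstoLocallyUniformlyOn_iff]
      intro ε hε x hx
      obtain ⟨t, ht, hts⟩ :=
        Metric.tendstoLocallyUniformlyOn_iff.mp hlim (ε / 2) (by positivity) x hx
      refine ⟨t, ht, ?_⟩
      filter_upwards [hts, Metric.tendsto_nhds.mp (hlim.tendsto_at hb) (ε / 2) (by positivity)]
        with n h1 h2 y hy
      have h3 := dist_sub_sub_le (f y) (f b) (F n y) (F n b)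
      rw [dist_comm] at h2
      linarith [h1 y hy]
    · by_contra hfr
      have han : AnalyticOnNhd ℂ (fun z => f z - f b) U := (hfd.sub_const _).analyticOnNhd hU
      have heq := han.eqOn_zero_of_preconnected_of_frequently_eq_zero hUc ha
        hfr
      apply hd0
      have : f =ᶠ[nhds z₀] fun _ => f b := by
        filter_upwards [hU.mem_nhds hz₀] with z hz
        exact sub_eq_zero.mp (heq hz)
      rw [this.deriv_eq, deriv_const]
  · intro a ha h0
    refine not_eventually_ne_zero_of_tendstoLocallyUniformlyOn hU (V := U) hlim'
      (fun n => (hFd n).deriv hU) ha (hU.mem_nhds ha) (fun n => (hF n).2.2.1) h0 ?_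
    by_contra hfr
    exact hd0 (((hfd.deriv hU).analyticOnNhd hU).eqOn_zero_of_preconnected_of_frequently_eq_zero
      hUc ha hfr hz₀)

/-- The disc automorphism sending `w` to `0`. -/
noncomputable def discShift (w x : ℂ) : ℂ := (x - w) / (1 - (starRingEnd ℂ) w * x)

theorem one_sub_conj_mul_ne_zero {w x : ℂ} (hw : ‖w‖ < 1) (hx : ‖x‖ < 1) :
    1 - (starRingEnd ℂ) w * x ≠ 0 := by
  intro h
  have h1 : ‖(starRingEnd ℂ) w * x‖ = 1 := by rw [← sub_eq_zero.mp h, norm_one]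
  rw [norm_mul, Complex.norm_conj] at h1
  nlinarith [norm_nonneg w, norm_nonneg x]

theorem norm_discShift_lt_one {w x : ℂ} (hw : ‖w‖ < 1) (hx : ‖x‖ < 1) : ‖discShift w x‖ < 1 := by
  have h0 := norm_pos_iff.mpr (one_sub_conj_mul_ne_zero hw hx)
  rw [discShift, norm_div, div_lt_one h0]
  refine lt_of_pow_lt_pow_left₀ 2 (norm_nonneg _) ?_
  have e : ‖1 - (starRingEnd ℂ) w * x‖ ^ 2 - ‖x - w‖ ^ 2 = (1 - ‖w‖ ^ 2) * (1 - ‖x‖ ^ 2) := by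
    simp only [← Complex.normSq_eq_norm_sq, Complex.normSq_apply]
    simp
    ring
  have h1 : 0 < 1 - ‖w‖ ^ 2 := by nlinarith [norm_nonneg w]
  have h2 : 0 < 1 - ‖x‖ ^ 2 := by nlinarith [norm_nonneg x]
  nlinarith [mul_pos h1 h2]

theorem one_sub_conj_mul_self_ne_zero {w : ℂ} (hw : ‖w‖ < 1) :
    1 - (starRingEnd ℂ) w * w ≠ 0 := one_sub_conj_mul_ne_zero hw hw

theorem discShift_inj {w x y : ℂ} (hw : ‖w‖ < 1) (hx : ‖x‖ < 1) (hy : ‖y‖ < 1)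
    (h : discShift w x = discShift w y) : x = y := by
  rw [discShift, discShift, div_eq_div_iff (one_sub_conj_mul_ne_zero hw hx)
    (one_sub_conj_mul_ne_zero hw hy)] at h
  refine sub_eq_zero.mp ((mul_eq_zero.mp
    (?_ : (x - y) * (1 - (starRingEnd ℂ) w * w) = 0)).resolve_right
    (one_sub_conj_mul_self_ne_zero hw))
  linear_combination h

theorem hasDerivAt_discShift {w x : ℂ} (hw : ‖w‖ < 1) (hx : ‖x‖ < 1) :
    HasDerivAt (discShift w)
      ((1 - (starRingEnd ℂ) w * w) / (1 - (starRingEnd ℂ) w * x) ^ 2) x := by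
  have h := ((hasDerivAt_id x).sub_const w).div
    (((hasDerivAt_id x).const_mul ((starRingEnd ℂ) w)).const_sub 1) (one_sub_conj_mul_ne_zero hw hx)
  convert! h using 1
  simp
  ring

theorem hasDerivAt_of_sq_eq {g F : ℂ → ℂ} {F' z : ℂ} (hg : ContinuousAt g z)
    (hF : HasDerivAt F F' z) (h : ∀ x, g x ^ 2 = F x) (hz : g z ≠ 0) :
    HasDerivAt g (F' / (2 * g z)) z := by
  rw [hasDerivAt_iff_tendsto_slope] at hF ⊢
  have hsum : Filter.Tendsto (fun x => g x + g z) (nhdsWithin z {z}ᶜ) (nhds (2 * g z)) := by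
    rw [two_mul]
    exact (hg.tendsto.mono_left nhdsWithin_le_nhds).add_const _
  have hne : ∀ᶠ x in nhdsWithin z {z}ᶜ, g x + g z ≠ 0 :=
    hsum.eventually_ne (mul_ne_zero two_ne_zero hz)
  refine (hF.div hsum (mul_ne_zero two_ne_zero hz)).congr' ?_
  filter_upwards [hne, self_mem_nhdsWithin] with x hx hxz
  have hxz' : x - z ≠ 0 := sub_ne_zero.mpr hxz
  simp only [slope_def_field, Pi.div_apply]
  rw [← h, ← h]
  field_simp
  ring

/-- Koebe's square root trick. -/
theorem exists_larger_deriv_of_not_surjOn {U : Set ℂ} (hU : IsOpen U) (hUc : IsSimplyConnected U)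
    {z₀ : ℂ} (hz₀ : z₀ ∈ U) {f : ℂ → ℂ} (hf : f ∈ univalentDiscMaps U z₀) {w : ℂ} (hw : ‖w‖ < 1)
    (hwf : w ∉ f '' U) : ∃ g ∈ univalentDiscMaps U z₀, ‖deriv f z₀‖ < ‖deriv g z₀‖ := by
  have hfd := differentiableOn_of_mem_univalentDiscMaps hf
  obtain ⟨hmaps, hinj, hder, hf0⟩ := hf
  have hf1 : ∀ z ∈ U, ‖f z‖ < 1 := fun z hz => mem_ball_zero_iff.mp (hmaps hz)
  set F : ℂ → ℂ := fun z => discShift w (f z)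
  set F' : ℂ → ℂ := fun z =>
    (1 - (starRingEnd ℂ) w * w) / (1 - (starRingEnd ℂ) w * f z) ^ 2 * deriv f z with hF'
  have hFd : ∀ z ∈ U, HasDerivAt F (F' z) z := fun z hz =>
    (hasDerivAt_discShift hw (hf1 z hz)).comp z
      (hfd.differentiableAt (hU.mem_nhds hz)).hasDerivAt
  have hF'0 : ∀ z ∈ U, F' z ≠ 0 := fun z hz => mul_ne_zero
    (div_ne_zero (one_sub_conj_mul_self_ne_zero hw)
      (pow_ne_zero 2 (one_sub_conj_mul_ne_zero hw (hf1 z hz)))) (hder z hz)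
  have hF0 : ∀ z ∈ U, F z ≠ 0 := fun z hz => div_ne_zero
    (sub_ne_zero.mpr fun h => hwf ⟨z, hz, h⟩) (one_sub_conj_mul_ne_zero hw (hf1 z hz))
  obtain ⟨g, hgc, hg⟩ := exists_continuousOn_pow_eq hUc hU
    (fun z hz => (hFd z hz).continuousAt.continuousWithinAt)
    (by rintro ⟨z, hz, h⟩; exact hF0 z hz h) two_ne_zero
  have hg0 : ∀ z ∈ U, g z ≠ 0 := fun z hz h => hF0 z hz (by rw [← hg, h]; simp)
  have hgd : ∀ z ∈ U, HasDerivAt g (F' z / (2 * g z)) z := fun z hz =>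
    hasDerivAt_of_sq_eq (hgc.continuousAt (hU.mem_nhds hz)) (hFd z hz) hg (hg0 z hz)
  have hg1 : ∀ z ∈ U, ‖g z‖ < 1 := by
    intro z hz
    have h1 : ‖g z‖ ^ 2 < 1 := by
      rw [← norm_pow, hg]
      exact norm_discShift_lt_one hw (hf1 z hz)
    nlinarith [norm_nonneg (g z)]
  have hb := hg1 z₀ hz₀
  set b := g z₀ with hb_def
  have hhd : ∀ z ∈ U, HasDerivAt (fun z => discShift b (g z))
      ((1 - (starRingEnd ℂ) b * b) / (1 - (starRingEnd ℂ) b * g z) ^ 2 * (F' z / (2 * g z))) z :=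
    fun z hz => (hasDerivAt_discShift hb (hg1 z hz)).comp z (hgd z hz)
  refine ⟨fun z => discShift b (g z), ⟨?_, ?_, ?_, ?_⟩, ?_⟩
  · exact fun z hz => mem_ball_zero_iff.mpr (norm_discShift_lt_one hb (hg1 z hz))
  · intro x hx y hy hxy
    have h1 : g x = g y := discShift_inj hb (hg1 x hx) (hg1 y hy) hxy
    have h2 : F x = F y := by rw [← hg, ← hg, h1]
    exact hinj hx hy (discShift_inj hw (hf1 x hx) (hf1 y hy) h2)
  · intro z hz
    rw [(hhd z hz).deriv]
    exact mul_ne_zero (div_ne_zero (one_sub_conj_mul_self_ne_zero hb)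
      (pow_ne_zero 2 (one_sub_conj_mul_ne_zero hb (hg1 z hz))))
      (div_ne_zero (hF'0 z hz) (mul_ne_zero two_ne_zero (hg0 z hz)))
  · simp [discShift, ← hb_def]
  · rw [(hhd z₀ hz₀).deriv, ← hb_def]
    have hbw : b ^ 2 = -w := by
      rw [hb_def, hg]
      simp [F, discShift, hf0]
    have hbw' : ‖w‖ = ‖b‖ ^ 2 := by rw [← norm_pow, hbw, norm_neg]
    have hb0 : 0 < ‖b‖ := norm_pos_iff.mpr (hg0 z₀ hz₀)
    have hnorm : ∀ x : ℂ, ‖x‖ < 1 → ‖1 - (starRingEnd ℂ) x * x‖ = 1 - ‖x‖ ^ 2 := by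
      intro x hx
      have : 1 - (starRingEnd ℂ) x * x = ((1 - ‖x‖ ^ 2 : ℝ) : ℂ) := by
        rw [Complex.conj_mul']; push_cast; rfl
      rw [this, Complex.norm_real, Real.norm_of_nonneg]
      nlinarith [norm_nonneg x]
    have hD : 0 < ‖deriv f z₀‖ := norm_pos_iff.mpr (hder z₀ hz₀)
    simp only [hF', hf0, mul_zero, sub_zero, one_pow, div_one, norm_mul, norm_div, norm_pow,
      hnorm b hb, hnorm w hw, hbw']
    set s := ‖b‖
    have h1 : 0 < 1 - s ^ 2 := by nlinarith
    have e : (1 - s ^ 2) / (1 - s ^ 2) ^ 2 * ((1 - (s ^ 2) ^ 2) * ‖deriv f z₀‖ / (‖(2 : ℂ)‖ * s)) =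
        ‖deriv f z₀‖ * ((1 + s ^ 2) / (2 * s)) := by
      rw [Complex.norm_ofNat]
      field_simp
      ring
    rw [e]
    refine lt_mul_of_one_lt_right hD ?_
    rw [one_lt_div (by positivity)]
    nlinarith [sq_pos_of_pos (sub_pos.mpr hb)]

/-- The **Riemann mapping theorem** for bounded domains. -/
theorem exists_biholomorphic_unit_ball {U : Set ℂ} (hU : IsOpen U) (hUc : IsSimplyConnected U)
    (hUb : Bornology.IsBounded U) :
    ∃ φ ψ : ℂ → ℂ, DifferentiableOn ℂ φ (Metric.ball 0 1) ∧ DifferentiableOn ℂ ψ U ∧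
      Set.BijOn φ (Metric.ball 0 1) U ∧ Set.BijOn ψ U (Metric.ball 0 1) ∧
      Set.InvOn φ ψ U (Metric.ball 0 1) := by
  obtain ⟨z₀, hz₀⟩ := hUc.nonempty
  have hne : (univalentDiscMaps U z₀).Nonempty := by
    obtain ⟨R, hR0, hR⟩ := hUb.subset_ball_lt 0 z₀
    have hRC : (R : ℂ) ≠ 0 := by exact_mod_cast hR0.ne'
    have hd : ∀ z, HasDerivAt (fun z : ℂ => (z - z₀) / R) (1 / R) z := fun z =>
      ((hasDerivAt_id z).sub_const z₀).div_const _
    refine ⟨fun z => (z - z₀) / R, ?_, ?_, ?_, by simp⟩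
    · intro z hz
      have := hR hz
      rw [Metric.mem_ball, dist_eq_norm] at this
      rw [mem_ball_zero_iff, norm_div, Complex.norm_real, Real.norm_of_nonneg hR0.le,
        div_lt_one hR0]
      exact this
    · intro x _ y _ hxy
      simpa [div_left_inj' hRC] using hxy
    · intro z _
      rw [(hd z).deriv]
      exact one_div_ne_zero hRC
  obtain ⟨f, hf, hmax⟩ := exists_maximal_univalentDiscMaps hU
    hUc.isPathConnected.isConnected.isPreconnected hz₀ hne
  have hfd := differentiableOn_of_mem_univalentDiscMaps hf
  have hsurj : Set.SurjOn f U (Metric.ball 0 1) := by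
    intro w hw
    by_contra hwf
    obtain ⟨g, hg, hlt⟩ := exists_larger_deriv_of_not_surjOn hU hUc hz₀ hf
      (mem_ball_zero_iff.mp hw) hwf
    exact (hmax g hg).not_gt hlt
  have hbij : Set.BijOn f U (Metric.ball 0 1) := ⟨hf.1, hf.2.1, hsurj⟩
  have hinv := hbij.invOn_invFunOn
  have hbij' := hbij.symm hinv.symm
  refine ⟨Function.invFunOn f U, f, ?_, hfd, hbij', hbij, hinv⟩
  intro w hw
  have hz := hbij'.mapsTo hw
  have hfz : f (Function.invFunOn f U w) = w := hinv.2 hw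
  have hstrict : HasStrictDerivAt f (deriv f (Function.invFunOn f U w)) (Function.invFunOn f U w) :=
    ((hfd.analyticOnNhd hU) _ hz).hasStrictDerivAt
  have hd0 := hf.2.2.1 _ hz
  have hcont : ContinuousAt (Function.invFunOn f U) w := by
    intro V hV
    have h1 := Filter.image_mem_map (m := f) (Filter.inter_mem hV (hU.mem_nhds hz))
    rw [hstrict.map_nhds_eq hd0, hfz] at h1
    refine Filter.mem_map.mpr (Filter.mem_of_superset h1 ?_)
    rintro _ ⟨z, ⟨hzV, hzU⟩, rfl⟩
    rw [Set.mem_preimage, hinv.1 hzU]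
    exact hzV
  refine (HasDerivAt.of_local_left_inverse hcont hstrict.hasDerivAt hd0
    ?_).differentiableAt.differentiableWithinAt
  filter_upwards [Metric.isOpen_ball.mem_nhds hw] with y hy
  exact hinv.2 hy

theorem Complex.abs_det_smul_one (c : ℂ) : |(c • (1 : ℂ →L[ℝ] ℂ)).det| = ‖c‖ ^ 2 := by
  have h : ((c • (1 : ℂ →L[ℝ] ℂ) : ℂ →L[ℝ] ℂ) : ℂ →ₗ[ℝ] ℂ) = Algebra.lmul ℝ ℂ c := by
    ext; simp
  rw [ContinuousLinearMap.det, h, ← Algebra.norm_apply, Algebra.norm_complex_apply,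
    Complex.normSq_eq_norm_sq, abs_of_nonneg (by positivity)]

/-- The `∂̄`-derivative of `conj z * h z - g z` is `h z` when `h` and `g` are holomorphic. -/
theorem dbar_conj_mul_sub {h g : ℂ → ℂ} {z : ℂ} (hh : DifferentiableAt ℂ h z)
    (hg : DifferentiableAt ℂ g z) :
    (fderiv ℝ (fun z => (starRingEnd ℂ) z * h z - g z) z 1 +
      Complex.I * fderiv ℝ (fun z => (starRingEnd ℂ) z * h z - g z) z Complex.I) / 2 = h z := by
  have hc : HasFDerivAt (fun z : ℂ => (starRingEnd ℂ) z) (conjCLE : ℂ →L[ℝ] ℂ) z :=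
    conjCLE.hasFDerivAt
  have hu := (hc.mul hh.hasDerivAt.complexToReal_fderiv).sub hg.hasDerivAt.complexToReal_fderiv
  rw [HasFDerivAt.fderiv (f := fun z => (starRingEnd ℂ) z * h z - g z) hu]
  simp
  linear_combination (((starRingEnd ℂ) z * deriv h z - deriv g z - h z) / 2) * Complex.I_sq

theorem lintegral_eq_of_bijOn {s t : Set ℂ} {φ : ℂ → ℂ} (hs : IsOpen s)
    (hφ : DifferentiableOn ℂ φ s) (hb : Set.BijOn φ s t) (F : ℂ → ENNReal) :
    ∫⁻ w in t, F w = ∫⁻ z in s, ENNReal.ofReal (‖deriv φ z‖ ^ 2) * F (φ z) := by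
  rw [← hb.image_eq, lintegral_image_eq_lintegral_abs_det_fderiv_mul volume hs.measurableSet
    (fun z hz => ((hφ.differentiableAt
      (hs.mem_nhds hz)).hasDerivAt.complexToReal_fderiv).hasFDerivWithinAt) hb.injOn]
  simp_rw [Complex.abs_det_smul_one]

theorem integral_eq_of_bijOn {s t : Set ℂ} {φ : ℂ → ℂ} (hs : IsOpen s)
    (hφ : DifferentiableOn ℂ φ s) (hb : Set.BijOn φ s t) (F : ℂ → ℝ) :
    ∫ w in t, F w = ∫ z in s, ‖deriv φ z‖ ^ 2 * F (φ z) := by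
  rw [← hb.image_eq, integral_image_eq_integral_abs_det_fderiv_smul volume hs.measurableSet
    (fun z hz => ((hφ.differentiableAt
      (hs.mem_nhds hz)).hasDerivAt.complexToReal_fderiv).hasFDerivWithinAt) hb.injOn]
  simp_rw [Complex.abs_det_smul_one, smul_eq_mul]

theorem integrableOn_iff_of_bijOn {s t : Set ℂ} {φ : ℂ → ℂ} (hs : IsOpen s)
    (hφ : DifferentiableOn ℂ φ s) (hb : Set.BijOn φ s t) (F : ℂ → ℝ) :
    IntegrableOn F t ↔ IntegrableOn (fun z => ‖deriv φ z‖ ^ 2 * F (φ z)) s := by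
  rw [← hb.image_eq, integrableOn_image_iff_integrableOn_abs_det_fderiv_smul volume
    hs.measurableSet (fun z hz => ((hφ.differentiableAt
      (hs.mem_nhds hz)).hasDerivAt.complexToReal_fderiv).hasFDerivWithinAt) hb.injOn]
  simp_rw [Complex.abs_det_smul_one, smul_eq_mul]

/-- Solution of the `∂̄`-problem with a Bergman-norm bound: for `h` holomorphic and
square-integrable on a bounded simply connected domain `Ω`, there is a holomorphic `g`
such that `u(z) = conj(z)·h(z) - g(z)` satisfies `∂̄u = h` on `Ω` and
`∫_Ω |u|² ≤ (Area(Ω)/(2π)) ∫_Ω |h|²`. -/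
theorem dbar_solution_bergman_bound
    (Ω : Set ℂ) (hΩo : IsOpen Ω) (hΩne : Ω.Nonempty) (hΩb : Bornology.IsBounded Ω)
    (hΩsc : SimplyConnectedSpace Ω)
    (h : ℂ → ℂ) (hh : DifferentiableOn ℂ h Ω)
    (hh2 : IntegrableOn (fun z => ‖h z‖ ^ 2) Ω volume) :
    ∃ g : ℂ → ℂ, DifferentiableOn ℂ g Ω ∧
      (∀ z ∈ Ω,
        (fderiv ℝ (fun z => (starRingEnd ℂ) z * h z - g z) z 1 +
          Complex.I * fderiv ℝ (fun z => (starRingEnd ℂ) z * h z - g z) z Complex.I)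
          / 2 = h z) ∧
      ∫ z in Ω, ‖(starRingEnd ℂ) z * h z - g z‖ ^ 2 ≤
        ((volume Ω).toReal / (2 * Real.pi)) * ∫ z in Ω, ‖h z‖ ^ 2 := by
  obtain ⟨φ, ψ, hφ, hψ, hφb, hψb, hinv⟩ := exists_biholomorphic_unit_ball hΩo hΩsc hΩb
  have hB : IsOpen (Metric.ball (0 : ℂ) 1) := Metric.isOpen_ball
  have hint1 : IntegrableOn (fun _ : ℂ => (1 : ℝ)) Ω :=
    integrableOn_const hΩb.measure_lt_top.ne
  have hchain : ∀ z ∈ Metric.ball (0 : ℂ) 1, deriv ψ (φ z) * deriv φ z = 1 := by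
    intro z hz
    have h1 := (hψ.differentiableAt (hΩo.mem_nhds (hφb.mapsTo hz))).hasDerivAt.comp z
      (hφ.differentiableAt (hB.mem_nhds hz)).hasDerivAt
    have h2 : ψ ∘ φ =ᶠ[nhds z] id := by
      filter_upwards [hB.mem_nhds hz] with y hy using hinv.2 hy
    rw [← h1.deriv, h2.deriv_eq, deriv_id]
  set f : ℂ → ℂ := fun z => h (φ z) * deriv φ z with hf_def
  have hf_sq : (fun z => ‖f z‖ ^ 2) = fun z => ‖deriv φ z‖ ^ 2 * ‖h (φ z)‖ ^ 2 := by
    funext z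
    rw [hf_def, norm_mul, mul_pow, mul_comm]
  have hf : DifferentiableOn ℂ f (Metric.ball 0 1) :=
    (hh.comp hφ hφb.mapsTo).mul (hφ.deriv hB)
  have hφ2 : IntegrableOn (fun z => ‖deriv φ z‖ ^ 2) (Metric.ball 0 1) := by
    simpa using (integrableOn_iff_of_bijOn hB hφ hφb fun _ => 1).mp hint1
  have hf2 : IntegrableOn (fun z => ‖f z‖ ^ 2) (Metric.ball 0 1) := by
    rw [hf_sq]
    exact (integrableOn_iff_of_bijOn hB hφ hφb _).mp hh2
  obtain ⟨G, hG, hGle⟩ := exists_bergman_correction_unit_ball hφ hf hφ2 hf2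
  have hg : DifferentiableOn ℂ (fun w => G (ψ w) * deriv ψ w) Ω :=
    (hG.comp hψ hψb.mapsTo).mul (hψ.deriv hΩo)
  refine ⟨fun w => G (ψ w) * deriv ψ w, hg, fun z hz =>
    dbar_conj_mul_sub (hh.differentiableAt (hΩo.mem_nhds hz))
      (hg.differentiableAt (hΩo.mem_nhds hz)), ?_⟩
  have hcont : ContinuousOn
      (fun z => ‖(starRingEnd ℂ) z * h z - G (ψ z) * deriv ψ z‖ ^ 2) Ω :=
    (((continuous_conj.continuousOn.mul hh.continuousOn).sub hg.continuousOn).norm).pow 2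
  have harea : (volume Ω).toReal = ∫ z in Metric.ball (0 : ℂ) 1, ‖deriv φ z‖ ^ 2 := by
    have := integral_eq_of_bijOn hB hφ hφb fun _ => 1
    simpa [Measure.real] using this
  rw [integral_eq_lintegral_of_nonneg_ae (Filter.Eventually.of_forall fun z => by positivity)
    (hcont.aestronglyMeasurable hΩo.measurableSet)]
  refine ENNReal.toReal_le_of_le_ofReal
    (mul_nonneg (by positivity) (integral_nonneg fun z => by positivity)) ?_
  rw [harea, integral_eq_of_bijOn hB hφ hφb, lintegral_eq_of_bijOn hB hφ hφb, ← hf_sq]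
  refine le_of_eq_of_le (setLIntegral_congr_fun hB.measurableSet fun z hz => ?_) hGle
  have e : (starRingEnd ℂ) (φ z) * f z - G z =
      deriv φ z * ((starRingEnd ℂ) (φ z) * h (φ z) - G (ψ (φ z)) * deriv ψ (φ z)) := by
    rw [hinv.2 hz, hf_def]
    linear_combination G z * hchain z hz
  rw [e, norm_mul, mul_pow, ENNReal.ofReal_mul (by positivity)]
end

section
/- Let Ω ⊂ ℂ be a nonempty bounded simply connected open set, let φ : Ω → 𝔻 be a biholomorphic map onto the unit disc, and let ψ be a bounded holomorphic function on Ω. Then the Hankel norms on Ω and on 𝔻 agree: the supremum, over holomorphic f on Ω with 0 < ∫_Ω |f|² dxdy < ∞, of [inf over holomorphic g ∈ L²(Ω) of ∫_Ω |conj(ψ)f − g|² dxdy] / ∫_Ω |f|² dxdy equals the supremum, over holomorphic F on 𝔻 with 0 < ∫_𝔻 |F|² dxdy < ∞, of [inf over holomorphic G ∈ L²(𝔻) of ∫_𝔻 |conj(ψ∘φ⁻¹)·F − G|² dxdy] / ∫_𝔻 |F|² dxdy. (That is, ‖H_{conj ψ}‖_{A²(Ω)→L²(Ω)} = ‖H_{conj(ψ∘φ⁻¹)}‖_{A²(𝔻)→L²(𝔻)}.)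 -/
open MeasureTheory Complex

open Filter Topology Set in
/-- The inverse of an injective holomorphic map is holomorphic. -/
theorem differentiableOn_of_invOn_holomorphic {U V : Set ℂ} {φ φinv : ℂ → ℂ} (hU : IsOpen U)
    (hV : IsOpen V) (hφ : DifferentiableOn ℂ φ U) (hbij : BijOn φ U V)
    (hinv : InvOn φinv φ U V) : DifferentiableOn ℂ φinv V := by
  have key : ∀ z ∈ U, Tendsto φinv (𝓝 (φ z)) (𝓝 z) ∧ ∀ᶠ x in 𝓝[≠] z, deriv φ x ≠ 0 := by
    intro z hz
    have hUz := hU.mem_nhds hz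
    have han : AnalyticAt ℂ φ z := hφ.analyticAt hUz
    have hnc : ¬ ∀ᶠ x in 𝓝 z, φ x = φ z := by
      intro h
      have h1 : ∀ᶠ x in 𝓝 z, x = z := by
        filter_upwards [h, hUz] with x hx hxU using hbij.injOn hxU hz hx
      have h2 : ∀ᶠ x in 𝓝[≠] z, False := by
        filter_upwards [h1.filter_mono nhdsWithin_le_nhds, self_mem_nhdsWithin] with x hx hx'
          using hx' hx
      exact h2.exists.elim fun _ => id
    constructor
    · have hle := han.eventually_constant_or_nhds_le_map_nhds.resolve_left hnc
      refine Tendsto.mono_left ?_ hle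
      rw [tendsto_map'_iff]
      refine tendsto_id.congr' ?_
      filter_upwards [hUz] with x hx using (hinv.1 hx).symm
    · refine han.deriv.eventually_eq_zero_or_eventually_ne_zero.resolve_left fun h => hnc ?_
      obtain ⟨r, hr, hball⟩ := Metric.eventually_nhds_iff_ball.1 (h.and hUz)
      filter_upwards [Metric.ball_mem_nhds z hr] with x hx
      exact (convex_ball z r).is_const_of_fderivWithin_eq_zero (𝕜 := ℂ)
        (hφ.mono fun y hy => (hball y hy).2)
        (fun y hy => by
          rw [fderivWithin_of_isOpen Metric.isOpen_ball hy]
          ext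
          simpa using (hball y hy).1)
        hx (Metric.mem_ball_self hr)
  have hmaps : ∀ w ∈ V, φinv w ∈ U ∧ φ (φinv w) = w := by
    intro w hw
    obtain ⟨z, hz, rfl⟩ := hbij.surjOn hw
    simp [hinv.1 hz, hz]
  intro w hw
  obtain ⟨hwU, hφw⟩ := hmaps w hw
  have hcont : ∀ v ∈ V, ContinuousAt φinv v := by
    intro v hv
    have := (key _ (hmaps v hv).1).1
    rwa [(hmaps v hv).2] at this
  have hne : Tendsto φinv (𝓝[≠] w) (𝓝[≠] (φinv w)) := by
    refine tendsto_nhdsWithin_iff.2 ⟨(hcont w hw).mono_left nhdsWithin_le_nhds, ?_⟩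
    filter_upwards [self_mem_nhdsWithin,
      mem_nhdsWithin_of_mem_nhds (hV.mem_nhds hw)] with v hv hvV h
    exact hv (by rw [mem_singleton_iff, ← (hmaps v hvV).2, h, hφw])
  refine (Complex.analyticAt_of_differentiable_on_punctured_nhds_of_continuousAt ?_
    (hcont w hw)).differentiableAt.differentiableWithinAt
  filter_upwards [hne.eventually (key _ hwU).2,
    mem_nhdsWithin_of_mem_nhds (hV.mem_nhds hw)] with v hv hvV
  refine (HasDerivAt.of_local_left_inverse (hcont v hvV)
    (hφ.differentiableAt (hU.mem_nhds (hmaps v hvV).1)).hasDerivAt hv ?_).differentiableAt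
  filter_upwards [hV.mem_nhds hvV] with y hy using (hmaps y hy).2

/-- The real Jacobian determinant of a complex linear map of `ℂ`. -/
theorem det_restrictScalars_toSpanSingleton (a : ℂ) :
    ((ContinuousLinearMap.toSpanSingleton ℂ a).restrictScalars ℝ).det = ‖a‖ ^ 2 := by
  have : (((ContinuousLinearMap.toSpanSingleton ℂ a).restrictScalars ℝ : ℂ →L[ℝ] ℂ) : ℂ →ₗ[ℝ] ℂ)
      = LinearMap.mul ℝ ℂ a := by
    ext
    all_goals simp [mul_comm]
  rw [ContinuousLinearMap.det, this, ← Complex.normSq_eq_norm_sq, ← Algebra.norm_complex_apply]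
  rfl

section ChangeOfVariables

variable {U V : Set ℂ} {φ : ℂ → ℂ}

theorem hasFDerivWithinAt_real_of_differentiableOn (hU : IsOpen U)
    (hφ : DifferentiableOn ℂ φ U) : ∀ z ∈ U, HasFDerivWithinAt φ
      ((ContinuousLinearMap.toSpanSingleton ℂ (deriv φ z)).restrictScalars ℝ) U z := fun _ hz =>
  ((hφ.differentiableAt (hU.mem_nhds hz)).hasDerivAt.hasFDerivAt.restrictScalars ℝ
    ).hasFDerivWithinAt

theorem integral_eq_integral_norm_deriv_sq_mul (hU : IsOpen U) (hφ : DifferentiableOn ℂ φ U)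
    (hbij : Set.BijOn φ U V) (h : ℂ → ℝ) :
    ∫ w in V, h w = ∫ z in U, ‖deriv φ z‖ ^ 2 * h (φ z) := by
  rw [← hbij.image_eq, integral_image_eq_integral_abs_det_fderiv_smul volume hU.measurableSet
    (hasFDerivWithinAt_real_of_differentiableOn hU hφ) hbij.injOn]
  simp [det_restrictScalars_toSpanSingleton]

theorem integrableOn_iff_integrableOn_norm_deriv_sq_mul (hU : IsOpen U)
    (hφ : DifferentiableOn ℂ φ U) (hbij : Set.BijOn φ U V) (h : ℂ → ℝ) :
    IntegrableOn h V ↔ IntegrableOn (fun z => ‖deriv φ z‖ ^ 2 * h (φ z)) U := by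
  rw [← hbij.image_eq, integrableOn_image_iff_integrableOn_abs_det_fderiv_smul volume
    hU.measurableSet (hasFDerivWithinAt_real_of_differentiableOn hU hφ) hbij.injOn]
  simp [det_restrictScalars_toSpanSingleton]

theorem integral_norm_sq_eq_of_pullback (hU : IsOpen U) (hφ : DifferentiableOn ℂ φ U)
    (hbij : Set.BijOn φ U V) {f F : ℂ → ℂ} (hfF : ∀ z ∈ U, f z = deriv φ z * F (φ z)) :
    ∫ z in U, ‖f z‖ ^ 2 = ∫ w in V, ‖F w‖ ^ 2 := by
  rw [integral_eq_integral_norm_deriv_sq_mul hU hφ hbij]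
  refine setIntegral_congr_fun hU.measurableSet fun z hz => ?_
  simp [hfF z hz, mul_pow]

/-- Pulling back by a biholomorphic map preserves the Bergman space. -/
theorem bergman_pullback (hU : IsOpen U) (hφ : DifferentiableOn ℂ φ U)
    (hbij : Set.BijOn φ U V) {F : ℂ → ℂ} (hF : DifferentiableOn ℂ F V)
    (hFi : IntegrableOn (fun w => ‖F w‖ ^ 2) V) :
    DifferentiableOn ℂ (fun z => deriv φ z * F (φ z)) U ∧
      IntegrableOn (fun z => ‖deriv φ z * F (φ z)‖ ^ 2) U := by
  refine ⟨(hφ.deriv hU).mul (hF.comp hφ hbij.mapsTo), ?_⟩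
  simpa [mul_pow] using (integrableOn_iff_integrableOn_norm_deriv_sq_mul hU hφ hbij _).1 hFi

variable {φinv : ℂ → ℂ}

/-- Every Bergman function is the pullback of a Bergman function by a given biholomorphic map. -/
theorem exists_bergman_pullback_eq (hU : IsOpen U) (hV : IsOpen V) (hφ : DifferentiableOn ℂ φ U)
    (hbij : Set.BijOn φ U V) (hinv : Set.InvOn φinv φ U V) {f : ℂ → ℂ}
    (hf : DifferentiableOn ℂ f U) (hfi : IntegrableOn (fun z => ‖f z‖ ^ 2) U) :
    ∃ F : ℂ → ℂ, (DifferentiableOn ℂ F V ∧ IntegrableOn (fun w => ‖F w‖ ^ 2) V) ∧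
      ∀ z ∈ U, f z = deriv φ z * F (φ z) := by
  have hφinv := differentiableOn_of_invOn_holomorphic hU hV hφ hbij hinv
  refine ⟨fun w => deriv φinv w * f (φinv w),
    bergman_pullback hV hφinv (hbij.symm hinv.symm) hf hfi, fun z hz => ?_⟩
  have hd : deriv φinv (φ z) * deriv φ z = 1 := by
    rw [← deriv_comp z (hφinv.differentiableAt (hV.mem_nhds (hbij.mapsTo hz)))
      (hφ.differentiableAt (hU.mem_nhds hz))]
    have : φinv ∘ φ =ᶠ[nhds z] id := by
      filter_upwards [hU.mem_nhds hz] with x hx using hinv.1 hx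
    simp [this.deriv_eq]
  simp only [hinv.1 hz]
  linear_combination (-f z) * hd

theorem iInf_bergman_dist_eq (hU : IsOpen U) (hV : IsOpen V) (hφ : DifferentiableOn ℂ φ U)
    (hbij : Set.BijOn φ U V) (hinv : Set.InvOn φinv φ U V) {f F σ : ℂ → ℂ}
    (hfF : ∀ z ∈ U, f z = deriv φ z * F (φ z)) :
    (⨅ g : {g : ℂ → ℂ // DifferentiableOn ℂ g U ∧ IntegrableOn (fun z => ‖g z‖ ^ 2) U volume},
      ∫ z in U, ‖(starRingEnd ℂ) (σ z) * f z - g.1 z‖ ^ 2) =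
    ⨅ G : {G : ℂ → ℂ // DifferentiableOn ℂ G V ∧ IntegrableOn (fun z => ‖G z‖ ^ 2) V volume},
      ∫ w in V, ‖(starRingEnd ℂ) (σ (φinv w)) * F w - G.1 w‖ ^ 2 := by
  have key : ∀ g G : ℂ → ℂ, (∀ z ∈ U, g z = deriv φ z * G (φ z)) →
      ∫ z in U, ‖(starRingEnd ℂ) (σ z) * f z - g z‖ ^ 2 =
        ∫ w in V, ‖(starRingEnd ℂ) (σ (φinv w)) * F w - G w‖ ^ 2 := by
    intro g G hgG
    refine integral_norm_sq_eq_of_pullback hU hφ hbij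
      (f := fun z => (starRingEnd ℂ) (σ z) * f z - g z)
      (F := fun w => (starRingEnd ℂ) (σ (φinv w)) * F w - G w) fun z hz => ?_
    simp only [hinv.1 hz, hfF z hz, hgG z hz]
    ring
  refine congrArg sInf (Set.ext fun x => ⟨?_, ?_⟩)
  · rintro ⟨⟨g, hg, hgi⟩, rfl⟩
    obtain ⟨G, hG, hgG⟩ := exists_bergman_pullback_eq hU hV hφ hbij hinv hg hgi
    exact ⟨⟨G, hG⟩, (key g G hgG).symm⟩
  · rintro ⟨⟨G, hG, hGi⟩, rfl⟩
    exact ⟨⟨_, bergman_pullback hU hφ hbij hG hGi⟩, key _ G fun _ _ => rfl⟩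

end ChangeOfVariables

/-- Conformal invariance of the Hankel operator norm: for a Riemann map `φ : Ω → 𝔻`
with inverse `φinv` and a bounded analytic symbol `ψ` on `Ω`,
`‖H_{conj ψ}‖_{A²(Ω)→L²(Ω)} = ‖H_{conj(ψ∘φ⁻¹)}‖_{A²(𝔻)→L²(𝔻)}`, where each norm is
expressed as the supremum over nonzero Bergman functions of the squared distance of
`conj(ψ)f` to the Bergman space divided by `‖f‖²`. -/
theorem hankel_norm_conformal_invariance
    (Ω : Set ℂ) (hΩo : IsOpen Ω) (hΩne : Ω.Nonempty) (hΩb : Bornology.IsBounded Ω)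
    (hΩsc : SimplyConnectedSpace Ω)
    (φ φinv : ℂ → ℂ) (hφ : DifferentiableOn ℂ φ Ω)
    (hφbij : Set.BijOn φ Ω (Metric.ball (0 : ℂ) 1))
    (hφinv : Set.InvOn φinv φ Ω (Metric.ball (0 : ℂ) 1))
    (ψ : ℂ → ℂ) (hψ : DifferentiableOn ℂ ψ Ω) (hψb : ∃ C : ℝ, ∀ z ∈ Ω, ‖ψ z‖ ≤ C) :
    (⨆ f : {f : ℂ → ℂ // DifferentiableOn ℂ f Ω ∧
        IntegrableOn (fun z => ‖f z‖ ^ 2) Ω volume ∧ 0 < ∫ z in Ω, ‖f z‖ ^ 2},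
      (⨅ g : {g : ℂ → ℂ // DifferentiableOn ℂ g Ω ∧
          IntegrableOn (fun z => ‖g z‖ ^ 2) Ω volume},
        ∫ z in Ω, ‖(starRingEnd ℂ) (ψ z) * f.1 z - g.1 z‖ ^ 2) /
        ∫ z in Ω, ‖f.1 z‖ ^ 2) =
    ⨆ F : {F : ℂ → ℂ // DifferentiableOn ℂ F (Metric.ball (0 : ℂ) 1) ∧
        IntegrableOn (fun z => ‖F z‖ ^ 2) (Metric.ball (0 : ℂ) 1) volume ∧
        0 < ∫ z in Metric.ball (0 : ℂ) 1, ‖F z‖ ^ 2},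
      (⨅ G : {G : ℂ → ℂ // DifferentiableOn ℂ G (Metric.ball (0 : ℂ) 1) ∧
          IntegrableOn (fun z => ‖G z‖ ^ 2) (Metric.ball (0 : ℂ) 1) volume},
        ∫ z in Metric.ball (0 : ℂ) 1,
          ‖(starRingEnd ℂ) (ψ (φinv z)) * F.1 z - G.1 z‖ ^ 2) /
        ∫ z in Metric.ball (0 : ℂ) 1, ‖F.1 z‖ ^ 2 := by
  have hD : IsOpen (Metric.ball (0 : ℂ) 1) := Metric.isOpen_ball
  refine congrArg sSup (Set.ext fun x => ⟨?_, ?_⟩)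
  · rintro ⟨⟨f, hf, hfi, hf0⟩, rfl⟩
    obtain ⟨F, ⟨hF, hFi⟩, hfF⟩ := exists_bergman_pullback_eq hΩo hD hφ hφbij hφinv hf hfi
    have hn := integral_norm_sq_eq_of_pullback hΩo hφ hφbij hfF
    refine ⟨⟨F, hF, hFi, hn ▸ hf0⟩, ?_⟩
    exact (congrArg₂ (· / ·) (iInf_bergman_dist_eq hΩo hD hφ hφbij hφinv hfF) hn).symm
  · rintro ⟨⟨F, hF, hFi, hF0⟩, rfl⟩
    obtain ⟨hf, hfi⟩ := bergman_pullback hΩo hφ hφbij hF hFi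
    have hn := integral_norm_sq_eq_of_pullback hΩo hφ hφbij (F := F) fun _ _ => rfl
    refine ⟨⟨_, hf, hfi, hn ▸ hF0⟩, ?_⟩
    exact congrArg₂ (· / ·)
      (iInf_bergman_dist_eq hΩo hD hφ hφbij hφinv (F := F) fun _ _ => rfl) hn
end

section
/- Let α ≥ −1 be real and for n ∈ ℕ set D_n^α = n!·Γ(α+2)/Γ(n+α+2), where Γ is the real Gamma function. Then for every v ∈ ℕ: ∑_{ℓ=0}^{v} 1/D_ℓ^α = (v+1)/((2+α)·D_{v+1}^α). -/
/-- The key summation lemma for the coefficients `D_n^α = n!·Γ(α+2)/Γ(n+α+2)`: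
`∑_{ℓ=0}^{v} 1/D_ℓ^α = (v+1)/((2+α)·D_{v+1}^α)` for all `v ∈ ℕ` and real `α ≥ -1`. -/
theorem sum_inv_D_coeff
    (α : ℝ) (hα : -1 ≤ α)
    (D : ℕ → ℝ)
    (hD : ∀ n : ℕ, D n = (Nat.factorial n : ℝ) * Real.Gamma (α + 2) /
      Real.Gamma ((n : ℝ) + α + 2)) :
    ∀ v : ℕ, ∑ ℓ ∈ Finset.range (v + 1), 1 / D ℓ =
      ((v : ℝ) + 1) / ((2 + α) * D (v + 1)) := by
  have hα2 : 0 < 2 + α := by linarith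
  have hpos : ∀ n : ℕ, 0 < (n : ℝ) + α + 2 := fun n ↦ by
    have := n.cast_nonneg (α := ℝ)
    linarith
  have hDpos : ∀ n : ℕ, 0 < D n := fun n ↦ by
    have h₁ := Real.Gamma_pos_of_pos (hpos n)
    have h₂ : 0 < Real.Gamma (α + 2) := Real.Gamma_pos_of_pos (by linarith)
    rw [hD]
    positivity
  have hrec : ∀ n : ℕ, D (n + 1) = D n * (((n : ℝ) + 1) / ((n : ℝ) + α + 2)) := fun n ↦ by
    have h₁ := hpos n
    have h₂ := Real.Gamma_pos_of_pos h₁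
    have h₃ : ((n + 1 : ℕ) : ℝ) + α + 2 = ((n : ℝ) + α + 2) + 1 := by push_cast; ring
    rw [hD, hD, h₃, Real.Gamma_add_one h₁.ne', Nat.factorial_succ]
    push_cast
    field_simp
  intro v
  induction v with
  | zero =>
    have h₀ := hDpos 0
    have h₁ := hpos 0
    rw [Finset.sum_range_one, hrec 0]
    simp only [Nat.cast_zero, zero_add] at h₁ ⊢
    field_simp
    ring
  | succ v ih =>
    have h₀ := hDpos (v + 1)
    have h₁ := hpos (v + 1)
    rw [Finset.sum_range_succ, ih, hrec (v + 1)]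
    push_cast at h₁ ⊢
    field_simp
    ring
end

section
/- Let (a_n)_{n≥0} and (c_k)_{k≥1} be complex sequences with ∑_{n≥0} |a_n|²/(n+1) < ∞ and ∑_{k≥1} k|c_k|² < ∞. Then the double series S₁ = ∑_{k≥1} ∑_{n,m≥0} a_n conj(a_m) c_{k+m} conj(c_{k+n}) / (n+m+k+1) and S₂ = ∑_{k≥0} ∑_{n,m≥k+1} a_n conj(a_m) c_{m−k} conj(c_{n−k}) (m−k)(n−k) / ((n+1)(m+1)(n+m−k+1)) converge absolutely, S₁ and S₂ are real, and S₁ + S₂ ≤ (1/2) · (∑_{n≥0} |a_n|²/(n+1)) · (∑_{m≥1} m|c_m|²). (This is the coefficient form of the sharp Hankel estimate on the Bergman space A²(𝔻): S₁ + S₂ equals ‖H_{conj ψ}f‖² for f = ∑ a_n z^n and ψ = ∑ c_k z^k.) -/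
open Complex

/-- Term of `S₁ = ∑_{k≥1}∑_{n,m≥0} a_n conj(a_m) c_{k+m} conj(c_{k+n})/(n+m+k+1)`,
reindexed by `p = (k', n, m)` with `k = k'+1`. -/
noncomputable def S1term (a c : ℕ → ℂ) (p : ℕ × ℕ × ℕ) : ℂ :=
  a p.2.1 * (starRingEnd ℂ) (a p.2.2) * c (p.1 + 1 + p.2.2) *
      (starRingEnd ℂ) (c (p.1 + 1 + p.2.1)) /
    ((p.2.1 : ℂ) + (p.2.2 : ℂ) + ((p.1 : ℂ) + 1) + 1)

/-- Term of
`S₂ = ∑_{k≥0}∑_{n,m≥k+1} a_n conj(a_m) c_{m-k} conj(c_{n-k})(m-k)(n-k)/((n+1)(m+1)(n+m-k+1))`,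
reindexed by `p = (k, i, j)` with `n = k+1+i`, `m = k+1+j`. -/
noncomputable def S2term (a c : ℕ → ℂ) (p : ℕ × ℕ × ℕ) : ℂ :=
  a (p.1 + 1 + p.2.1) * (starRingEnd ℂ) (a (p.1 + 1 + p.2.2)) * c (p.2.2 + 1) *
      (starRingEnd ℂ) (c (p.2.1 + 1)) * (((p.2.2 : ℂ) + 1) * ((p.2.1 : ℂ) + 1)) /
    (((p.1 : ℂ) + (p.2.1 : ℂ) + 2) * ((p.1 : ℂ) + (p.2.2 : ℂ) + 2) *
      ((p.1 : ℂ) + (p.2.1 : ℂ) + (p.2.2 : ℂ) + 3))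

/-- A nonnegative function is summable as soon as its sums over the finite fibers of a map are. -/
lemma hasSum_of_finite_fibers {X Y : Type*} (π : X → Y) (s : Y → Finset X)
    (hs : ∀ x y, x ∈ s y ↔ π x = y) {f : X → ℝ} (hf : ∀ x, 0 ≤ f x) {h : Y → ℝ}
    (hh : Summable h) (hsum : ∀ y, ∑ x ∈ s y, f x = h y) : HasSum f (∑' y, h y) := by
  have fiber : ∀ y, HasSum (fun x : {x // π x = y} => f x) (h y) := by
    intro y
    rw [← hsum y]
    have hset : {x | π x = y} = (s y : Set X) := by
      ext x
      simp [hs]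
    have := Finset.hasSum (s y) f
    change HasSum (f ∘ ((↑) : {x | π x = y} → X)) _
    rw [hset]
    exact this
  rw [← (Equiv.sigmaFiberEquiv π).hasSum_iff]
  refine HasSum.sigma_of_hasSum hh.hasSum fiber ?_
  refine (summable_sigma_of_nonneg fun x => hf _).2 ⟨fun y => (fiber y).summable, ?_⟩
  convert hh using 2 with y
  exact (fiber y).tsum_eq

lemma norm_of_eq_natCast (x : ℕ) (z : ℂ) (hz : z = x) : ‖z‖ = x := by
  rw [hz, Complex.norm_natCast]

/-- The majorant of `S1term` obtained from the weighted inequality of arithmetic and geometric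
means. -/
noncomputable def S1majorant (a c : ℕ → ℂ) (p : ℕ × ℕ × ℕ) : ℝ :=
  ‖a p.2.1‖ ^ 2 * ‖c (p.1 + 1 + p.2.2)‖ ^ 2 * (((p.2.2 : ℝ) + 1) / ((p.2.1 : ℝ) + 1)) /
    ((p.2.1 : ℝ) + p.2.2 + p.1 + 2)

/-- The majorant of `S2term` obtained from the weighted inequality of arithmetic and geometric
means. -/
noncomputable def S2majorant (a c : ℕ → ℂ) (p : ℕ × ℕ × ℕ) : ℝ :=
  ‖a (p.1 + 1 + p.2.1)‖ ^ 2 * ‖c (p.2.2 + 1)‖ ^ 2 * (((p.2.2 : ℝ) + 1) * ((p.2.1 : ℝ) + 1)) /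
    (((p.1 : ℝ) + p.2.1 + 2) ^ 2 * ((p.1 : ℝ) + p.2.1 + p.2.2 + 3))

/-- Exchange of the last two indices. -/
def swapLast : ℕ × ℕ × ℕ ≃ ℕ × ℕ × ℕ :=
  (Equiv.refl ℕ).prodCongr (Equiv.prodComm ℕ ℕ)

lemma norm_S1term_le (a c : ℕ → ℂ) (p : ℕ × ℕ × ℕ) :
    ‖S1term a c p‖ ≤ (S1majorant a c p + S1majorant a c (swapLast p)) / 2 := by
  obtain ⟨k, n, m⟩ := p
  have hd : ‖(n : ℂ) + (m : ℂ) + ((k : ℂ) + 1) + 1‖ = (n : ℝ) + m + k + 2 := by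
    rw [norm_of_eq_natCast (n + m + k + 2) _ (by push_cast; ring)]
    push_cast
    ring
  simp only [S1term, S1majorant, swapLast, Equiv.prodCongr_apply, Equiv.coe_refl, Prod.map_apply,
    id, Equiv.prodComm_apply, Prod.swap_prod_mk, norm_div, norm_mul, RCLike.norm_conj, hd]
  generalize ‖a n‖ = x
  generalize ‖a m‖ = y
  generalize ‖c (k + 1 + m)‖ = u
  generalize ‖c (k + 1 + n)‖ = v
  have hn : (0 : ℝ) < (n : ℝ) + 1 := by positivity
  have hm : (0 : ℝ) < (m : ℝ) + 1 := by positivity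
  have key : x * y * u * v ≤ (x ^ 2 * u ^ 2 * (((m : ℝ) + 1) / ((n : ℝ) + 1)) +
      y ^ 2 * v ^ 2 * (((n : ℝ) + 1) / ((m : ℝ) + 1))) / 2 := by
    have : (x ^ 2 * u ^ 2 * (((m : ℝ) + 1) / ((n : ℝ) + 1)) +
      y ^ 2 * v ^ 2 * (((n : ℝ) + 1) / ((m : ℝ) + 1))) / 2 - x * y * u * v =
      (x * u * (m + 1) - y * v * (n + 1)) ^ 2 / (2 * (n + 1) * (m + 1)) := by
      field_simp
      ring
    have h0 : 0 ≤ (x * u * (m + 1) - y * v * (n + 1)) ^ 2 / (2 * ((n : ℝ) + 1) * (m + 1)) := by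
      positivity
    linarith
  calc _ ≤ (x ^ 2 * u ^ 2 * (((m : ℝ) + 1) / ((n : ℝ) + 1)) +
      y ^ 2 * v ^ 2 * (((n : ℝ) + 1) / ((m : ℝ) + 1))) / 2 / ((n : ℝ) + m + k + 2) := by gcongr
    _ = _ := by
      rw [show (m : ℝ) + n + k + 2 = (n : ℝ) + m + k + 2 by ring]
      ring

lemma norm_S2term_le (a c : ℕ → ℂ) (p : ℕ × ℕ × ℕ) :
    ‖S2term a c p‖ ≤ (S2majorant a c p + S2majorant a c (swapLast p)) / 2 := by
  obtain ⟨k, i, j⟩ := p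
  have h1 (l : ℕ) : ‖(l : ℂ) + 1‖ = (l : ℝ) + 1 := by
    rw [norm_of_eq_natCast (l + 1) _ (by push_cast; ring)]
    push_cast
    ring
  have h2 (l : ℕ) : ‖(k : ℂ) + (l : ℂ) + 2‖ = (k : ℝ) + l + 2 := by
    rw [norm_of_eq_natCast (k + l + 2) _ (by push_cast; ring)]
    push_cast
    ring
  have h3 : ‖(k : ℂ) + (i : ℂ) + (j : ℂ) + 3‖ = (k : ℝ) + i + j + 3 := by
    rw [norm_of_eq_natCast (k + i + j + 3) _ (by push_cast; ring)]
    push_cast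
    ring
  simp only [S2term, S2majorant, swapLast, Equiv.prodCongr_apply, Equiv.coe_refl, Prod.map_apply,
    id, Equiv.prodComm_apply, Prod.swap_prod_mk, norm_div, norm_mul, RCLike.norm_conj, h1, h2, h3]
  generalize ‖a (k + 1 + i)‖ = x
  generalize ‖a (k + 1 + j)‖ = y
  generalize ‖c (j + 1)‖ = u
  generalize ‖c (i + 1)‖ = v
  rw [show (k : ℝ) + j + i + 3 = (k : ℝ) + i + j + 3 by ring, ← sub_nonneg]
  have h0 : 0 ≤ (x * u / ((k : ℝ) + i + 2) - y * v / ((k : ℝ) + j + 2)) ^ 2 *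
      (((j : ℝ) + 1) * ((i : ℝ) + 1)) / (2 * ((k : ℝ) + i + j + 3)) := by positivity
  refine h0.trans_eq ?_
  field_simp
  ring

lemma S1term_swapLast (a c : ℕ → ℂ) (p : ℕ × ℕ × ℕ) :
    S1term a c (swapLast p) = (starRingEnd ℂ) (S1term a c p) := by
  obtain ⟨k, n, m⟩ := p
  simp only [S1term, swapLast, Equiv.prodCongr_apply, Equiv.coe_refl, Prod.map_apply,
    id, Equiv.prodComm_apply, Prod.swap_prod_mk, map_div₀, map_mul, map_add, map_natCast, map_one,
    Complex.conj_conj]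
  rw [show (m : ℂ) + n + (k + 1) + 1 = (n : ℂ) + m + (k + 1) + 1 by ring]
  ring

lemma S2term_swapLast (a c : ℕ → ℂ) (p : ℕ × ℕ × ℕ) :
    S2term a c (swapLast p) = (starRingEnd ℂ) (S2term a c p) := by
  obtain ⟨k, i, j⟩ := p
  simp only [S2term, swapLast, Equiv.prodCongr_apply, Equiv.coe_refl, Prod.map_apply,
    id, Equiv.prodComm_apply, Prod.swap_prod_mk, map_div₀, map_mul, map_add, map_natCast, map_one,
    Complex.conj_conj, map_ofNat]
  rw [show (k : ℂ) + j + i + 3 = (k : ℂ) + i + j + 3 by ring]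
  ring

lemma im_tsum_eq_zero_of_conj {X : Type*} (e : X ≃ X) (f : X → ℂ)
    (hf : ∀ x, f (e x) = (starRingEnd ℂ) (f x)) : (∑' x, f x).im = 0 := by
  rw [← Complex.conj_eq_iff_im, Complex.conj_tsum, ← e.tsum_eq f]
  exact tsum_congr fun x => (hf x).symm

lemma summable_and_re_tsum_le {X : Type*} (e : X ≃ X) {f : X → ℂ} {g : X → ℝ} {s : ℝ}
    (hg : HasSum g s) (hf : ∀ x, ‖f x‖ ≤ (g x + g (e x)) / 2) :
    Summable (fun x => ‖f x‖) ∧ (∑' x, f x).re ≤ s := by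
  have hge : HasSum (fun x => g (e x)) s := e.hasSum_iff.2 hg
  have hs : HasSum (fun x => (g x + g (e x)) / 2) s := by
    simpa using (hg.add hge).div_const 2
  have hn : Summable (fun x => ‖f x‖) := .of_nonneg_of_le (fun _ => norm_nonneg _) hf hs.summable
  exact ⟨hn, (Complex.re_le_norm _).trans ((norm_tsum_le_tsum_norm hn).trans
    ((hn.tsum_le_tsum hf hs.summable).trans_eq hs.tsum_eq))⟩

lemma sum_range_natCast_add_one (N : ℕ) :
    ∑ m ∈ Finset.range N, ((m : ℝ) + 1) = (N : ℝ) * (N + 1) / 2 := by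
  induction N with
  | zero => simp
  | succ N ih =>
    rw [Finset.sum_range_succ, ih]
    push_cast
    ring

lemma hasSum_S1majorant (a c : ℕ → ℂ)
    (h : Summable fun q : ℕ × ℕ => ‖a q.1‖ ^ 2 / ((q.1 : ℝ) + 1) *
      (((q.2 : ℝ) + 1) * ‖c (q.2 + 1)‖ ^ 2) * (((q.2 : ℝ) + 2) / (2 * ((q.1 : ℝ) + q.2 + 2)))) :
    HasSum (S1majorant a c) (∑' q : ℕ × ℕ, ‖a q.1‖ ^ 2 / ((q.1 : ℝ) + 1) *
      (((q.2 : ℝ) + 1) * ‖c (q.2 + 1)‖ ^ 2) *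
      (((q.2 : ℝ) + 2) / (2 * ((q.1 : ℝ) + q.2 + 2)))) := by
  refine hasSum_of_finite_fibers (fun p => (p.2.1, p.1 + p.2.2))
    (fun q => (Finset.range (q.2 + 1)).image fun m => (q.2 - m, q.1, m)) ?_ ?_ h ?_
  · rintro ⟨k, n, m⟩ ⟨n', j⟩
    simp only [Finset.mem_image, Finset.mem_range, Prod.mk.injEq]
    constructor
    · rintro ⟨m', h1, h2, h3, h4⟩
      omega
    · rintro ⟨h1, h2⟩
      exact ⟨m, by omega, by omega, by omega, rfl⟩
  · intro p
    unfold S1majorant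
    positivity
  · rintro ⟨n, j⟩
    rw [Finset.sum_image (by intro x _ y _; simp)]
    have hterm : ∀ m ∈ Finset.range (j + 1), S1majorant a c (j - m, n, m) =
        ‖a n‖ ^ 2 * ‖c (j + 1)‖ ^ 2 / (((n : ℝ) + 1) * (n + j + 2)) * ((m : ℝ) + 1) := by
      intro m hm
      have hm' : m ≤ j := Nat.lt_succ_iff.1 (Finset.mem_range.1 hm)
      simp only [S1majorant]
      rw [show j - m + 1 + m = j + 1 by omega, Nat.cast_sub hm',
        show (n : ℝ) + m + (j - m) + 2 = n + j + 2 by ring]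
      field_simp
    rw [Finset.sum_congr rfl hterm, ← Finset.mul_sum, sum_range_natCast_add_one]
    push_cast
    field_simp
    ring

lemma hasSum_S2majorant (a c : ℕ → ℂ)
    (h : Summable fun q : ℕ × ℕ => ‖a q.1‖ ^ 2 / ((q.1 : ℝ) + 1) *
      (((q.2 : ℝ) + 1) * ‖c (q.2 + 1)‖ ^ 2) * ((q.1 : ℝ) / (2 * ((q.1 : ℝ) + q.2 + 2)))) :
    HasSum (S2majorant a c) (∑' q : ℕ × ℕ, ‖a q.1‖ ^ 2 / ((q.1 : ℝ) + 1) *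
      (((q.2 : ℝ) + 1) * ‖c (q.2 + 1)‖ ^ 2) *
      ((q.1 : ℝ) / (2 * ((q.1 : ℝ) + q.2 + 2)))) := by
  refine hasSum_of_finite_fibers (fun p => (p.1 + 1 + p.2.1, p.2.2))
    (fun q => (Finset.range q.1).image fun i => (q.1 - 1 - i, i, q.2)) ?_ ?_ h ?_
  · rintro ⟨k, i, j⟩ ⟨n, j'⟩
    simp only [Finset.mem_image, Finset.mem_range, Prod.mk.injEq]
    constructor
    · rintro ⟨i', h1, h2, h3, h4⟩
      omega
    · rintro ⟨h1, h2⟩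
      exact ⟨i, by omega, by omega, rfl, by omega⟩
  · intro p
    unfold S2majorant
    positivity
  · rintro ⟨n, j⟩
    rw [Finset.sum_image (by intro x _ y _; simp)]
    have hterm : ∀ i ∈ Finset.range n, S2majorant a c (n - 1 - i, i, j) =
        ‖a n‖ ^ 2 * ‖c (j + 1)‖ ^ 2 * ((j : ℝ) + 1) / (((n : ℝ) + 1) ^ 2 * (n + j + 2)) *
          ((i : ℝ) + 1) := by
      intro i hi
      obtain ⟨k, rfl⟩ : ∃ k, n = k + 1 + i :=
        ⟨n - 1 - i, by have := Finset.mem_range.1 hi; omega⟩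
      simp only [S2majorant]
      rw [show k + 1 + i - 1 - i = k by omega]
      push_cast
      rw [show (k : ℝ) + 1 + i + 1 = k + i + 2 by ring,
        show (k : ℝ) + 1 + i + j + 2 = k + i + j + 3 by ring]
      field_simp
    rw [Finset.sum_congr rfl hterm, ← Finset.mul_sum, sum_range_natCast_add_one]
    field_simp

/-- Coefficient form of the sharp Hankel estimate on the Bergman space `A²(𝔻)`:
with `f = ∑ a_n z^n`, `ψ = ∑_{k≥1} c_k z^k`, the double series `S₁` and `S₂`
converge absolutely, are real, and `S₁ + S₂ ≤ (1/2)(∑ |a_n|²/(n+1))(∑ m|c_m|²)`. -/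
theorem hankel_coefficient_estimate_bergman
    (a c : ℕ → ℂ)
    (ha : Summable (fun n : ℕ => ‖a n‖ ^ 2 / ((n : ℝ) + 1)))
    (hc : Summable (fun m : ℕ => ((m : ℝ) + 1) * ‖c (m + 1)‖ ^ 2)) :
    Summable (fun p : ℕ × ℕ × ℕ => ‖S1term a c p‖) ∧
    Summable (fun p : ℕ × ℕ × ℕ => ‖S2term a c p‖) ∧
    (∑' p : ℕ × ℕ × ℕ, S1term a c p).im = 0 ∧
    (∑' p : ℕ × ℕ × ℕ, S2term a c p).im = 0 ∧
    (∑' p : ℕ × ℕ × ℕ, S1term a c p).re + (∑' p : ℕ × ℕ × ℕ, S2term a c p).re ≤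
      (1 / 2) * (∑' n : ℕ, ‖a n‖ ^ 2 / ((n : ℝ) + 1)) *
        (∑' m : ℕ, ((m : ℝ) + 1) * ‖c (m + 1)‖ ^ 2) := by
  have hH := ha.mul_of_nonneg hc (fun n => by positivity) (fun m => by positivity)
  have bound : ∀ (w : ℕ × ℕ → ℝ), (∀ q, 0 ≤ w q) → (∀ q, w q ≤ 1) →
      Summable fun q : ℕ × ℕ => ‖a q.1‖ ^ 2 / ((q.1 : ℝ) + 1) *
        (((q.2 : ℝ) + 1) * ‖c (q.2 + 1)‖ ^ 2) * w q := fun w h0 h1 =>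
    .of_nonneg_of_le (fun q => mul_nonneg (by positivity) (h0 q))
      (fun q => mul_le_of_le_one_right (by positivity) (h1 q)) hH
  have h1 := bound (fun q => ((q.2 : ℝ) + 2) / (2 * ((q.1 : ℝ) + q.2 + 2)))
    (fun q => by positivity) fun q => by
      rw [div_le_one (by positivity)]
      have := Nat.cast_nonneg (α := ℝ) q.1
      have := Nat.cast_nonneg (α := ℝ) q.2
      linarith
  have h2 := bound (fun q => (q.1 : ℝ) / (2 * ((q.1 : ℝ) + q.2 + 2)))
    (fun q => by positivity) fun q => by
      rw [div_le_one (by positivity)]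
      have := Nat.cast_nonneg (α := ℝ) q.1
      have := Nat.cast_nonneg (α := ℝ) q.2
      linarith
  obtain ⟨s1, le1⟩ := summable_and_re_tsum_le swapLast (hasSum_S1majorant a c h1)
    (norm_S1term_le a c)
  obtain ⟨s2, le2⟩ := summable_and_re_tsum_le swapLast (hasSum_S2majorant a c h2)
    (norm_S2term_le a c)
  refine ⟨s1, s2, im_tsum_eq_zero_of_conj swapLast _ (S1term_swapLast a c),
    im_tsum_eq_zero_of_conj swapLast _ (S2term_swapLast a c), (add_le_add le1 le2).trans_eq ?_⟩
  rw [← h1.tsum_add h2, mul_assoc, ha.tsum_mul_tsum hc hH, ← tsum_mul_left]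
  refine tsum_congr fun q => ?_
  field_simp
  ring
end

section
/- Let α ≥ −1 be real, set D_n = n!·Γ(α+2)/Γ(n+α+2) for n ∈ ℕ, and let (a_n)_{n≥0}, (c_k)_{k≥1} be complex sequences with ∑_{n≥0} D_n|a_n|² < ∞ and ∑_{k≥1} k|c_k|² < ∞. Then the double series S₁ = ∑_{k≥1} ∑_{n,m≥0} a_n conj(a_m) c_{k+m} conj(c_{k+n}) · D_{n+m+k} and S₂ = ∑_{k≥0} ∑_{n,m≥k+1} a_n conj(a_m) c_{m−k} conj(c_{n−k}) · (D_{n+m−k} − D_n D_m / D_k) converge absolutely, S₁ and S₂ are real, and S₁ + S₂ ≤ (1/(2+α)) · (∑_{n≥0} D_n|a_n|²) · (∑_{m≥1} m|c_m|²). (This is the coefficient form of the sharp Hankel estimate on the weighted Bergman space A²_α(𝔻).) -/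
open Complex

/-- The weight coefficients `D_n = n!·Γ(α+2)/Γ(n+α+2)` of the weighted Bergman
space `A²_α(𝔻)`. -/
noncomputable def Dcoeff (α : ℝ) (n : ℕ) : ℝ :=
  (Nat.factorial n : ℝ) * Real.Gamma (α + 2) / Real.Gamma ((n : ℝ) + α + 2)

/-- Term of `S₁ = ∑_{k≥1}∑_{n,m≥0} a_n conj(a_m) c_{k+m} conj(c_{k+n}) D_{n+m+k}`,
reindexed by `p = (k', n, m)` with `k = k'+1`. -/
noncomputable def S1termW (α : ℝ) (a c : ℕ → ℂ) (p : ℕ × ℕ × ℕ) : ℂ :=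
  a p.2.1 * (starRingEnd ℂ) (a p.2.2) * c (p.1 + 1 + p.2.2) *
      (starRingEnd ℂ) (c (p.1 + 1 + p.2.1)) *
    ((Dcoeff α (p.2.1 + p.2.2 + (p.1 + 1)) : ℝ) : ℂ)

/-- Term of
`S₂ = ∑_{k≥0}∑_{n,m≥k+1} a_n conj(a_m) c_{m-k} conj(c_{n-k}) (D_{n+m-k} - D_n D_m / D_k)`,
reindexed by `p = (k, i, j)` with `n = k+1+i`, `m = k+1+j`. -/
noncomputable def S2termW (α : ℝ) (a c : ℕ → ℂ) (p : ℕ × ℕ × ℕ) : ℂ :=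
  a (p.1 + 1 + p.2.1) * (starRingEnd ℂ) (a (p.1 + 1 + p.2.2)) * c (p.2.2 + 1) *
      (starRingEnd ℂ) (c (p.2.1 + 1)) *
    (((Dcoeff α (p.1 + p.2.1 + p.2.2 + 2) -
        Dcoeff α (p.1 + 1 + p.2.1) * Dcoeff α (p.1 + 1 + p.2.2) / Dcoeff α p.1 : ℝ)) : ℂ)

theorem Dcoeff_pos {α : ℝ} (hα : -1 ≤ α) (n : ℕ) : 0 < Dcoeff α n := by
  have hn : (0 : ℝ) ≤ n := n.cast_nonneg
  have h₁ : 0 < Real.Gamma (α + 2) := Real.Gamma_pos_of_pos (by linarith)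
  have h₂ : 0 < Real.Gamma ((n : ℝ) + α + 2) := Real.Gamma_pos_of_pos (by linarith)
  unfold Dcoeff
  positivity

theorem Dcoeff_succ {α : ℝ} (hα : -1 ≤ α) (n : ℕ) :
    Dcoeff α (n + 1) = Dcoeff α n * (((n : ℝ) + 1) / ((n : ℝ) + α + 2)) := by
  have hn : (0 : ℝ) ≤ n := n.cast_nonneg
  have hpos : 0 < (n : ℝ) + α + 2 := by linarith
  have hΓ : Real.Gamma ((n : ℝ) + α + 2) ≠ 0 := (Real.Gamma_pos_of_pos hpos).ne'
  have hrec : Real.Gamma (((n + 1 : ℕ) : ℝ) + α + 2) =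
      ((n : ℝ) + α + 2) * Real.Gamma ((n : ℝ) + α + 2) := by
    rw [← Real.Gamma_add_one hpos.ne']
    congr 1
    push_cast
    ring
  unfold Dcoeff
  rw [hrec, Nat.factorial_succ]
  push_cast
  field_simp

/-- Log-convexity of the weights. -/
theorem Dcoeff_mul_le {α : ℝ} (hα : -1 ≤ α) (k i j : ℕ) :
    Dcoeff α (k + i) * Dcoeff α (k + j) ≤ Dcoeff α k * Dcoeff α (k + i + j) := by
  induction j with
  | zero => simp [mul_comm]
  | succ j ih =>
    have hk : (0 : ℝ) ≤ k := k.cast_nonneg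
    have hi : (0 : ℝ) ≤ i := i.cast_nonneg
    have hj : (0 : ℝ) ≤ j := j.cast_nonneg
    have hratio : (((k + j : ℕ) : ℝ) + 1) / (((k + j : ℕ) : ℝ) + α + 2) ≤
        (((k + i + j : ℕ) : ℝ) + 1) / (((k + i + j : ℕ) : ℝ) + α + 2) := by
      push_cast
      rw [div_le_div_iff₀ (by linarith) (by linarith)]
      nlinarith [mul_nonneg hi (show 0 ≤ α + 1 by linarith)]
    rw [← add_assoc, ← add_assoc, Dcoeff_succ hα, Dcoeff_succ hα, ← mul_assoc, ← mul_assoc]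
    refine mul_le_mul ih hratio ?_ (mul_pos (Dcoeff_pos hα _) (Dcoeff_pos hα _)).le
    exact div_nonneg (by positivity) (by push_cast; linarith)

theorem sum_Dcoeff_div {α : ℝ} (hα : -1 ≤ α) (n : ℕ) :
    ∑ j ∈ Finset.range n, Dcoeff α n / Dcoeff α j = n / (2 + α) := by
  induction n with
  | zero => simp
  | succ n ih =>
    have hn : (0 : ℝ) ≤ n := n.cast_nonneg
    have hne : (n : ℝ) + α + 2 ≠ 0 := by linarith
    have hne' : 2 + α ≠ 0 := by linarith
    have hD := (Dcoeff_pos hα n).ne'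
    have hstep : ∀ j, Dcoeff α (n + 1) / Dcoeff α j =
        (((n : ℝ) + 1) / ((n : ℝ) + α + 2)) * (Dcoeff α n / Dcoeff α j) := fun j => by
      rw [Dcoeff_succ hα]
      ring
    simp_rw [hstep]
    rw [← Finset.mul_sum, Finset.sum_range_succ, ih, div_self hD]
    push_cast
    field_simp
    ring

/-- A weighted arithmetic-geometric mean inequality. -/
theorem mul_mul_le_half_weighted {w x y s t : ℝ} (hw : 0 ≤ w) (hs : 0 < s) (ht : 0 < t) :
    w * (x * y) ≤ (w * (s / t) * x ^ 2 + w * (t / s) * y ^ 2) / 2 := by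
  have h : x * y ≤ (s / t * x ^ 2 + t / s * y ^ 2) / 2 := by
    have : (s / t * x ^ 2 + t / s * y ^ 2) / 2 - x * y = (s * x - t * y) ^ 2 / (2 * (s * t)) := by
      field_simp
      ring
    have : 0 ≤ (s * x - t * y) ^ 2 / (2 * (s * t)) := by positivity
    linarith
  calc w * (x * y) ≤ w * ((s / t * x ^ 2 + t / s * y ^ 2) / 2) := by gcongr
    _ = _ := by ring

/-- A family that is conjugated by a permutation `σ` of its indices and dominated by the
symmetrization of a summable `G` is absolutely summable, with real sum at most `∑ G`. -/
theorem tsum_of_conj_symm {ι : Type*} (σ : ι ≃ ι) {T : ι → ℂ} {G : ι → ℝ} (hG : Summable G)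
    (hbound : ∀ p, ‖T p‖ ≤ (G p + G (σ p)) / 2)
    (hconj : ∀ p, (starRingEnd ℂ) (T p) = T (σ p)) :
    Summable (fun p => ‖T p‖) ∧ (∑' p, T p).im = 0 ∧ (∑' p, T p).re ≤ ∑' p, G p := by
  have hGσ : Summable (fun p => G (σ p)) := (σ.summable_iff (f := G)).2 hG
  have hmaj : Summable (fun p => (G p + G (σ p)) / 2) := (hG.add hGσ).div_const 2
  have hT : Summable (fun p => ‖T p‖) :=
    Summable.of_nonneg_of_le (fun _ => norm_nonneg _) hbound hmaj
  refine ⟨hT, ?_, ?_⟩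
  · rw [← Complex.conj_eq_iff_im, Complex.conj_tsum]
    simp_rw [hconj]
    exact σ.tsum_eq T
  · calc (∑' p, T p).re ≤ ‖∑' p, T p‖ := Complex.re_le_norm _
      _ ≤ ∑' p, ‖T p‖ := norm_tsum_le_tsum_norm hT
      _ ≤ ∑' p, (G p + G (σ p)) / 2 := hT.tsum_le_tsum hbound hmaj
      _ = ∑' p, G p := by
        rw [tsum_div_const, hG.tsum_add hGσ, σ.tsum_eq G]
        ring

/-- Summation over finite fibres: if `e` embeds the index set of `G` into pairs `(x, m)` with
`m ∈ s x`, then `∑ G` is bounded by the iterated sum. -/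
theorem tsum_le_tsum_sum_fiber {ι κ : Type*} {G : ι → ℝ} {F : κ → ℕ → ℝ} {s : κ → Finset ℕ}
    {e : ι → κ × ℕ} (he : Function.Injective e) (hmem : ∀ p, (e p).2 ∈ s (e p).1)
    (hGF : ∀ p, G p = F (e p).1 (e p).2) (hF : ∀ x, ∀ m ∈ s x, 0 ≤ F x m)
    (hsum : Summable (fun x => ∑ m ∈ s x, F x m)) :
    Summable G ∧ ∑' p, G p ≤ ∑' x, ∑ m ∈ s x, F x m := by
  classical
  let H : κ × ℕ → ℝ := fun y => if y.2 ∈ s y.1 then F y.1 y.2 else 0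
  have hH : ∀ y, 0 ≤ H y := fun y => by
    by_cases h : y.2 ∈ s y.1
    · simpa [H, h] using hF _ _ h
    · simp [H, h]
  have hfiber : ∀ x, HasSum (fun m => H (x, m)) (∑ m ∈ s x, F x m) := fun x => by
    have h : HasSum (fun m => H (x, m)) (∑ m ∈ s x, H (x, m)) :=
      hasSum_sum_of_ne_finset_zero fun m hm => by simp [H, hm]
    rwa [Finset.sum_congr rfl (fun m hm => by simp [H, hm] : ∀ m ∈ s x, H (x, m) = F x m)] at h
  have hHs : Summable H := by
    rw [summable_prod_of_nonneg hH]
    refine ⟨fun x => (hfiber x).summable, ?_⟩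
    simpa only [(hfiber _).tsum_eq] using hsum
  have hGH : G = H ∘ e := by
    ext p
    simp [H, hmem p, hGF p]
  have hHe : Summable (H ∘ e) := hHs.comp_injective he
  refine ⟨hGH ▸ hHe, ?_⟩
  calc ∑' p, G p = ∑' p, H (e p) := by rw [hGH]; rfl
    _ ≤ ∑' y, H y := tsum_comp_le_tsum_of_inj hHs hH he
    _ = ∑' x, ∑ m ∈ s x, F x m := by
      rw [hHs.tsum_prod' fun x => (hfiber x).summable]
      simp only [(hfiber _).tsum_eq]

/-- The weighted bound for the terms of `S₁`, in terms of `x = (n, P)` with `P + 1` the index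
of `c`. -/
noncomputable def S1weight (α : ℝ) (a c : ℕ → ℂ) (x : ℕ × ℕ) (m : ℕ) : ℝ :=
  Dcoeff α (x.1 + x.2 + 1) * (Dcoeff α x.1 / Dcoeff α m) * (‖a x.1‖ * ‖c (x.2 + 1)‖) ^ 2

/-- The weighted bound for the terms of `S₂`, in terms of `x = (n, P)` with `P + 1` the index
of `c`. -/
noncomputable def S2weight (α : ℝ) (a c : ℕ → ℂ) (x : ℕ × ℕ) (k : ℕ) : ℝ :=
  (Dcoeff α (x.1 + x.2 + 1) - Dcoeff α x.1 * Dcoeff α (k + 1 + x.2) / Dcoeff α k) *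
    (Dcoeff α x.1 / Dcoeff α (k + 1 + x.2)) * (‖a x.1‖ * ‖c (x.2 + 1)‖) ^ 2

theorem Dcoeff_sub_nonneg {α : ℝ} (hα : -1 ≤ α) {n k : ℕ} (hk : k ≤ n) (P : ℕ) :
    0 ≤ Dcoeff α (n + P + 1) - Dcoeff α n * Dcoeff α (k + 1 + P) / Dcoeff α k := by
  obtain ⟨i, rfl⟩ := Nat.exists_eq_add_of_le hk
  rw [sub_nonneg, div_le_iff₀ (Dcoeff_pos hα k), mul_comm (Dcoeff α (k + i + P + 1))]
  have h := Dcoeff_mul_le hα k i (P + 1)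
  rwa [show k + (P + 1) = k + 1 + P by ring, ← add_assoc (k + i)] at h

theorem S1weight_nonneg {α : ℝ} (hα : -1 ≤ α) (a c : ℕ → ℂ) (x : ℕ × ℕ) (m : ℕ) :
    0 ≤ S1weight α a c x m := by
  have h := Dcoeff_pos hα
  exact mul_nonneg (mul_nonneg (h _).le (div_nonneg (h _).le (h _).le)) (sq_nonneg _)

theorem S2weight_nonneg {α : ℝ} (hα : -1 ≤ α) (a c : ℕ → ℂ) (x : ℕ × ℕ) {k : ℕ}
    (hk : k ≤ x.1) : 0 ≤ S2weight α a c x k := by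
  have h := Dcoeff_pos hα
  exact mul_nonneg (mul_nonneg (Dcoeff_sub_nonneg hα hk x.2) (div_nonneg (h _).le (h _).le))
    (sq_nonneg _)

theorem sum_S1weight_add_sum_S2weight {α : ℝ} (hα : -1 ≤ α) (a c : ℕ → ℂ) (x : ℕ × ℕ) :
    ∑ m ∈ Finset.range (x.2 + 1), S1weight α a c x m +
        ∑ k ∈ Finset.range x.1, S2weight α a c x k =
      1 / (2 + α) * ((Dcoeff α x.1 * ‖a x.1‖ ^ 2) * (((x.2 : ℝ) + 1) * ‖c (x.2 + 1)‖ ^ 2)) := by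
  obtain ⟨n, P⟩ := x
  have hα' : 2 + α ≠ 0 := by linarith
  set A := Dcoeff α n * (‖a n‖ * ‖c (P + 1)‖) ^ 2 with hA
  have h₁ : ∀ m, S1weight α a c (n, P) m = A * (Dcoeff α (n + P + 1) / Dcoeff α m) := fun m => by
    simp only [S1weight, hA]
    ring
  have h₂ : ∀ k, S2weight α a c (n, P) k =
      A * (Dcoeff α (n + P + 1) / Dcoeff α (P + 1 + k)) - A * (Dcoeff α n / Dcoeff α k) :=
    fun k => by
      have hD := (Dcoeff_pos hα (P + 1 + k)).ne'
      have hD' := (Dcoeff_pos hα k).ne'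
      simp only [S2weight, hA, show k + 1 + P = P + 1 + k by ring]
      field_simp
  have h := sum_Dcoeff_div hα (P + 1 + n)
  rw [Finset.sum_range_add, show P + 1 + n = n + P + 1 by ring] at h
  simp only [h₁, h₂]
  rw [Finset.sum_sub_distrib, ← Finset.mul_sum, ← Finset.mul_sum, ← Finset.mul_sum,
    sum_Dcoeff_div hα n, ← add_sub_assoc, ← mul_add, h, hA]
  push_cast
  field_simp
  ring

theorem norm_S1termW_le {α : ℝ} (hα : -1 ≤ α) (a c : ℕ → ℂ) (k n m : ℕ) :
    ‖S1termW α a c (k, n, m)‖ ≤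
      (S1weight α a c (n, k + m) m + S1weight α a c (m, k + n) n) / 2 := by
  have h := mul_mul_le_half_weighted (x := ‖a n‖ * ‖c (k + m + 1)‖)
    (y := ‖a m‖ * ‖c (k + n + 1)‖) (Dcoeff_pos hα (n + m + (k + 1))).le
    (Dcoeff_pos hα n) (Dcoeff_pos hα m)
  simp only [S1weight, S1termW, norm_mul, RCLike.norm_conj, Complex.norm_real, Real.norm_eq_abs,
    abs_of_pos (Dcoeff_pos hα _)]
  rw [show n + (k + m) + 1 = n + m + (k + 1) by ring,
    show m + (k + n) + 1 = n + m + (k + 1) by ring, show k + 1 + m = k + m + 1 by ring,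
    show k + 1 + n = k + n + 1 by ring]
  refine le_of_eq_of_le ?_ h
  ring

theorem norm_S2termW_le {α : ℝ} (hα : -1 ≤ α) (a c : ℕ → ℂ) (k i j : ℕ) :
    ‖S2termW α a c (k, i, j)‖ ≤
      (S2weight α a c (k + 1 + i, j) k + S2weight α a c (k + 1 + j, i) k) / 2 := by
  have hW := Dcoeff_sub_nonneg hα (show k ≤ k + 1 + i by omega) j
  have h := mul_mul_le_half_weighted (x := ‖a (k + 1 + i)‖ * ‖c (j + 1)‖)
    (y := ‖a (k + 1 + j)‖ * ‖c (i + 1)‖) hW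
    (Dcoeff_pos hα (k + 1 + i)) (Dcoeff_pos hα (k + 1 + j))
  simp only [S2weight, S2termW, norm_mul, RCLike.norm_conj, Complex.norm_real, Real.norm_eq_abs]
  rw [show k + i + j + 2 = k + 1 + i + j + 1 by ring, abs_of_nonneg hW,
    show k + 1 + j + i + 1 = k + 1 + i + j + 1 by ring,
    mul_comm (Dcoeff α (k + 1 + j)) (Dcoeff α (k + 1 + i))]
  refine le_of_eq_of_le ?_ h
  ring

theorem conj_S1termW (α : ℝ) (a c : ℕ → ℂ) (p : ℕ × ℕ × ℕ) :
    (starRingEnd ℂ) (S1termW α a c p) = S1termW α a c (swapLast p) := by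
  obtain ⟨k, n, m⟩ := p
  simp only [swapLast, S1termW, map_mul, Complex.conj_conj, Complex.conj_ofReal,
    Equiv.prodCongr_apply, Prod.map, Equiv.refl_apply, Equiv.prodComm_apply, Prod.swap,
    add_comm m n]
  ring

theorem conj_S2termW (α : ℝ) (a c : ℕ → ℂ) (p : ℕ × ℕ × ℕ) :
    (starRingEnd ℂ) (S2termW α a c p) = S2termW α a c (swapLast p) := by
  obtain ⟨k, i, j⟩ := p
  simp only [swapLast, S2termW, map_mul, Complex.conj_conj, Complex.conj_ofReal,
    Equiv.prodCongr_apply, Prod.map, Equiv.refl_apply, Equiv.prodComm_apply, Prod.swap,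
    add_right_comm k j i, mul_comm (Dcoeff α (k + 1 + j)) (Dcoeff α (k + 1 + i))]
  ring

/-- Coefficient form of the sharp Hankel estimate on the weighted Bergman space
`A²_α(𝔻)`, `α ≥ -1`: the double series `S₁` and `S₂` converge absolutely, are real,
and `S₁ + S₂ ≤ (1/(2+α)) (∑_{n≥0} D_n|a_n|²)(∑_{m≥1} m|c_m|²)`. -/
theorem hankel_coefficient_estimate_weighted_bergman
    (α : ℝ) (hα : -1 ≤ α)
    (a c : ℕ → ℂ)
    (ha : Summable (fun n : ℕ => Dcoeff α n * ‖a n‖ ^ 2))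
    (hc : Summable (fun m : ℕ => ((m : ℝ) + 1) * ‖c (m + 1)‖ ^ 2)) :
    Summable (fun p : ℕ × ℕ × ℕ => ‖S1termW α a c p‖) ∧
    Summable (fun p : ℕ × ℕ × ℕ => ‖S2termW α a c p‖) ∧
    (∑' p : ℕ × ℕ × ℕ, S1termW α a c p).im = 0 ∧
    (∑' p : ℕ × ℕ × ℕ, S2termW α a c p).im = 0 ∧
    (∑' p : ℕ × ℕ × ℕ, S1termW α a c p).re + (∑' p : ℕ × ℕ × ℕ, S2termW α a c p).re ≤
      (1 / (2 + α)) * (∑' n : ℕ, Dcoeff α n * ‖a n‖ ^ 2) *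
        (∑' m : ℕ, ((m : ℝ) + 1) * ‖c (m + 1)‖ ^ 2) := by
  set h₁ : ℕ × ℕ → ℝ := fun x => ∑ m ∈ Finset.range (x.2 + 1), S1weight α a c x m
  set h₂ : ℕ × ℕ → ℝ := fun x => ∑ k ∈ Finset.range x.1, S2weight α a c x k
  have h₁_nonneg : ∀ x, 0 ≤ h₁ x := fun x =>
    Finset.sum_nonneg fun m _ => S1weight_nonneg hα a c x m
  have h₂_nonneg : ∀ x, 0 ≤ h₂ x := fun x =>
    Finset.sum_nonneg fun k hk => S2weight_nonneg hα a c x (Finset.mem_range.1 hk).le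
  have hprod : Summable (fun x : ℕ × ℕ =>
      (Dcoeff α x.1 * ‖a x.1‖ ^ 2) * (((x.2 : ℝ) + 1) * ‖c (x.2 + 1)‖ ^ 2)) :=
    ha.mul_of_nonneg hc (fun n => mul_nonneg (Dcoeff_pos hα n).le (sq_nonneg _))
      (fun m => by positivity)
  have hadd : ∀ x, h₁ x + h₂ x = 1 / (2 + α) *
      ((Dcoeff α x.1 * ‖a x.1‖ ^ 2) * (((x.2 : ℝ) + 1) * ‖c (x.2 + 1)‖ ^ 2)) :=
    sum_S1weight_add_sum_S2weight hα a c
  have hadd_summable : Summable (fun x => h₁ x + h₂ x) := by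
    simp only [hadd]
    exact hprod.mul_left _
  have h₁_summable : Summable h₁ :=
    hadd_summable.of_nonneg_of_le h₁_nonneg fun x => le_add_of_nonneg_right (h₂_nonneg x)
  have h₂_summable : Summable h₂ :=
    hadd_summable.of_nonneg_of_le h₂_nonneg fun x => le_add_of_nonneg_left (h₁_nonneg x)
  obtain ⟨hG₁, hG₁_le⟩ := tsum_le_tsum_sum_fiber
    (G := fun p : ℕ × ℕ × ℕ => S1weight α a c (p.2.1, p.1 + p.2.2) p.2.2)
    (F := S1weight α a c) (s := fun x => Finset.range (x.2 + 1))
    (e := fun p => ((p.2.1, p.1 + p.2.2), p.2.2))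
    (by
      rintro ⟨k, n, m⟩ ⟨k', n', m'⟩ h
      simp only [Prod.mk.injEq] at h ⊢
      omega)
    (fun p => by simp only [Finset.mem_range]; omega) (fun _ => rfl)
    (fun x m _ => S1weight_nonneg hα a c x m) h₁_summable
  obtain ⟨hG₂, hG₂_le⟩ := tsum_le_tsum_sum_fiber
    (G := fun p : ℕ × ℕ × ℕ => S2weight α a c (p.1 + 1 + p.2.1, p.2.2) p.1)
    (F := S2weight α a c) (s := fun x => Finset.range x.1)
    (e := fun p => ((p.1 + 1 + p.2.1, p.2.2), p.1))
    (by
      rintro ⟨k, n, m⟩ ⟨k', n', m'⟩ h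
      simp only [Prod.mk.injEq] at h ⊢
      omega)
    (fun p => by simp only [Finset.mem_range]; omega) (fun _ => rfl)
    (fun x k hk => S2weight_nonneg hα a c x (Finset.mem_range.1 hk).le) h₂_summable
  obtain ⟨hS₁, him₁, hre₁⟩ := tsum_of_conj_symm swapLast hG₁
    (fun p => norm_S1termW_le hα a c p.1 p.2.1 p.2.2) (conj_S1termW α a c)
  obtain ⟨hS₂, him₂, hre₂⟩ := tsum_of_conj_symm swapLast hG₂
    (fun p => norm_S2termW_le hα a c p.1 p.2.1 p.2.2) (conj_S2termW α a c)
  refine ⟨hS₁, hS₂, him₁, him₂, ?_⟩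
  calc _ ≤ ∑' x, h₁ x + ∑' x, h₂ x := add_le_add (hre₁.trans hG₁_le) (hre₂.trans hG₂_le)
    _ = ∑' x, (h₁ x + h₂ x) := (h₁_summable.tsum_add h₂_summable).symm
    _ = _ := by
      simp only [hadd]
      rw [tsum_mul_left, ← ha.tsum_mul_tsum hc hprod, mul_assoc]
end

section
/- Let x : {1,2,3,…} → [0,∞] and y : {1,2,3,…} → [0,∞] be families of extended nonnegative reals. Then ∑_{n≥1} ∑_{m≥1} ∑_{k≥0} x_n · y_{m+k} · nm/(n+m+k) + ∑_{n≥1} ∑_{m≥1} ∑_{k≥1} x_{n+k} · y_m · nm/(n+m+k) = (1/2) ∑_{n≥1} ∑_{m≥1} x_n · y_m · n·m, as an identity in [0,∞]. -/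
open scoped ENNReal

theorem ENNReal.tsum_tsum_eq_tsum_sum_range (f : ℕ → ℕ → ℝ≥0∞) :
    ∑' (a : ℕ) (b : ℕ), f a b = ∑' s : ℕ, ∑ a ∈ Finset.range (s + 1), f a (s - a) := by
  rw [← ENNReal.tsum_prod, ← Finset.HasAntidiagonal.sigmaAntidiagonalEquivProd.tsum_eq,
    ENNReal.tsum_sigma']
  refine tsum_congr fun s => ?_
  rw [← Finset.Nat.sum_antidiagonal_eq_sum_range_succ f s, tsum_fintype]
  exact Finset.sum_coe_sort (Finset.HasAntidiagonal.antidiagonal s) (fun p : ℕ × ℕ => f p.1 p.2)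

theorem Finset.two_mul_sum_range_succ_id (n : ℕ) :
    2 * ∑ a ∈ Finset.range n, (a + 1) = n * (n + 1) := by
  induction n with
  | zero => simp
  | succ n ih => rw [Finset.sum_range_succ, mul_add, ih]; ring

/-- The coefficient of `x_{N+1} y_{M+1}` on the left-hand side of the summation identity. -/
theorem hankel_coefficient_identity (N M : ℕ) :
    ((N : ℝ≥0∞) + 1) * (∑ a ∈ Finset.range (M + 1), ((a : ℝ≥0∞) + 1)) / ((N : ℝ≥0∞) + M + 2) +
      (∑ a ∈ Finset.range N, ((a : ℝ≥0∞) + 1)) * ((M : ℝ≥0∞) + 1) / ((N : ℝ≥0∞) + M + 2) =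
    (1 / 2) * (((N : ℝ≥0∞) + 1) * ((M : ℝ≥0∞) + 1)) := by
  have key : 2 * ((N + 1) * (∑ a ∈ Finset.range (M + 1), (a + 1)) +
      (∑ a ∈ Finset.range N, (a + 1)) * (M + 1)) = (N + 1) * (M + 1) * (N + M + 2) := by
    linear_combination (N + 1) * Finset.two_mul_sum_range_succ_id (M + 1) +
      (M + 1) * Finset.two_mul_sum_range_succ_id N
  have key' := congrArg (Nat.cast : ℕ → ℝ≥0∞) key
  push_cast at key'
  have hne : (N : ℝ≥0∞) + M + 2 ≠ 0 := by simp
  have htop : (N : ℝ≥0∞) + M + 2 ≠ ⊤ := by finiteness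
  rw [ENNReal.div_add_div_same, eq_comm, ENNReal.eq_div_iff hne htop, eq_comm]
  calc _ = 1 / 2 * (2 * (((N : ℝ≥0∞) + 1) * (∑ a ∈ Finset.range (M + 1), ((a : ℝ≥0∞) + 1)) +
        (∑ a ∈ Finset.range N, ((a : ℝ≥0∞) + 1)) * ((M : ℝ≥0∞) + 1))) := by
        rw [← mul_assoc, one_div, ENNReal.inv_mul_cancel two_ne_zero ENNReal.ofNat_ne_top, one_mul]
    _ = _ := by rw [key']; ring

/-- Collecting the terms of the first sum by the value of `m + k`. -/
theorem tsum_tsum_hankel_left (x y : ℕ → ℝ≥0∞) (N : ℕ) :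
    ∑' (m : ℕ) (k : ℕ), x (N + 1) * y (m + 1 + k) *
      (((N : ℝ≥0∞) + 1) * ((m : ℝ≥0∞) + 1) / ((N : ℝ≥0∞) + 1 + ((m : ℝ≥0∞) + 1) + k)) =
    ∑' M : ℕ, x (N + 1) * y (M + 1) *
      (((N : ℝ≥0∞) + 1) * (∑ a ∈ Finset.range (M + 1), ((a : ℝ≥0∞) + 1)) /
        ((N : ℝ≥0∞) + M + 2)) := by
  rw [ENNReal.tsum_tsum_eq_tsum_sum_range]
  refine tsum_congr fun M => ?_
  simp only [div_eq_mul_inv, Finset.mul_sum, Finset.sum_mul]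
  refine Finset.sum_congr rfl fun a ha => ?_
  obtain ⟨b, rfl⟩ := Nat.exists_eq_add_of_le (Finset.mem_range_succ_iff.mp ha)
  have h1 : a + 1 + (a + b - a) = a + b + 1 := by omega
  have h2 : (N : ℝ≥0∞) + 1 + ((a : ℝ≥0∞) + 1) + b = (N : ℝ≥0∞) + (a + b : ℕ) + 2 := by
    push_cast; ring
  rw [h1, Nat.add_sub_cancel_left, h2]

/-- Collecting the terms of the second sum by the value of `n + k`. -/
theorem tsum_tsum_hankel_right (x y : ℕ → ℝ≥0∞) (M : ℕ) :
    ∑' (n : ℕ) (k : ℕ), x (n + 1 + (k + 1)) * y (M + 1) *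
      (((n : ℝ≥0∞) + 1) * ((M : ℝ≥0∞) + 1) /
        ((n : ℝ≥0∞) + 1 + ((M : ℝ≥0∞) + 1) + ((k : ℝ≥0∞) + 1))) =
    ∑' N : ℕ, x (N + 1) * y (M + 1) *
      ((∑ a ∈ Finset.range N, ((a : ℝ≥0∞) + 1)) * ((M : ℝ≥0∞) + 1) /
        ((N : ℝ≥0∞) + M + 2)) := by
  symm
  rw [tsum_eq_zero_add' ENNReal.summable]
  simp only [Finset.range_zero, Finset.sum_empty, zero_mul, ENNReal.zero_div, mul_zero, zero_add]
  rw [ENNReal.tsum_tsum_eq_tsum_sum_range, eq_comm]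
  refine tsum_congr fun N => ?_
  simp only [div_eq_mul_inv, Finset.mul_sum, Finset.sum_mul]
  refine Finset.sum_congr rfl fun a ha => ?_
  obtain ⟨b, rfl⟩ := Nat.exists_eq_add_of_le (Finset.mem_range_succ_iff.mp ha)
  have h1 : a + 1 + (a + b - a + 1) = a + b + 1 + 1 := by omega
  have h2 : (a : ℝ≥0∞) + 1 + ((M : ℝ≥0∞) + 1) + ((b : ℝ≥0∞) + 1) =
      (a + b + 1 : ℕ) + (M : ℝ≥0∞) + 2 := by
    push_cast; ring
  rw [h1, Nat.add_sub_cancel_left, h2]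

/-- The combinatorial summation identity behind the sharp Hankel estimate, as an
identity in `[0,∞]`: for families `x, y` of extended nonnegative reals indexed by the
positive integers (here `x (n+1)` plays the role of `x_{n+1}`),
`∑_{n,m≥1,k≥0} x_n y_{m+k} nm/(n+m+k) + ∑_{n,m,k≥1} x_{n+k} y_m nm/(n+m+k)
  = (1/2) ∑_{n,m≥1} x_n y_m n m`. -/
theorem hankel_summation_identity_ennreal (x y : ℕ → ℝ≥0∞) :
    (∑' (n : ℕ) (m : ℕ) (k : ℕ),
        x (n + 1) * y (m + 1 + k) *
          (((n : ℝ≥0∞) + 1) * ((m : ℝ≥0∞) + 1) / ((n : ℝ≥0∞) + 1 + ((m : ℝ≥0∞) + 1) + k))) +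
    (∑' (n : ℕ) (m : ℕ) (k : ℕ),
        x (n + 1 + (k + 1)) * y (m + 1) *
          (((n : ℝ≥0∞) + 1) * ((m : ℝ≥0∞) + 1) /
            ((n : ℝ≥0∞) + 1 + ((m : ℝ≥0∞) + 1) + ((k : ℝ≥0∞) + 1)))) =
    (1 / 2) * ∑' (n : ℕ) (m : ℕ),
        x (n + 1) * y (m + 1) * (((n : ℝ≥0∞) + 1) * ((m : ℝ≥0∞) + 1)) := by
  simp only [tsum_tsum_hankel_left]
  rw [ENNReal.tsum_comm (f := fun n m => ∑' k : ℕ, x (n + 1 + (k + 1)) * y (m + 1) *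
    (((n : ℝ≥0∞) + 1) * ((m : ℝ≥0∞) + 1) /
      ((n : ℝ≥0∞) + 1 + ((m : ℝ≥0∞) + 1) + ((k : ℝ≥0∞) + 1))))]
  simp only [tsum_tsum_hankel_right]
  rw [ENNReal.tsum_comm (f := fun M N => x (N + 1) * y (M + 1) *
    ((∑ a ∈ Finset.range N, ((a : ℝ≥0∞) + 1)) * ((M : ℝ≥0∞) + 1) / ((N : ℝ≥0∞) + M + 2)))]
  simp only [← ENNReal.tsum_add, ← ENNReal.tsum_mul_left, ← mul_add, hankel_coefficient_identity]
  refine tsum_congr fun N => tsum_congr fun M => ?_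
  ring
end

section
/- Let Ω ⊂ ℂ be a nonempty bounded simply connected open set and let ψ : ℂ → ℝ be a smooth real-valued function with compact support contained in Ω and with ∫_Ω |∇ψ|² dxdy > 0. Then the infimum, over all holomorphic functions g on Ω with ∫_Ω |g|² dxdy < ∞, of ∫_Ω |conj(z) − g(z)|² dxdy is at least 4·(∫_Ω ψ dxdy)² / ∫_Ω |∇ψ(z)|² dxdy. (This is the Bell–Ferguson–Lundberg lower bound: ‖H_{conj z}1‖²_{A²(Ω)} is at least the torsional-rigidity quotient of Ω.) -/
open MeasureTheory Complex

/-- A continuous function on an open set, multiplied by a continuous compactly supported scalar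
function whose support lies in that set, is integrable on the whole space. -/
theorem integrable_smul_of_tsupport_subset {Ω : Set ℂ} (hΩ : IsOpen Ω) {u : ℂ → ℝ}
    (hu : Continuous u) (huc : HasCompactSupport u) (hsupp : tsupport u ⊆ Ω) {F : ℂ → ℂ}
    (hF : ContinuousOn F Ω) : Integrable (fun z => u z • F z) := by
  have hsub : tsupport (fun z => u z • F z) ⊆ tsupport u :=
    closure_mono (Function.support_smul_subset_left u F)
  have hcont : Continuous (fun z => u z • F z) :=
    (hu.continuousOn.smul hF).continuous_of_tsupport_subset hΩ (hsub.trans hsupp)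
  exact hcont.integrable_of_hasCompactSupport (huc.smul_right (f' := F))

/-- Integration by parts against the conjugate Wirtinger derivative: if `g` is holomorphic on `Ω`
then `∫ (∂_x ψ + i ∂_y ψ) (conj z - g) = -2 ∫ ψ`. -/
theorem integral_wirtinger_smul_conj_sub {Ω : Set ℂ} (hΩ : IsOpen Ω) {ψ : ℂ → ℝ}
    (hψ : ContDiff ℝ 1 ψ) (hψc : HasCompactSupport ψ) (hsupp : tsupport ψ ⊆ Ω) {g : ℂ → ℂ}
    (hg : DifferentiableOn ℂ g Ω) :
    ∫ z, (fderiv ℝ ψ z 1 • ((starRingEnd ℂ) z - g z) +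
      I * (fderiv ℝ ψ z I • ((starRingEnd ℂ) z - g z))) = -2 * ((∫ z, ψ z : ℝ) : ℂ) := by
  set F : ℂ → ℂ := fun z => (starRingEnd ℂ) z - g z
  have hF : ContDiffOn ℝ 1 F Ω :=
    conjCLE.contDiff.contDiffOn.sub ((hg.contDiffOn hΩ).restrict_scalars ℝ)
  have hdiff : ∀ z ∈ Ω, DifferentiableAt ℝ F z := fun z hz =>
    (hF.differentiableOn one_ne_zero).differentiableAt (hΩ.mem_nhds hz)
  have hint (v : ℂ) : Integrable (fun z => fderiv ℝ ψ z v • F z) :=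
    integrable_smul_of_tsupport_subset hΩ ((hψ.continuous_fderiv one_ne_zero).clm_apply
      continuous_const) (hψc.fderiv_apply ℝ v) ((tsupport_fderiv_apply_subset ℝ v).trans hsupp)
      hF.continuousOn
  have hint' (v : ℂ) : Integrable (fun z => ψ z • fderiv ℝ F z v) :=
    integrable_smul_of_tsupport_subset hΩ hψ.continuous hψc hsupp
      ((hF.continuousOn_fderiv_of_isOpen hΩ le_rfl).clm_apply continuousOn_const)
  have hparts (v : ℂ) : ∫ z, ψ z • fderiv ℝ F z v = -∫ z, fderiv ℝ ψ z v • F z :=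
    integral_smul_fderiv_eq_neg_fderiv_smul_of_integrable (hint v) (hint' v)
      (integrable_smul_of_tsupport_subset hΩ hψ.continuous hψc hsupp hF.continuousOn)
      (fun z _ => (hψ.differentiable one_ne_zero) z) (fun z hz => hdiff z (hsupp hz))
  have hpt (z : ℂ) : ψ z • fderiv ℝ F z 1 + I * (ψ z • fderiv ℝ F z I) = 2 * (ψ z : ℂ) := by
    by_cases hz : z ∈ tsupport ψ
    · have hgz := (hg.differentiableAt (hΩ.mem_nhds (hsupp hz))).hasDerivAt
      have hFz : HasFDerivAt F _ z :=
        conjCLE.hasFDerivAt.sub (hgz.hasFDerivAt.restrictScalars ℝ)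
      rw [hFz.fderiv]
      simp
      ring_nf
      simp
      ring
    · simp [image_eq_zero_of_notMem_tsupport hz]
  calc ∫ z, (fderiv ℝ ψ z 1 • F z + I * (fderiv ℝ ψ z I • F z))
      = -∫ z, (ψ z • fderiv ℝ F z 1 + I * (ψ z • fderiv ℝ F z I)) := by
        rw [integral_add (hint 1) ((hint I).const_mul I),
          integral_add (hint' 1) ((hint' I).const_mul I), integral_const_mul, integral_const_mul,
          hparts 1, hparts I]
        ring
    _ = -2 * ((∫ z, ψ z : ℝ) : ℂ) := by
        simp_rw [hpt]
        rw [integral_const_mul, integral_complex_ofReal]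
        ring

/-- On a bounded open set, `conj z - g` is square integrable if `g` is continuous and square
integrable. -/
theorem integrableOn_norm_sq_conj_sub {Ω : Set ℂ} (hΩ : IsOpen Ω) (hΩb : Bornology.IsBounded Ω)
    {g : ℂ → ℂ} (hg : ContinuousOn g Ω) (hg2 : IntegrableOn (fun z => ‖g z‖ ^ 2) Ω) :
    IntegrableOn (fun z => ‖(starRingEnd ℂ) z - g z‖ ^ 2) Ω := by
  have hz : IntegrableOn (fun z : ℂ => ‖z‖ ^ 2) Ω :=
    ((continuous_norm.pow 2).continuousOn.integrableOn_compact hΩb.isCompact_closure).mono_set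
      subset_closure
  refine Integrable.mono' ((hz.add hg2).const_mul 2)
    (((continuous_conj.continuousOn.sub hg).norm.pow 2).aestronglyMeasurable hΩ.measurableSet)
    (Filter.Eventually.of_forall fun z => ?_)
  have h := norm_sub_le ((starRingEnd ℂ) z) (g z)
  rw [RCLike.norm_conj] at h
  rw [Real.norm_of_nonneg (by positivity)]
  simp only [Pi.add_apply]
  nlinarith [norm_nonneg ((starRingEnd ℂ) z - g z), sq_nonneg (‖z‖ - ‖g z‖)]

/-- The torsional-rigidity quotient bounds the `L²`-distance from `conj z` to each single
square integrable holomorphic function. -/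
theorem four_mul_sq_integral_div_le {Ω : Set ℂ} (hΩo : IsOpen Ω) (hΩb : Bornology.IsBounded Ω)
    {ψ : ℂ → ℝ} (hψ1 : ContDiff ℝ 1 ψ) (hψc : HasCompactSupport ψ) (hsupp : tsupport ψ ⊆ Ω)
    (hgrad : 0 < ∫ z in Ω, ((fderiv ℝ ψ z 1) ^ 2 + (fderiv ℝ ψ z I) ^ 2))
    {g : ℂ → ℂ} (hg : DifferentiableOn ℂ g Ω) (hg2 : IntegrableOn (fun z => ‖g z‖ ^ 2) Ω) :
    4 * (∫ z in Ω, ψ z) ^ 2 / ∫ z in Ω, ((fderiv ℝ ψ z 1) ^ 2 + (fderiv ℝ ψ z I) ^ 2) ≤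
      ∫ z in Ω, ‖(starRingEnd ℂ) z - g z‖ ^ 2 := by
  set B := ∫ z in Ω, ((fderiv ℝ ψ z 1) ^ 2 + (fderiv ℝ ψ z I) ^ 2) with hB
  set s := ∫ z in Ω, ψ z
  set F : ℂ → ℂ := fun z => (starRingEnd ℂ) z - g z
  have hF : ContinuousOn F Ω := continuous_conj.continuousOn.sub hg.continuousOn
  have hzero (v z : ℂ) (hz : z ∉ Ω) : fderiv ℝ ψ z v = 0 :=
    image_eq_zero_of_notMem_tsupport (f := (fderiv ℝ ψ · v))
      fun h => hz (hsupp (tsupport_fderiv_apply_subset ℝ v h))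
  have hcont (v : ℂ) : Continuous (fderiv ℝ ψ · v) :=
    (hψ1.continuous_fderiv one_ne_zero).clm_apply continuous_const
  have hint (v : ℂ) : Integrable (fun z => fderiv ℝ ψ z v • F z) :=
    integrable_smul_of_tsupport_subset hΩo (hcont v) (hψc.fderiv_apply ℝ v)
      ((tsupport_fderiv_apply_subset ℝ v).trans hsupp) hF
  have hsq (v : ℂ) : Integrable (fun z => (fderiv ℝ ψ z v) ^ 2) :=
    Continuous.integrable_of_hasCompactSupport ((hcont v).pow 2)
      ((hψc.fderiv_apply ℝ v).mono fun z hz => by simpa using hz)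
  have hGF : Integrable (fun z => fderiv ℝ ψ z 1 • F z + I * (fderiv ℝ ψ z I • F z)) :=
    (hint 1).add ((hint I).const_mul I)
  have hpair : ∫ z in Ω, (fderiv ℝ ψ z 1 • F z + I * (fderiv ℝ ψ z I • F z)).re = -2 * s := by
    have hψΩ : s = ∫ z, ψ z := setIntegral_eq_integral_of_forall_compl_eq_zero fun z hz =>
      image_eq_zero_of_notMem_tsupport fun h => hz (hsupp h)
    have h := congrArg re (integral_wirtinger_smul_conj_sub hΩo hψ1 hψc hsupp hg)
    rw [setIntegral_eq_integral_of_forall_compl_eq_zero (fun z hz => by simp [hzero _ z hz]), hψΩ]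
    refine (integral_re hGF).trans (h.trans ?_)
    simp
  set t := 2 * s / B with ht
  have hF2 : IntegrableOn (fun z => ‖F z‖ ^ 2) Ω :=
    integrableOn_norm_sq_conj_sub hΩo hΩb hg.continuousOn hg2
  have hlin := (hGF.re.integrableOn (s := Ω)).const_mul (-2 * t)
  have hquad := (((hsq 1).add (hsq I)).integrableOn (s := Ω)).const_mul (t ^ 2)
  calc 4 * s ^ 2 / B = -2 * t * (-2 * s) - t ^ 2 * B := by
        rw [ht]
        field_simp
        ring
    _ = ∫ z in Ω, (-2 * t * (fderiv ℝ ψ z 1 • F z + I * (fderiv ℝ ψ z I • F z)).re -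
          t ^ 2 * ((fderiv ℝ ψ z 1) ^ 2 + (fderiv ℝ ψ z I) ^ 2)) := by
        rw [← hpair, hB, ← integral_const_mul, ← integral_const_mul]
        exact (integral_sub hlin hquad).symm
    _ ≤ ∫ z in Ω, ‖F z‖ ^ 2 := by
        refine integral_mono (hlin.sub hquad) hF2 fun z => ?_
        rw [← normSq_eq_norm_sq, normSq_apply]
        simp only [real_smul, add_re, mul_re, mul_im, ofReal_re, ofReal_im, I_re, I_im]
        nlinarith [sq_nonneg ((F z).re + t * fderiv ℝ ψ z 1),
          sq_nonneg ((F z).im - t * fderiv ℝ ψ z I)]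

/-- The Bell–Ferguson–Lundberg lower bound: for a bounded simply connected domain `Ω`
and any smooth real `ψ` with compact support in `Ω` (and nonzero Dirichlet energy),
the squared `L²`-distance from `conj(z)` to the Bergman space `A²(Ω)` is at least
`4 (∫_Ω ψ)² / ∫_Ω |∇ψ|²`.  Here `|∇ψ(z)|² = (∂_x ψ)² + (∂_y ψ)²` is expressed via
`fderiv ℝ ψ z 1` and `fderiv ℝ ψ z I`. -/
theorem bell_ferguson_lundberg_lower_bound
    (Ω : Set ℂ) (hΩo : IsOpen Ω) (hΩne : Ω.Nonempty) (hΩb : Bornology.IsBounded Ω)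
    (hΩsc : SimplyConnectedSpace Ω)
    (ψ : ℂ → ℝ) (hψ : ContDiff ℝ (⊤ : ℕ∞) ψ) (hψc : HasCompactSupport ψ)
    (hsupp : tsupport ψ ⊆ Ω)
    (hgrad : 0 < ∫ z in Ω, ((fderiv ℝ ψ z 1) ^ 2 + (fderiv ℝ ψ z Complex.I) ^ 2)) :
    4 * (∫ z in Ω, ψ z) ^ 2 /
        ∫ z in Ω, ((fderiv ℝ ψ z 1) ^ 2 + (fderiv ℝ ψ z Complex.I) ^ 2) ≤
      ⨅ g : {g : ℂ → ℂ // DifferentiableOn ℂ g Ω ∧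
          IntegrableOn (fun z => ‖g z‖ ^ 2) Ω volume},
        ∫ z in Ω, ‖(starRingEnd ℂ) z - g.1 z‖ ^ 2 := by
  have : Nonempty {g : ℂ → ℂ // DifferentiableOn ℂ g Ω ∧
      IntegrableOn (fun z => ‖g z‖ ^ 2) Ω volume} :=
    ⟨⟨fun _ => 0, differentiableOn_const _, by simp⟩⟩
  refine le_ciInf fun g => ?_
  exact four_mul_sq_integral_div_le hΩo hΩb (hψ.of_le (by exact_mod_cast le_top)) hψc hsupp hgrad
    g.2.1 g.2.2
end

section
/- Let Ω ⊂ ℂ be a nonempty bounded simply connected open set. Then for every smooth real-valued function ψ : ℂ → ℝ with compact support contained in Ω, 4·(∫_Ω ψ dxdy)² ≤ (Area(Ω)²/(2π)) · ∫_Ω |∇ψ(z)|² dxdy, where Area(Ω) is the Lebesgue measure of Ω. (This is the de St. Venant inequality ρ(Ω) ≤ Area(Ω)²/(2π), where ρ(Ω) is the torsional rigidity of Ω.) -/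
open MeasureTheory Complex

theorem neg_mul_le_weighted_sq_add_sq {u v l : ℝ} (hl : 0 < l) :
    -(u * v) ≤ l / 2 * u ^ 2 + v ^ 2 / (2 * l) := by
  have : l / 2 * u ^ 2 + v ^ 2 / (2 * l) + u * v = (l * u + v) ^ 2 / (2 * l) := by
    field_simp; ring
  have : 0 ≤ (l * u + v) ^ 2 / (2 * l) := by positivity
  linarith

/-- Transport estimate on a line: a function `f` supported where the density `χ` equals `1`, tested
against the affine map pushing `χ` of mass `m` to the uniform law on an interval of length `c`. -/
theorem slice_integral_le {f f' χ : ℝ → ℝ} {N m c l : ℝ}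
    (hf : ∀ y, HasDerivAt f (f' y) y) (hf' : Continuous f') (hχ : Continuous χ)
    (hχ0 : ∀ y, 0 ≤ χ y) (hfχ : ∀ y, f y = 0 ∧ f' y = 0 ∨ χ y = 1)
    (hN : 0 ≤ N) (hfl : f (-N) = 0) (hfr : f N = 0)
    (hm : m = ∫ y in -N..N, χ y) (hm0 : 0 < m) (hl : 0 < l) :
    (∫ y in -N..N, f y) * (c / m) ≤
      l / 2 * (∫ y in -N..N, f' y ^ 2) + m * c ^ 2 / (24 * l) := by
  set B : ℝ → ℝ := fun y => ∫ t in -N..y, χ t with hB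
  have hBd : ∀ y, HasDerivAt B (χ y) y := fun y =>
    intervalIntegral.integral_hasDerivAt_right (hχ.intervalIntegrable _ _)
      hχ.aestronglyMeasurable.stronglyMeasurableAtFilter hχ.continuousAt
  have hBl : B (-N) = 0 := by simp [hB]
  have hBr : B N = m := by simp [hB, hm]
  have hfc : Continuous f := continuous_iff_continuousAt.2 fun y => (hf y).continuousAt
  have hBc : Continuous B := continuous_iff_continuousAt.2 fun y => (hBd y).continuousAt
  set b : ℝ → ℝ := fun y => c * (B y / m - 1 / 2) with hb
  have hbc : Continuous b := by fun_prop
  have hbd : ∀ y, HasDerivAt b (c * (χ y / m)) y := fun y =>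
    (((hBd y).div_const m).sub_const _).const_mul c
  have hparts := intervalIntegral.integral_mul_deriv_eq_deriv_mul (a := -N) (b := N)
    (u := f) (v := b) (u' := f') (v' := fun y => c * (χ y / m))
    (fun y _ => hf y) (fun y _ => hbd y) (hf'.intervalIntegrable _ _)
    ((by fun_prop : Continuous fun y => c * (χ y / m)).intervalIntegrable _ _)
  have h1 : ∫ y in -N..N, f y * (c * (χ y / m)) = (∫ y in -N..N, f y) * (c / m) := by
    rw [← intervalIntegral.integral_mul_const]
    congr 1; ext y
    rcases hfχ y with h | h
    · simp [h.1]
    · rw [h]; ring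
  have h2 : ∫ y in -N..N, χ y * b y ^ 2 = m * c ^ 2 / 12 := by
    have := intervalIntegral.integral_eq_sub_of_hasDerivAt (a := -N) (b := N)
      (f := fun y => m * c ^ 2 * (B y / m - 1 / 2) ^ 3 / 3) (f' := fun y => χ y * b y ^ 2)
      (fun y _ => by
        have := (((((hBd y).div_const m).sub_const (1 / 2)).pow 3).const_mul (m * c ^ 2)).div_const 3
        refine this.congr_deriv ?_
        simp only [hb]
        push_cast
        field_simp)
      ((by fun_prop : Continuous fun y => χ y * b y ^ 2).intervalIntegrable _ _)
    rw [this, hBl, hBr]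
    field_simp
    norm_num
    ring
  have h3 : ∫ y in -N..N, -(f' y * b y) ≤
      ∫ y in -N..N, (l / 2 * f' y ^ 2 + χ y * b y ^ 2 / (2 * l)) := by
    apply intervalIntegral.integral_mono_on (by linarith)
    · exact (by fun_prop : Continuous fun y => -(f' y * b y)).intervalIntegrable _ _
    · exact (by fun_prop : Continuous fun y =>
        l / 2 * f' y ^ 2 + χ y * b y ^ 2 / (2 * l)).intervalIntegrable _ _
    · intro y _
      rcases hfχ y with h | h
      · have := hχ0 y
        rw [h.2]; simp; positivity
      · rw [h, one_mul]; exact neg_mul_le_weighted_sq_add_sq hl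
  rw [intervalIntegral.integral_add
    ((by fun_prop : Continuous fun y => l / 2 * f' y ^ 2).intervalIntegrable _ _)
    ((by fun_prop : Continuous fun y => χ y * b y ^ 2 / (2 * l)).intervalIntegrable _ _),
    intervalIntegral.integral_const_mul, intervalIntegral.integral_div, h2,
    intervalIntegral.integral_neg] at h3
  rw [h1, hfl, hfr] at hparts
  rw [hparts]
  calc _ = _ := by ring
    _ ≤ _ := h3
    _ = _ := by field_simp; ring

theorem strictMono_sub_half_sin_two_mul : StrictMono fun t : ℝ => t - Real.sin (2 * t) / 2 := by
  intro u v huv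
  have h := Real.sin_sub_sin (2 * v) (2 * u)
  have e1 : (2 * v - 2 * u) / 2 = v - u := by ring
  rw [e1] at h
  have h1 : |Real.sin (v - u)| < |v - u| := Real.abs_sin_lt_abs (by linarith)
  have h2 := Real.abs_cos_le_one ((2 * v + 2 * u) / 2)
  rw [abs_of_pos (by linarith : 0 < v - u)] at h1
  have : Real.sin (v - u) * Real.cos ((2 * v + 2 * u) / 2) < v - u :=
    (le_abs_self _).trans_lt (by rw [abs_mul]; nlinarith [abs_nonneg (Real.sin (v-u))])
  simp only
  linarith

/-- An inverse of `t ↦ t - sin (2 t) / 2` on `(0, π)`, with its derivative. It turns the area of a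
disc segment into its half-angle. -/
theorem exists_inverse_sub_half_sin_two_mul : ∃ q : ℝ → ℝ, Continuous q ∧ ∀ s ∈ Set.Ioo 0 Real.pi,
    q s ∈ Set.Ioo 0 Real.pi ∧ HasDerivAt q (1 / (2 * Real.sin (q s) ^ 2)) s := by
  have hs := strictMono_sub_half_sin_two_mul
  set P : ℝ → ℝ := fun t => t - Real.sin (2 * t) / 2 with hP
  have hPc : Continuous P := by fun_prop
  have hsurj : Function.Surjective P := by
    apply hPc.surjective
    · apply Filter.tendsto_atTop_mono (f := fun t => t - 1 / 2)
      · intro t; have := Real.sin_le_one (2 * t); simp only [hP]; linarith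
      · exact Filter.tendsto_atTop_add_const_right _ _ Filter.tendsto_id
    · apply Filter.tendsto_atBot_mono (f := fun t => t + 1 / 2)
      · intro t; have := Real.neg_one_le_sin (2 * t); simp only [hP]; linarith
      · exact Filter.tendsto_atBot_add_const_right _ _ Filter.tendsto_id
  let e := hs.orderIsoOfSurjective P hsurj
  have hPe : ∀ s, P (e.symm s) = s := fun s => e.apply_symm_apply s
  have hP0 : P 0 = 0 := by simp [hP]
  have hPpi : P Real.pi = Real.pi := by simp [hP]
  refine ⟨e.symm, e.symm.continuous, fun s hs' => ?_⟩
  have hmem : e.symm s ∈ Set.Ioo 0 Real.pi := by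
    constructor
    · rw [← hs.lt_iff_lt, hPe, hP0]; exact hs'.1
    · rw [← hs.lt_iff_lt, hPe, hPpi]; exact hs'.2
  refine ⟨hmem, ?_⟩
  have hsin := Real.sin_pos_of_pos_of_lt_pi hmem.1 hmem.2
  have hd : HasDerivAt P (2 * Real.sin (e.symm s) ^ 2) (e.symm s) := by
    have h1 : HasDerivAt (fun t : ℝ => 2 * t) (2 * 1) (e.symm s) :=
      (hasDerivAt_id _).const_mul 2
    have := (hasDerivAt_id (e.symm s)).sub (h1.sin.div_const 2)
    refine this.congr_deriv ?_
    rw [Real.cos_two_mul, Real.cos_sq']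
    ring
  rw [one_div]
  exact HasDerivAt.of_local_left_inverse e.symm.continuous.continuousAt hd (by positivity)
    (Filter.Eventually.of_forall hPe)

/-- Slice-wise form of the mass-transport proof: `m` is the marginal of the density, transported to
the marginal of a disc of area `S` by the map `a`, and `c` is the length of the disc's chord. -/
theorem integral_le_of_slices {F F' G₁ G₂ m : ℝ → ℝ} {N S l : ℝ} (hN : 0 < N) (hl : 0 < l)
    (hF : ∀ x, HasDerivAt F (F' x) x) (hF' : Continuous F') (hG₁ : Continuous G₁)
    (hG₂ : Continuous G₂) (hm : Continuous m) (hF0 : ∀ x, 0 ≤ F x) (hG0 : ∀ x, 0 ≤ G₂ x)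
    (hm0 : ∀ x, 0 ≤ m x) (hFl : F (-N) = 0) (hFr : F N = 0)
    (h₁ : ∀ x a, -(F' x * a) ≤ l / 2 * G₁ x + m x * a ^ 2 / (2 * l))
    (h₂ : ∀ x c, 0 < m x → F x * (c / m x) ≤ l / 2 * G₂ x + m x * c ^ 2 / (24 * l))
    (h₃ : ∀ x, m x = 0 → F x = 0) (hS : ∫ x in -N..N, m x < S) :
    4 * ∫ x in -N..N, F x ≤
      l * (∫ x in -N..N, (G₁ x + G₂ x)) + S ^ 2 / (2 * Real.pi) / l := by
  have hpi := Real.pi_pos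
  have hNN : -N ≤ N := by linarith
  obtain ⟨q, hqc, hq⟩ := exists_inverse_sub_half_sin_two_mul
  set M : ℝ → ℝ := fun x => ∫ t in -N..x, m t with hM
  have hMd : ∀ x, HasDerivAt M (m x) x := fun x =>
    intervalIntegral.integral_hasDerivAt_right (hm.intervalIntegrable _ _)
      hm.aestronglyMeasurable.stronglyMeasurableAtFilter hm.continuousAt
  have hMc : Continuous M := continuous_iff_continuousAt.2 fun y => (hMd y).continuousAt
  have hFc : Continuous F := continuous_iff_continuousAt.2 fun y => (hF y).continuousAt
  have hMmono : Monotone M := monotone_of_hasDerivAt_nonneg hMd hm0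
  have hMl : M (-N) = 0 := by simp [hM]
  have hA0 : 0 ≤ M N := hMl ▸ hMmono hNN
  change M N < S at hS
  have hS0 : 0 < S := hA0.trans_lt hS
  set ε := (S - M N) / 2 with hε
  have hε0 : 0 < ε := by rw [hε]; linarith
  set θ : ℝ → ℝ := fun x => q (Real.pi / S * (M x + ε)) with hθ
  have hθc : Continuous θ := by fun_prop
  have hs : ∀ x ∈ Set.uIcc (-N) N, Real.pi / S * (M x + ε) ∈ Set.Ioo 0 Real.pi := by
    intro x hx
    rw [Set.uIcc_of_le hNN] at hx
    have h0 : 0 ≤ M x := hMl ▸ hMmono hx.1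
    have h1 : M x ≤ M N := hMmono hx.2
    refine ⟨by positivity, ?_⟩
    rw [div_mul_eq_mul_div, div_lt_iff₀ hS0]
    exact mul_lt_mul_of_pos_left (by rw [hε]; linarith) hpi
  have hθm : ∀ x ∈ Set.uIcc (-N) N, θ x ∈ Set.Ioo 0 Real.pi := fun x hx => (hq _ (hs x hx)).1
  have hsin : ∀ x ∈ Set.uIcc (-N) N, 0 < Real.sin (θ x) := fun x hx =>
    Real.sin_pos_of_pos_of_lt_pi (hθm x hx).1 (hθm x hx).2
  have hθd : ∀ x ∈ Set.uIcc (-N) N,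
      HasDerivAt θ (Real.pi / S * m x / (2 * Real.sin (θ x) ^ 2)) x := by
    intro x hx
    have := (hq _ (hs x hx)).2.comp x (((hMd x).add_const ε).const_mul (Real.pi / S))
    refine this.congr_deriv ?_
    simp only [hθ]
    ring
  set R := √(S / Real.pi) with hR
  have hR0 : 0 < R := Real.sqrt_pos.2 (by positivity)
  have hR2 : S = Real.pi * R ^ 2 := by rw [hR, Real.sq_sqrt (by positivity)]; field_simp
  set a : ℝ → ℝ := fun x => -(R * Real.cos (θ x)) with ha
  set c : ℝ → ℝ := fun x => 2 * R * Real.sin (θ x) with hc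
  have hac : Continuous a := by fun_prop
  have hcc : Continuous c := by fun_prop
  have hc0 : ∀ x ∈ Set.uIcc (-N) N, 0 < c x := fun x hx => by
    have := hsin x hx
    simp only [hc]; positivity
  have had : ∀ x ∈ Set.uIcc (-N) N, HasDerivAt a (m x / c x) x := by
    intro x hx
    have := hsin x hx
    refine (((hθd x hx).cos.const_mul R).neg).congr_deriv ?_
    simp only [hc]
    rw [hR2]
    field_simp
  have hmc : ContinuousOn (fun x => m x / c x) (Set.uIcc (-N) N) :=
    hm.continuousOn.div hcc.continuousOn fun x hx => (hc0 x hx).ne'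
  have hparts := intervalIntegral.integral_mul_deriv_eq_deriv_mul (fun x _ => hF x) had
    (hF'.intervalIntegrable _ _) hmc.intervalIntegrable
  rw [hFl, hFr] at hparts
  have hx : ∫ x in -N..N, F x * (m x / c x) ≤
      ∫ x in -N..N, (l / 2 * G₁ x + m x * a x ^ 2 / (2 * l)) := by
    rw [hparts, zero_mul, zero_mul, sub_zero, zero_sub, ← intervalIntegral.integral_neg]
    refine intervalIntegral.integral_mono_on hNN ?_ ?_ fun x _ => h₁ x (a x)
    · exact (by fun_prop : Continuous fun x => -(F' x * a x)).intervalIntegrable _ _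
    · exact (by fun_prop : Continuous fun x =>
        l / 2 * G₁ x + m x * a x ^ 2 / (2 * l)).intervalIntegrable _ _
  have hFm : IntervalIntegrable (fun x => F x * (m x / c x)) volume (-N) N :=
    (hFc.continuousOn.mul hmc).intervalIntegrable
  have hy : ∫ x in -N..N, 2 * F x ≤
      ∫ x in -N..N, (F x * (m x / c x) + (l / 2 * G₂ x + m x * c x ^ 2 / (24 * l))) := by
    refine intervalIntegral.integral_mono_on hNN ?_ ?_ ?_
    · exact (by fun_prop : Continuous fun x => 2 * F x).intervalIntegrable _ _
    · exact hFm.add ((by fun_prop : Continuous fun x =>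
        l / 2 * G₂ x + m x * c x ^ 2 / (24 * l)).intervalIntegrable _ _)
    · intro x hx
      rw [← Set.uIcc_of_le hNN] at hx
      have hcx := hc0 x hx
      rcases (hm0 x).eq_or_lt with h | h
      · rw [h₃ x h.symm, ← h]
        have := hG0 x
        simp only [mul_zero, zero_mul, zero_div, zero_add, add_zero]
        positivity
      · have h2 := h₂ x (c x) h
        have h4 : 2 ≤ m x / c x + c x / m x := by
          rw [div_add_div _ _ hcx.ne' h.ne', le_div_iff₀ (by positivity)]
          nlinarith [sq_nonneg (m x - c x)]
        nlinarith [mul_le_mul_of_nonneg_left h4 (hF0 x)]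
  have hmom : ∫ x in -N..N, m x * (a x ^ 2 + c x ^ 2 / 12) ≤ S ^ 2 / (2 * Real.pi) := by
    set h : ℝ → ℝ := fun t => t / 2 - Real.sin (2 * t) / 6 - Real.sin (4 * t) / 24 with hh
    have hhd : ∀ t, HasDerivAt h (2 * Real.sin t ^ 2 * (Real.cos t ^ 2 + Real.sin t ^ 2 / 3)) t := by
      intro t
      have e2 : HasDerivAt (fun t : ℝ => 2 * t) (2 * 1) t := (hasDerivAt_id _).const_mul 2
      have e4 : HasDerivAt (fun t : ℝ => 4 * t) (4 * 1) t := (hasDerivAt_id _).const_mul 4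
      have := (((hasDerivAt_id t).div_const 2).sub (e2.sin.div_const 6)).sub (e4.sin.div_const 24)
      refine this.congr_deriv ?_
      rw [show 4 * t = 2 * (2 * t) by ring, Real.cos_two_mul (2 * t), Real.cos_two_mul t,
        Real.sin_sq]
      ring
    have hhm : Monotone h := monotone_of_hasDerivAt_nonneg hhd fun t => by
      simp only [Pi.zero_apply]; positivity
    have := intervalIntegral.integral_eq_sub_of_hasDerivAt (a := -N) (b := N)
      (f := fun x => R ^ 4 * h (θ x)) (f' := fun x => m x * (a x ^ 2 + c x ^ 2 / 12))
      (fun x hx => by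
        have hsx := hsin x hx
        refine (((hhd (θ x)).comp x (hθd x hx)).const_mul (R ^ 4)).congr_deriv ?_
        simp only [ha, hc]
        rw [hR2]
        field_simp
        ring)
      ((by fun_prop : Continuous fun x => m x * (a x ^ 2 + c x ^ 2 / 12)).intervalIntegrable _ _)
    rw [this]
    have h1 : h (θ N) ≤ h Real.pi := hhm (hθm N Set.right_mem_uIcc).2.le
    have h0 : h 0 ≤ h (θ (-N)) := hhm (hθm (-N) Set.left_mem_uIcc).1.le
    have e0 : h 0 = 0 := by simp [hh]
    have e1 : h Real.pi = Real.pi / 2 := by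
      have : Real.sin (4 * Real.pi) = 0 := by simpa using Real.sin_nat_mul_pi 4
      simp [hh, this]
    have : S ^ 2 / (2 * Real.pi) = R ^ 4 * (Real.pi / 2) := by rw [hR2]; field_simp
    rw [this, ← mul_sub]
    exact mul_le_mul_of_nonneg_left (by linarith) (by positivity)
  have i1 := hG₁.intervalIntegrable (μ := volume) (-N) N
  have i2 := hG₂.intervalIntegrable (μ := volume) (-N) N
  have i3 := (by fun_prop : Continuous fun x => m x * a x ^ 2).intervalIntegrable (μ := volume) (-N) N
  have i4 := (by fun_prop : Continuous fun x => m x * c x ^ 2).intervalIntegrable (μ := volume) (-N) N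
  rw [intervalIntegral.integral_add hFm ((i2.const_mul _).add (i4.div_const _)),
    intervalIntegral.integral_add (i2.const_mul _) (i4.div_const _),
    intervalIntegral.integral_const_mul, intervalIntegral.integral_const_mul,
    intervalIntegral.integral_div] at hy
  rw [intervalIntegral.integral_add (i1.const_mul _) (i3.div_const _),
    intervalIntegral.integral_const_mul, intervalIntegral.integral_div] at hx
  simp only [mul_add, ← mul_div_assoc] at hmom
  rw [intervalIntegral.integral_add i3 (i4.div_const _), intervalIntegral.integral_div] at hmom
  rw [intervalIntegral.integral_add i1 i2]
  have := div_le_div_of_nonneg_right hmom hl.le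
  have e : ∀ u v : ℝ, (u + v / 12) / l = 2 * (u / (2 * l) + v / (24 * l)) := by
    intro u v; field_simp; ring
  rw [e] at this
  linarith

theorem hasDerivAt_intervalIntegral_of_continuous {f f' : ℝ → ℝ → ℝ} {a b : ℝ}
    (hf : Continuous fun p : ℝ × ℝ => f p.1 p.2) (hf' : Continuous fun p : ℝ × ℝ => f' p.1 p.2)
    (hd : ∀ x y, HasDerivAt (fun t => f t y) (f' x y) x) (x : ℝ) :
    HasDerivAt (fun x => ∫ y in a..b, f x y) (∫ y in a..b, f' x y) x := by
  obtain ⟨C, hC⟩ := ((isCompact_closedBall x 1).prod (isCompact_uIcc (a := a) (b := b))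
    ).exists_bound_of_continuousOn hf'.continuousOn
  refine (intervalIntegral.hasDerivAt_integral_of_dominated_loc_of_deriv_le (bound := fun _ => C)
    (F := f) (F' := f') (Metric.closedBall_mem_nhds x one_pos) ?_ ?_ ?_ ?_ ?_ ?_).2
  · exact Filter.Eventually.of_forall fun x =>
      (by fun_prop : Continuous fun y => f x y).aestronglyMeasurable
  · exact (by fun_prop : Continuous fun y => f x y).intervalIntegrable _ _
  · exact (by fun_prop : Continuous fun y => f' x y).aestronglyMeasurable
  · exact Filter.Eventually.of_forall fun t ht z hz => hC (z, t) ⟨hz, Set.uIoc_subset_uIcc ht⟩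
  · exact intervalIntegrable_const
  · exact Filter.Eventually.of_forall fun t _ z _ => hd z t

/-- The de St. Venant inequality for a nonnegative function on a square, supported where a
density `χ` of total mass less than `S` equals `1`. -/
theorem sq_integral_le_of_nonneg {f fx fy χ : ℝ → ℝ → ℝ} {N S : ℝ} (hN : 0 < N)
    (hfx : ∀ x y, HasDerivAt (fun t => f t y) (fx x y) x)
    (hfy : ∀ x y, HasDerivAt (fun t => f x t) (fy x y) y)
    (cf : Continuous fun p : ℝ × ℝ => f p.1 p.2) (cfx : Continuous fun p : ℝ × ℝ => fx p.1 p.2)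
    (cfy : Continuous fun p : ℝ × ℝ => fy p.1 p.2) (cχ : Continuous fun p : ℝ × ℝ => χ p.1 p.2)
    (hf0 : ∀ x y, 0 ≤ f x y) (hχ0 : ∀ x y, 0 ≤ χ x y)
    (hfχ : ∀ x y, f x y = 0 ∧ fx x y = 0 ∧ fy x y = 0 ∨ χ x y = 1)
    (hl : ∀ y, f (-N) y = 0) (hr : ∀ y, f N y = 0) (hb : ∀ x, f x (-N) = 0) (ht : ∀ x, f x N = 0)
    (hS : ∫ x in -N..N, ∫ y in -N..N, χ x y < S) :
    4 * (∫ x in -N..N, ∫ y in -N..N, f x y) ^ 2 ≤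
      S ^ 2 / (2 * Real.pi) * ∫ x in -N..N, ∫ y in -N..N, (fx x y ^ 2 + fy x y ^ 2) := by
  have hNN : -N ≤ N := by linarith
  have hI : 0 ≤ ∫ x in -N..N, ∫ y in -N..N, f x y :=
    intervalIntegral.integral_nonneg hNN fun x _ =>
      intervalIntegral.integral_nonneg hNN fun y _ => hf0 x y
  have hD : 0 ≤ ∫ x in -N..N, ∫ y in -N..N, (fx x y ^ 2 + fy x y ^ 2) :=
    intervalIntegral.integral_nonneg hNN fun x _ =>
      intervalIntegral.integral_nonneg hNN fun y _ => by positivity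
  have key : ∀ l : ℝ, 0 < l → 4 * (∫ x in -N..N, ∫ y in -N..N, f x y) ≤
      l * (∫ x in -N..N, ∫ y in -N..N, (fx x y ^ 2 + fy x y ^ 2)) +
        S ^ 2 / (2 * Real.pi) / l := by
    intro l hl0
    have hsplit : ∀ x, ∫ y in -N..N, (fx x y ^ 2 + fy x y ^ 2) =
        (∫ y in -N..N, fx x y ^ 2) + ∫ y in -N..N, fy x y ^ 2 := fun x =>
      intervalIntegral.integral_add
        ((by fun_prop : Continuous fun y => fx x y ^ 2).intervalIntegrable _ _)
        ((by fun_prop : Continuous fun y => fy x y ^ 2).intervalIntegrable _ _)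
    simp only [hsplit]
    have hm : ∀ x, (∀ y ∈ Set.Icc (-N) N, f x y = 0) ∨ 0 < ∫ y in -N..N, χ x y := by
      intro x
      by_contra! h
      obtain ⟨⟨y, hy, hfy⟩, h2⟩ := h
      refine h2.not_gt (intervalIntegral.integral_pos (by linarith)
        (by fun_prop : Continuous fun y => χ x y).continuousOn (fun y _ => hχ0 x y) ⟨y, hy, ?_⟩)
      rcases hfχ x y with h | h
      · exact absurd h.1 hfy
      · rw [h]; exact one_pos
    refine integral_le_of_slices (F := fun x => ∫ y in -N..N, f x y)
      (F' := fun x => ∫ y in -N..N, fx x y) (m := fun x => ∫ y in -N..N, χ x y) hN hl0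
      (fun x => hasDerivAt_intervalIntegral_of_continuous cf cfx hfx x) ?_ ?_ ?_ ?_
      (fun x => intervalIntegral.integral_nonneg hNN fun y _ => hf0 x y)
      (fun x => intervalIntegral.integral_nonneg hNN fun y _ => sq_nonneg _)
      (fun x => intervalIntegral.integral_nonneg hNN fun y _ => hχ0 x y)
      (by simp [hl]) (by simp [hr]) ?_ ?_ ?_ hS
    · exact intervalIntegral.continuous_parametric_intervalIntegral_of_continuous' cfx _ _
    · exact intervalIntegral.continuous_parametric_intervalIntegral_of_continuous' (cfx.pow 2) _ _
    · exact intervalIntegral.continuous_parametric_intervalIntegral_of_continuous' (cfy.pow 2) _ _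
    · exact intervalIntegral.continuous_parametric_intervalIntegral_of_continuous' cχ _ _
    · intro x a
      have i1 := (by fun_prop : Continuous fun y => fx x y ^ 2).intervalIntegrable
        (μ := volume) (-N) N
      have i2 := (by fun_prop : Continuous fun y => χ x y).intervalIntegrable (μ := volume) (-N) N
      have i3 := (by fun_prop : Continuous fun y => -(fx x y * a)).intervalIntegrable
        (μ := volume) (-N) N
      rw [← intervalIntegral.integral_const_mul, ← intervalIntegral.integral_mul_const,
        ← intervalIntegral.integral_mul_const, ← intervalIntegral.integral_neg,
        ← intervalIntegral.integral_div,
        ← intervalIntegral.integral_add (i1.const_mul _) ((i2.mul_const _).div_const _)]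
      refine intervalIntegral.integral_mono_on hNN i3
        ((i1.const_mul _).add ((i2.mul_const _).div_const _)) fun y _ => ?_
      rcases hfχ x y with h | h
      · have := hχ0 x y
        rw [h.2.1]; simp; positivity
      · rw [h, one_mul]; exact neg_mul_le_weighted_sq_add_sq hl0
    · intro x c hmx
      exact slice_integral_le (hfy x) (by fun_prop) (by fun_prop) (hχ0 x)
        (fun y => (hfχ x y).imp_left fun h => ⟨h.1, h.2.2⟩) hN.le (hb x) (ht x) rfl hmx hl0
    · intro x hmx
      rcases hm x with h | h
      · rw [intervalIntegral.integral_congr (g := fun _ => (0 : ℝ))]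
        · simp
        · intro y hy
          rw [Set.uIcc_of_le hNN] at hy
          exact h y hy
      · exact absurd hmx h.ne'
  have hC : 0 ≤ S ^ 2 / (2 * Real.pi) := by positivity
  generalize (∫ x in -N..N, ∫ y in -N..N, f x y) = I at *
  generalize (∫ x in -N..N, ∫ y in -N..N, (fx x y ^ 2 + fy x y ^ 2)) = D at *
  generalize S ^ 2 / (2 * Real.pi) = C at *
  have := discrim_le_zero (a := D) (b := -4 * I) (c := C) fun t => by
    rcases lt_or_ge 0 t with h | h
    · have := mul_le_mul_of_nonneg_right (key t h) h.le
      rw [add_mul, div_mul_cancel₀ _ h.ne'] at this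
      linarith
    · nlinarith [mul_nonneg hD (mul_self_nonneg t), mul_nonneg hI (neg_nonneg.2 h)]
  rw [discrim] at this
  linarith

theorem setIntegral_complex_eq {g : ℂ → ℝ} {Ω : Set ℂ} {N : ℝ} (hN : 0 ≤ N) (hg : Continuous g)
    (hgΩ : ∀ z, z ∉ Ω → g z = 0) (hΩN : Ω ⊆ Metric.ball 0 N) :
    ∫ z in Ω, g z = ∫ x in -N..N, ∫ y in -N..N, g (x + y * I) := by
  have hNN : -N ≤ N := by linarith
  have hout : ∀ x y : ℝ, ¬ (x ∈ Set.Ioc (-N) N ∧ y ∈ Set.Ioc (-N) N) → g (x + y * I) = 0 := by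
    intro x y h
    refine hgΩ _ fun hz => h ?_
    have hz := hΩN hz
    rw [mem_ball_zero_iff] at hz
    have h1 := (abs_re_le_norm _).trans_lt hz
    have h2 := (abs_im_le_norm _).trans_lt hz
    simp at h1 h2
    rw [abs_lt] at h1 h2
    exact ⟨⟨h1.1, h1.2.le⟩, ⟨h2.1, h2.2.le⟩⟩
  have hcs : HasCompactSupport g := HasCompactSupport.intro (isCompact_closedBall (0 : ℂ) N)
    fun z hz => hgΩ z fun h => hz (Metric.ball_subset_closedBall (hΩN h))
  have hint : Integrable (fun p : ℝ × ℝ => g (p.1 + p.2 * I)) (volume.prod volume) := by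
    have := (volume_preserving_equiv_real_prod.symm).integrable_comp_of_integrable
      (hg.integrable_of_hasCompactSupport hcs)
    refine this.congr (Filter.Eventually.of_forall fun p => ?_)
    simp [← mk_eq_add_mul_I]
  rw [setIntegral_eq_integral_of_forall_compl_eq_zero hgΩ,
    ← (volume_preserving_equiv_real_prod.symm).integral_comp
      measurableEquivRealProd.symm.measurableEmbedding]
  simp only [measurableEquivRealProd_symm_apply, mk_eq_add_mul_I]
  rw [Measure.volume_eq_prod, integral_prod _ hint, intervalIntegral.integral_of_le hNN,
    setIntegral_eq_integral_of_forall_compl_eq_zero]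
  · refine integral_congr_ae (Filter.Eventually.of_forall fun x => ?_)
    simp only
    rw [intervalIntegral.integral_of_le hNN, setIntegral_eq_integral_of_forall_compl_eq_zero]
    exact fun y hy => hout x y fun h => hy h.2
  · intro x hx
    simp [fun y : ℝ => hout x y fun h => hx h.1]

theorem sqrt_sq_add_sq_sub_bounds {δ : ℝ} (hδ : 0 < δ) (u : ℝ) :
    0 ≤ √(u ^ 2 + δ ^ 2) - δ ∧ |u| ≤ √(u ^ 2 + δ ^ 2) - δ + δ ∧
      (u / √(u ^ 2 + δ ^ 2)) ^ 2 ≤ 1 := by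
  refine ⟨?_, ?_, ?_⟩
  · have : δ ≤ √(u ^ 2 + δ ^ 2) := Real.le_sqrt_of_sq_le (by nlinarith)
    linarith
  · rw [sub_add_cancel]
    exact Real.abs_le_sqrt (by nlinarith)
  · rw [div_pow, Real.sq_sqrt (by positivity)]
    exact div_le_one_of_le₀ (by nlinarith) (by positivity)

theorem two_mul_abs_integral_le {Ω : Set ℂ} (hΩo : IsOpen Ω) (hΩb : Bornology.IsBounded Ω)
    {ψ : ℂ → ℝ} (hψ : ContDiff ℝ 1 ψ) (hψc : HasCompactSupport ψ) (hψΩ : tsupport ψ ⊆ Ω)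
    {S δ : ℝ} (hS : (volume Ω).toReal < S) (hδ : 0 < δ) :
    2 * |∫ z in Ω, ψ z| ≤
      √(S ^ 2 / (2 * Real.pi) * ∫ z in Ω, ((fderiv ℝ ψ z 1) ^ 2 + (fderiv ℝ ψ z I) ^ 2)) +
        2 * (δ * (volume Ω).toReal) := by
  obtain ⟨N, hN, hΩN⟩ : ∃ N : ℝ, 0 < N ∧ Ω ⊆ Metric.ball 0 N := by
    obtain ⟨r, hr⟩ := hΩb.subset_ball 0
    exact ⟨max r 1, by positivity, hr.trans (Metric.ball_subset_ball (le_max_left _ _))⟩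
  have hvol : volume Ω ≠ ⊤ := hΩb.measure_lt_top.ne
  obtain ⟨χ, hχ1, hχc, hχΩ, hχ01⟩ :=
    exists_continuousMap_one_of_isCompact_subset_isOpen hψc.isCompact hΩo hψΩ
  have hψ0 : ∀ z, z ∉ Ω → ψ z = 0 := fun z hz =>
    image_eq_zero_of_notMem_tsupport fun h => hz (hψΩ h)
  have hχ0 : ∀ z, z ∉ Ω → χ z = 0 := fun z hz =>
    image_eq_zero_of_notMem_tsupport fun h => hz (hχΩ h)
  have hd0 : ∀ z, z ∉ Ω → fderiv ℝ ψ z = 0 := fun z hz =>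
    image_eq_zero_of_notMem_tsupport fun h => hz (hψΩ (tsupport_fderiv_subset ℝ h))
  have cψ := hψ.continuous
  have cd : ∀ v, Continuous fun z => fderiv ℝ ψ z v := fun v =>
    (hψ.continuous_fderiv one_ne_zero).clm_apply continuous_const
  have hr0 : ∀ u : ℝ, 0 < √(u ^ 2 + δ ^ 2) := fun u => Real.sqrt_pos.2 (by positivity)
  set φ : ℂ → ℝ := fun z => √(ψ z ^ 2 + δ ^ 2) - δ with hφ
  set φd : ℂ → ℂ → ℝ := fun v z => ψ z / √(ψ z ^ 2 + δ ^ 2) * fderiv ℝ ψ z v with hφd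
  have cφ : Continuous φ := by fun_prop
  have cφd : ∀ v, Continuous (φd v) := fun v =>
    (cψ.div (by fun_prop) fun z => (hr0 _).ne').mul (cd v)
  have hφz : ∀ z, ψ z = 0 → φ z = 0 := fun z hz => by simp [hφ, hz, Real.sqrt_sq hδ.le]
  have hφ0 : ∀ z, z ∉ Ω → φ z = 0 := fun z hz => hφz z (hψ0 z hz)
  have hderiv : ∀ (γ : ℝ → ℂ) (v : ℂ) (t : ℝ), HasDerivAt γ v t →
      HasDerivAt (fun s => φ (γ s)) (φd v (γ t)) t := by
    intro γ v t hγ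
    have h1 : HasDerivAt (fun s => ψ (γ s)) (fderiv ℝ ψ (γ t) v) t :=
      ((hψ.differentiable one_ne_zero) (γ t)).hasFDerivAt.comp_hasDerivAt t hγ
    have h2 := (((h1.pow 2).add_const (δ ^ 2)).sqrt
      (by have := sq_nonneg (ψ (γ t)); simp only [Pi.pow_apply]; positivity)).sub_const δ
    refine h2.congr_deriv ?_
    simp only [hφd, Pi.pow_apply]
    have := hr0 (ψ (γ t))
    push_cast
    field_simp
  have hχint : ∫ z in Ω, χ z ≤ (volume Ω).toReal := by
    have := setIntegral_mono_on (μ := volume) (s := Ω) (f := χ) (g := fun _ => (1 : ℝ))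
      (χ.continuous.integrable_of_hasCompactSupport hχc).integrableOn
      (integrableOn_const hvol) hΩo.measurableSet fun z _ => (hχ01 z).2
    simpa [Measure.real] using this
  have hNnot : ∀ x y : ℝ, N ≤ |x| ∨ N ≤ |y| → φ (x + y * I) = 0 := by
    intro x y h
    refine hφ0 _ fun hz => ?_
    have hz := hΩN hz
    rw [mem_ball_zero_iff] at hz
    have h1 := (abs_re_le_norm _).trans_lt hz
    have h2 := (abs_im_le_norm _).trans_lt hz
    simp at h1 h2
    rcases h with h | h <;> linarith
  have main := sq_integral_le_of_nonneg (f := fun x y => φ (x + y * I))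
    (fx := fun x y => φd 1 (x + y * I)) (fy := fun x y => φd I (x + y * I))
    (χ := fun x y => χ (x + y * I)) (S := S) hN
    (fun x y => hderiv (fun t => t + y * I) 1 x (ofRealCLM.hasDerivAt.add_const _))
    (fun x y => hderiv (fun t => x + t * I) I y (by
      simpa using (ofRealCLM.hasDerivAt (x := y).mul_const I).const_add (x : ℂ)))
    (by fun_prop) ((cφd 1).comp (by fun_prop)) ((cφd I).comp (by fun_prop)) (by fun_prop)
    (fun x y => (sqrt_sq_add_sq_sub_bounds hδ _).1) (fun x y => (hχ01 _).1)
    (fun x y => by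
      by_cases h : ψ (x + y * I) = 0
      · left
        exact ⟨hφz _ h, by simp [hφd, h], by simp [hφd, h]⟩
      · right
        exact hχ1 (subset_tsupport _ h))
    (fun y => hNnot _ _ (Or.inl (by rw [abs_neg]; exact le_abs_self N)))
    (fun y => hNnot _ _ (Or.inl (le_abs_self N)))
    (fun x => hNnot _ _ (Or.inr (by rw [abs_neg]; exact le_abs_self N)))
    (fun x => hNnot _ _ (Or.inr (le_abs_self N)))
    (by
      rw [← setIntegral_complex_eq hN.le χ.continuous hχ0 hΩN]
      exact hχint.trans_lt hS)
  rw [← setIntegral_complex_eq hN.le cφ hφ0 hΩN,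
    ← setIntegral_complex_eq (g := fun z => φd 1 z ^ 2 + φd I z ^ 2) hN.le
      (((cφd 1).pow 2).add ((cφd I).pow 2))
      (fun z hz => by simp [hφd, hd0 z hz]) hΩN] at main
  have hint : ∀ g : ℂ → ℝ, Continuous g → IntegrableOn g Ω := fun g hg =>
    (hg.continuousOn.integrableOn_compact hΩb.isCompact_closure).mono_set subset_closure
  have hDle : ∫ z in Ω, (φd 1 z ^ 2 + φd I z ^ 2) ≤
      ∫ z in Ω, ((fderiv ℝ ψ z 1) ^ 2 + (fderiv ℝ ψ z I) ^ 2) := by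
    refine setIntegral_mono (hint _ (((cφd 1).pow 2).add ((cφd I).pow 2)))
      (hint _ (((cd 1).pow 2).add ((cd I).pow 2))) fun z => ?_
    have := (sqrt_sq_add_sq_sub_bounds hδ (ψ z)).2.2
    simp only [hφd, mul_pow]
    nlinarith [mul_le_mul_of_nonneg_right this (sq_nonneg (fderiv ℝ ψ z 1)),
      mul_le_mul_of_nonneg_right this (sq_nonneg (fderiv ℝ ψ z I))]
  have hψφ : |∫ z in Ω, ψ z| ≤ (∫ z in Ω, φ z) + δ * (volume Ω).toReal := by
    calc |∫ z in Ω, ψ z| ≤ ∫ z in Ω, |ψ z| := abs_integral_le_integral_abs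
      _ ≤ ∫ z in Ω, (φ z + δ) := setIntegral_mono (hint _ cψ.abs)
          (hint _ (cφ.add continuous_const)) fun z => (sqrt_sq_add_sq_sub_bounds hδ (ψ z)).2.1
      _ = _ := by
        rw [integral_add (hint _ cφ) (hint _ continuous_const)]
        simp [Measure.real, mul_comm]
  have hle : 2 * ∫ z in Ω, φ z ≤
      √(S ^ 2 / (2 * Real.pi) * ∫ z in Ω, ((fderiv ℝ ψ z 1) ^ 2 + (fderiv ℝ ψ z I) ^ 2)) := by
    refine Real.le_sqrt_of_sq_le ?_
    calc (2 * ∫ z in Ω, φ z) ^ 2 = 4 * (∫ z in Ω, φ z) ^ 2 := by ring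
      _ ≤ _ := main
      _ ≤ _ := mul_le_mul_of_nonneg_left hDle (by positivity)
  linarith

/-- The de St. Venant inequality `ρ(Ω) ≤ Area(Ω)²/(2π)` in distilled form: for a bounded
simply connected domain `Ω` and every smooth real `ψ` with compact support in `Ω`,
`4 (∫_Ω ψ)² ≤ (Area(Ω)²/(2π)) ∫_Ω |∇ψ|²`, where
`|∇ψ(z)|² = (∂_x ψ)² + (∂_y ψ)²` is expressed via `fderiv ℝ ψ z 1` and
`fderiv ℝ ψ z I`. -/
theorem de_st_venant_inequality
    (Ω : Set ℂ) (hΩo : IsOpen Ω) (hΩne : Ω.Nonempty) (hΩb : Bornology.IsBounded Ω)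
    (hΩsc : SimplyConnectedSpace Ω) :
    ∀ ψ : ℂ → ℝ, ContDiff ℝ (⊤ : ℕ∞) ψ → HasCompactSupport ψ → tsupport ψ ⊆ Ω →
      4 * (∫ z in Ω, ψ z) ^ 2 ≤
        ((volume Ω).toReal ^ 2 / (2 * Real.pi)) *
          ∫ z in Ω, ((fderiv ℝ ψ z 1) ^ 2 + (fderiv ℝ ψ z Complex.I) ^ 2) := by
  intro ψ hψ hψc hψΩ
  have hψ1 : ContDiff ℝ 1 ψ := hψ.of_le (by exact_mod_cast le_top)
  have hD : 0 ≤ ∫ z in Ω, ((fderiv ℝ ψ z 1) ^ 2 + (fderiv ℝ ψ z Complex.I) ^ 2) :=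
    integral_nonneg fun z => by positivity
  have bound : ∀ δ : ℝ, 0 < δ → 2 * |∫ z in Ω, ψ z| ≤
      √(((volume Ω).toReal + δ) ^ 2 / (2 * Real.pi) *
        ∫ z in Ω, ((fderiv ℝ ψ z 1) ^ 2 + (fderiv ℝ ψ z Complex.I) ^ 2)) +
          2 * (δ * (volume Ω).toReal) := fun δ hδ =>
    two_mul_abs_integral_le hΩo hΩb hψ1 hψc hψΩ (by linarith) hδ
  generalize (∫ z in Ω, ((fderiv ℝ ψ z 1) ^ 2 + (fderiv ℝ ψ z Complex.I) ^ 2)) = D at *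
  generalize (volume Ω).toReal = A at *
  have hlim : Filter.Tendsto (fun δ : ℝ => √((A + δ) ^ 2 / (2 * Real.pi) * D) + 2 * (δ * A))
      (nhdsWithin 0 (Set.Ioi 0)) (nhds (√((A + 0) ^ 2 / (2 * Real.pi) * D) + 2 * (0 * A))) :=
    ((by fun_prop : Continuous fun δ : ℝ =>
      √((A + δ) ^ 2 / (2 * Real.pi) * D) + 2 * (δ * A)).tendsto 0).mono_left nhdsWithin_le_nhds
  have h := ge_of_tendsto hlim (by filter_upwards [self_mem_nhdsWithin] with δ hδ using bound δ hδ)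
  rw [add_zero, zero_mul, mul_zero, add_zero] at h
  have h2 := pow_le_pow_left₀ (by positivity) h 2
  rw [Real.sq_sqrt (by positivity), mul_pow, sq_abs] at h2
  linarith
end
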